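/- There exists an absolute constant C_0 > 2 such that S(R_M) = s(|R_M|)·(1 + o(1)) as M → ∞ with M ∈ Ω(C_0); that is, S(R_M)/s(|R_M|) → 1 along M ∈ Ω(C_0). -/

import Mathlib

open Finset

/-- The set of quadratic residues modulo `M`, as a finset of `ZMod M`. -/
def QR (M : ℕ) : Finset (ZMod M) := (Finset.range M).image (fun a : ℕ => ((a : ZMod M)) ^ 2)

/-- The "universe" finset of `ZMod M` (all residues), valid for any `M ≥ 1`. -/
def univM (M : ℕ) : Finset (ZMod M) := (Finset.range M).image (fun a : ℕ => (a : ZMod M))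

/-- The cyclic gap from `u` to the next element of `U`: the least `k ≥ 1` with `u + k ∈ U`. -/
noncomputable def cycGap (M : ℕ) (U : Finset (ZMod M)) (u : ZMod M) : ℕ :=
  sInf {k : ℕ | 0 < k ∧ u + (k : ZMod M) ∈ U}

/-- The stochasticity parameter `S(U)`: the sum of the squares of the consecutive
(cyclic) distances between elements of `U`. -/
noncomputable def stoch (M : ℕ) (U : Finset (ZMod M)) : ℕ :=
  ∑ u ∈ U, (cycGap M U u) ^ 2

/-- `s(k) = s(k, Z_M)`: the average of `S(U)` over all subsets `U ⊆ Z_M` of size `k`. -/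
noncomputable def savg (M k : ℕ) : ℚ :=
  (∑ U ∈ (univM M).powersetCard k, (stoch M U : ℚ)) / (Nat.choose M k : ℚ)


/-- Membership in the set `Ω(C₀)` (apart from the "sufficiently large" cutoff):
`M` is square-free, `0.9 log log M < ω(M) < 1.1 log log M`, and `M = A·m` with
`3 ≤ A ≤ (log M)^0.1` and every prime divisor of `m` exceeding `(log M)^C₀`. -/
def inOmega (C₀ : ℝ) (M : ℕ) : Prop :=
  Squarefree M ∧
  0.9 * Real.log (Real.log M) < (M.primeFactors.card : ℝ) ∧
  (M.primeFactors.card : ℝ) < 1.1 * Real.log (Real.log M) ∧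
  ∃ A m : ℕ, M = A * m ∧ 3 ≤ A ∧ (A : ℝ) ≤ Real.log M ^ (0.1 : ℝ) ∧
    ∀ p : ℕ, p.Prime → p ∣ m → Real.log M ^ C₀ < (p : ℝ)

section Stepanov
open Polynomial

variable {K : Type*} [Field K]

/-- The cofactor of `f ^ (n - l)` in the `l`-th derivative of `f ^ n * r`. -/
noncomputable def derivCofactor (f : K[X]) (n : ℕ) : ℕ → K[X] →ₗ[K] K[X]
  | 0 => LinearMap.id
  | l + 1 =>
    (LinearMap.mulLeft K (((n - l : ℕ) : K[X]) * derivative f) +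
      (LinearMap.mulLeft K f).comp derivative).comp (derivCofactor f n l)

lemma derivCofactor_succ (f : K[X]) (n l : ℕ) (r : K[X]) :
    derivCofactor f n (l + 1) r =
      ((n - l : ℕ) : K[X]) * derivative f * derivCofactor f n l r +
        f * derivative (derivCofactor f n l r) := by
  simp [derivCofactor, mul_assoc]

lemma iterate_derivative_pow_mul (f : K[X]) (n l : ℕ) (hl : l ≤ n) (r : K[X]) :
    derivative^[l] (f ^ n * r) = f ^ (n - l) * derivCofactor f n l r := by
  induction l with
  | zero => simp [derivCofactor]
  | succ l ih =>
    rw [Function.iterate_succ_apply', ih (by omega), derivCofactor_succ, derivative_mul,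
      derivative_pow]
    obtain ⟨k, hk⟩ : ∃ k, n - l = k + 1 := ⟨n - l - 1, by omega⟩
    have : n - (l + 1) = k := by omega
    rw [this, hk]
    simp only [map_natCast, Nat.add_sub_cancel]
    ring

lemma degree_derivCofactor_lt (f : K[X]) (n l B : ℕ) (r : K[X]) (hr : r.degree < B)
    (hf : f ≠ 0) :
    (derivCofactor f n l r).degree < (B + l * f.natDegree : ℕ) := by
  induction l with
  | zero => simpa [derivCofactor] using hr
  | succ l ih =>
    rw [derivCofactor_succ]
    have e : ((B + (l + 1) * f.natDegree : ℕ) : WithBot ℕ) =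
        f.degree + ((B + l * f.natDegree : ℕ) : WithBot ℕ) := by
      rw [degree_eq_natDegree hf]; norm_cast; ring
    rw [e]
    have hfd : f.degree ≠ ⊥ := by simpa using hf
    refine lt_of_le_of_lt (degree_add_le _ _) (max_lt ?_ ?_)
    · calc _ ≤ (((n - l : ℕ) : K[X]) * derivative f).degree + (derivCofactor f n l r).degree :=
            degree_mul_le _ _
        _ ≤ f.degree + (derivCofactor f n l r).degree := by
            gcongr
            refine (degree_mul_le _ _).trans ?_
            have h1 : (((n - l : ℕ) : K[X])).degree ≤ 0 := degree_natCast_le _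
            calc _ ≤ 0 + f.degree := add_le_add h1 (degree_derivative_le)
              _ = _ := zero_add _
        _ < _ := WithBot.add_lt_add_left hfd ih
    · calc _ ≤ f.degree + (derivative (derivCofactor f n l r)).degree := degree_mul_le _ _
        _ ≤ f.degree + (derivCofactor f n l r).degree := by
            gcongr; exact degree_derivative_le
        _ < _ := WithBot.add_lt_add_left hfd ih

lemma derivative_mul_X_pow_mul_char (p : ℕ) [CharP K p] (u : K[X]) (j : ℕ) :
    derivative (u * X ^ (p * j)) = derivative u * X ^ (p * j) := by
  simp [derivative_mul, derivative_X_pow]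

lemma iterate_derivative_mul_X_pow_mul_char (p : ℕ) [CharP K p] (u : K[X]) (j l : ℕ) :
    derivative^[l] (u * X ^ (p * j)) = derivative^[l] u * X ^ (p * j) := by
  induction l with
  | zero => simp
  | succ l ih => rw [Function.iterate_succ_apply', ih, derivative_mul_X_pow_mul_char,
      Function.iterate_succ_apply']


section ZModStepanov
variable {p : ℕ} [Fact p.Prime]

lemma pow_card_eq_C_add (f : (ZMod p)[X]) :
    ∃ q : (ZMod p)[X], f ^ p = C (f.eval 0) + X ^ p * q := by
  obtain ⟨q, hq⟩ : X ∣ f - C (f.eval 0) := by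
    rw [X_dvd_iff]; simp [coeff_zero_eq_eval_zero]
  refine ⟨q ^ p, ?_⟩
  have h := congrArg (· ^ p) hq
  simp only [sub_pow_char, mul_pow, ← C_pow, ZMod.pow_card] at h
  rw [← h]; ring

/-- A relation `r + g s = 0` modulo `X ^ p`, where `g ^ 2 f = f ^ p`, is trivial for `r`, `s` of
small degree, as soon as `f` has a root of odd multiplicity. -/
lemma eq_zero_of_sq_mul_eq {f : (ZMod p)[X]} (hf0 : f.eval 0 ≠ 0) {c : ZMod p}
    (hc : Odd (f.rootMultiplicity c)) {B : ℕ} (hB : 2 * (B - 1) + f.natDegree < p)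
    {r s R S : (ZMod p)[X]} (hr : r.degree < B) (hs : s.degree < B)
    (h : (r + X ^ p * R) ^ 2 * f = f ^ p * (s + X ^ p * S) ^ 2) : r = 0 ∧ s = 0 := by
  obtain ⟨q, hq⟩ := pow_card_eq_C_add f
  have hf : f ≠ 0 := by rintro rfl; simp at hf0
  have hnr : r.natDegree ≤ B - 1 := by
    rcases eq_or_ne r 0 with rfl | h0
    · simp
    · have := (natDegree_lt_iff_degree_lt h0).2 hr; omega
  have hns : s.natDegree ≤ B - 1 := by
    rcases eq_or_ne s 0 with rfl | h0
    · simp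
    · have := (natDegree_lt_iff_degree_lt h0).2 hs; omega
  have key : r ^ 2 * f - C (f.eval 0) * s ^ 2 = 0 := by
    refine eq_zero_of_dvd_of_natDegree_lt (p := X ^ p) ?_ ?_
    · rw [hq] at h
      refine ⟨q * (s + X ^ p * S) ^ 2 + C (f.eval 0) * (2 * s * S + X ^ p * S ^ 2)
        - (2 * r * R + X ^ p * R ^ 2) * f, ?_⟩
      linear_combination h
    · rw [natDegree_X_pow]
      refine lt_of_le_of_lt (natDegree_sub_le _ _) (max_lt ?_ ?_)
      · refine lt_of_le_of_lt natDegree_mul_le ?_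
        have := natDegree_pow_le (p := r) (n := 2)
        omega
      · refine lt_of_le_of_lt (natDegree_C_mul_le _ _) ?_
        have := natDegree_pow_le (p := s) (n := 2)
        omega
  have hC : C (f.eval 0) ≠ 0 := by simpa using hf0
  by_cases hr0 : r = 0
  · refine ⟨hr0, ?_⟩
    subst hr0
    simpa [hf0] using key
  · exfalso
    have hs0 : s ≠ 0 := by
      rintro rfl
      simp [hr0, hf] at key
    have e := congrArg (rootMultiplicity c) (sub_eq_zero.1 key)
    rw [rootMultiplicity_mul (mul_ne_zero (pow_ne_zero _ hr0) hf),
      rootMultiplicity_mul (mul_ne_zero hC (pow_ne_zero _ hs0)), sq, sq,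
      rootMultiplicity_mul (mul_ne_zero hr0 hr0), rootMultiplicity_mul (mul_ne_zero hs0 hs0),
      rootMultiplicity_C] at e
    obtain ⟨k, hk⟩ := hc
    omega

lemma stepanov_independence {f : (ZMod p)[X]} (hf0 : f.eval 0 ≠ 0) {c : ZMod p}
    (hc : Odd (f.rootMultiplicity c)) {B e : ℕ} (hB : 2 * (B - 1) + f.natDegree < p)
    (he : 2 * e + 1 = p) (J : ℕ) :
    ∀ r s : ℕ → (ZMod p)[X], (∀ j, (r j).degree < B) → (∀ j, (s j).degree < B) →
      ∑ j ∈ range J, (r j + f ^ e * s j) * X ^ (p * j) = 0 →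
      ∀ j < J, r j = 0 ∧ s j = 0 := by
  induction J with
  | zero => intro r s _ _ _ j hj; omega
  | succ J ih =>
    intro r s hr hs h
    have hX : (X ^ p : (ZMod p)[X]) ≠ 0 := pow_ne_zero _ X_ne_zero
    set R := ∑ j ∈ range J, r (j + 1) * X ^ (p * j) with hR
    set S := ∑ j ∈ range J, s (j + 1) * X ^ (p * j) with hS
    have hRS : ∑ j ∈ range J, (r (j + 1) + f ^ e * s (j + 1)) * X ^ (p * j) = R + f ^ e * S := by
      rw [hR, hS, mul_sum, ← sum_add_distrib]
      exact sum_congr rfl fun j _ => by ring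
    have hsh : ∑ j ∈ range J, (r (j + 1) + f ^ e * s (j + 1)) * X ^ (p * (j + 1)) =
        X ^ p * (R + f ^ e * S) := by
      rw [← hRS, mul_sum]
      refine sum_congr rfl fun j _ => ?_
      rw [mul_add p j 1, mul_one, pow_add]
      ring
    have h' : (r 0 + f ^ e * s 0) + X ^ p * (R + f ^ e * S) = 0 := by
      rw [sum_range_succ', hsh, mul_zero, pow_zero, mul_one] at h
      rw [add_comm]
      exact h
    clear_value R S
    have h0 : r 0 = 0 ∧ s 0 = 0 := by
      refine eq_zero_of_sq_mul_eq hf0 hc hB (hr 0) (hs 0) (R := R) (S := S) ?_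
      have e1 : r 0 + X ^ p * R = - (f ^ e * (s 0 + X ^ p * S)) := by linear_combination h'
      have e2 : f ^ p = f ^ (2 * e + 1) := by rw [he]
      rw [e1, e2]; ring
    rw [h0.1, h0.2] at h'
    have h2 : R + f ^ e * S = 0 := by simpa [hX] using h'
    rw [← hRS] at h2
    intro j hj
    rcases j with _ | j
    · exact h0
    · exact ih (fun j => r (j + 1)) (fun j => s (j + 1)) (fun j => hr _) (fun j => hs _) h2 j
        (by omega)

lemma finrank_degreeLT_eq (F : Type*) [Field F] (n : ℕ) :
    Module.finrank F (degreeLT F n) = n := by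
  rw [(degreeLTEquiv F n).finrank_eq]; simp

/-- Existence of the auxiliary polynomial coefficients in Stepanov's method. -/
lemma exists_stepanov_coeffs (f : (ZMod p)[X]) (hf : f ≠ 0) (a : ZMod p) {B J L e : ℕ}
    (hdim : L * (B + L * f.natDegree + J) < 2 * J * B) :
    ∃ r s : ℕ → (ZMod p)[X], (∀ j, (r j).degree < B) ∧ (∀ j, (s j).degree < B) ∧
      (∃ j < J, r j ≠ 0 ∨ s j ≠ 0) ∧
      ∀ l < L, ∑ j ∈ range J,
        (derivCofactor f L l (r j) + C a * derivCofactor f (L + e) l (s j)) * X ^ j = 0 := by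
  classical
  let V := (Fin J → degreeLT (ZMod p) B) × (Fin J → degreeLT (ZMod p) B)
  let T : Fin L → V →ₗ[ZMod p] (ZMod p)[X] := fun l =>
    ∑ j : Fin J, (LinearMap.mulRight (ZMod p) (X ^ (j : ℕ))).comp
      ((derivCofactor f L l).comp ((degreeLT (ZMod p) B).subtype.comp
          ((LinearMap.proj j).comp (LinearMap.fst _ _ _))) +
        (LinearMap.mulLeft (ZMod p) (C a)).comp ((derivCofactor f (L + e) l).comp
          ((degreeLT (ZMod p) B).subtype.comp ((LinearMap.proj j).comp (LinearMap.snd _ _ _)))))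
  have hT : ∀ l v, T l v = ∑ j : Fin J, (derivCofactor f L l (v.1 j : (ZMod p)[X]) +
      C a * derivCofactor f (L + e) l (v.2 j : (ZMod p)[X])) * X ^ (j : ℕ) := by
    intro l v
    simp only [T, LinearMap.sum_apply]
    rfl
  have hdeg : ∀ l v, T l v ∈ degreeLT (ZMod p) (B + L * f.natDegree + J) := by
    intro l v
    rw [hT]
    refine Submodule.sum_mem _ fun j _ => ?_
    have h1 : ∀ (n : ℕ) (w : degreeLT (ZMod p) B),
        (derivCofactor f n l (w : (ZMod p)[X])).degree < (B + L * f.natDegree : ℕ) := by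
      intro n w
      refine (degree_derivCofactor_lt f n l B w (mem_degreeLT.1 w.2) hf).trans_le ?_
      have := Nat.mul_le_mul_right f.natDegree l.2.le
      exact_mod_cast Nat.add_le_add_left this B
    have h2 : (derivCofactor f L l (v.1 j : (ZMod p)[X]) +
      C a * derivCofactor f (L + e) l (v.2 j : (ZMod p)[X])) ∈
        degreeLT (ZMod p) (B + L * f.natDegree) := by
      refine Submodule.add_mem _ (mem_degreeLT.2 (h1 _ _)) ?_
      rw [← smul_eq_C_mul]
      exact Submodule.smul_mem _ _ (mem_degreeLT.2 (h1 _ _))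
    rw [mem_degreeLT] at h2 ⊢
    set u := (derivCofactor f L l (v.1 j : (ZMod p)[X]) +
      C a * derivCofactor f (L + e) l (v.2 j : (ZMod p)[X]))
    rcases eq_or_ne u 0 with h0 | h0
    · rw [h0, zero_mul, degree_zero]; exact WithBot.bot_lt_coe _
    · rw [degree_mul, degree_X_pow, degree_eq_natDegree h0]
      rw [degree_eq_natDegree h0] at h2
      have := j.2
      norm_cast at h2 ⊢
      omega
  let Φ : V →ₗ[ZMod p] (Fin L → degreeLT (ZMod p) (B + L * f.natDegree + J)) :=
    LinearMap.pi fun l => (T l).codRestrict _ (hdeg l)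
  have hker : LinearMap.ker Φ ≠ ⊥ := by
    refine LinearMap.ker_ne_bot_of_finrank_lt ?_
    rw [Module.finrank_pi_fintype, Module.finrank_prod, Module.finrank_pi_fintype]
    simp only [finrank_degreeLT_eq, sum_const, card_univ, Fintype.card_fin, smul_eq_mul]
    calc _ < _ := hdim
      _ = _ := by ring
  obtain ⟨v, hv, hv0⟩ := Submodule.exists_mem_ne_zero_of_ne_bot hker
  refine ⟨fun j => if h : j < J then v.1 ⟨j, h⟩ else 0, fun j => if h : j < J then v.2 ⟨j, h⟩ else 0,
    ?_, ?_, ?_, ?_⟩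
  · intro j
    by_cases h : j < J
    · simpa [h] using mem_degreeLT.1 (v.1 ⟨j, h⟩).2
    · simp [h]
  · intro j
    by_cases h : j < J
    · simpa [h] using mem_degreeLT.1 (v.2 ⟨j, h⟩).2
    · simp [h]
  · by_contra! hcon
    apply hv0
    have : ∀ j : Fin J, (v.1 j : (ZMod p)[X]) = 0 ∧ (v.2 j : (ZMod p)[X]) = 0 := by
      intro j
      simpa [j.2] using hcon j j.2
    refine Prod.ext (funext fun j => Subtype.ext ?_) (funext fun j => Subtype.ext ?_)
    · simpa using (this j).1
    · simpa using (this j).2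
  · intro l hl
    have h1 : T ⟨l, hl⟩ v = 0 := by
      have := congrFun (LinearMap.mem_ker.1 hv) ⟨l, hl⟩
      exact congrArg Subtype.val this
    rw [hT] at h1
    refine Eq.trans ?_ h1
    beta_reduce
    rw [← Fin.sum_univ_eq_sum_range]
    exact sum_congr rfl fun j _ => by simp

/-- Stepanov's bound for the number of `x` with `f(x) ^ ((p - 1) / 2) = a`. -/
lemma stepanov_card_mul_le {f : (ZMod p)[X]} (hf0 : f.eval 0 ≠ 0) {c : ZMod p}
    (hc : Odd (f.rootMultiplicity c)) {a : ZMod p} {B J L e : ℕ}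
    (hB : 2 * (B - 1) + f.natDegree < p) (he : 2 * e + 1 = p) (hL : L ≤ p)
    (hdim : L * (B + L * f.natDegree + J) < 2 * J * B) (N : Finset (ZMod p))
    (hN : ∀ x ∈ N, f.eval x ^ e = a) :
    L * N.card ≤ (L + e) * f.natDegree + B + p * J := by
  classical
  have hf : f ≠ 0 := by rintro rfl; simp at hf0
  obtain ⟨r, s, hr, hs, ⟨j0, hj0, hne⟩, hG⟩ := exists_stepanov_coeffs f hf a (e := e) hdim
  set F : (ZMod p)[X] := ∑ j ∈ range J, (f ^ L * r j + f ^ (L + e) * s j) * X ^ (p * j) with hF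
  have hFfac : F = f ^ L * ∑ j ∈ range J, (r j + f ^ e * s j) * X ^ (p * j) := by
    rw [hF, mul_sum]
    refine sum_congr rfl fun j _ => ?_
    rw [pow_add]; ring
  have hF0 : F ≠ 0 := by
    intro h
    rw [hFfac] at h
    have h' := (mul_eq_zero.1 h).resolve_left (pow_ne_zero _ hf)
    have := stepanov_independence hf0 hc hB he J r s hr hs h' j0 hj0
    tauto
  have hD : ∀ l ≤ L, derivative^[l] F = ∑ j ∈ range J, (f ^ (L - l) * derivCofactor f L l (r j) +
      f ^ (L + e - l) * derivCofactor f (L + e) l (s j)) * X ^ (p * j) := by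
    intro l hl
    rw [hF, iterate_derivative_sum]
    refine sum_congr rfl fun j _ => ?_
    rw [iterate_derivative_mul_X_pow_mul_char, iterate_map_add,
      iterate_derivative_pow_mul _ _ _ hl, iterate_derivative_pow_mul _ _ _ (by omega)]
  have hroot : ∀ x ∈ N, ∀ l < L, (derivative^[l] F).IsRoot x := by
    intro x hx l hl
    rw [IsRoot, hD l hl.le, eval_finsetSum]
    have h1 : ∀ j, eval x ((f ^ (L - l) * derivCofactor f L l (r j) +
        f ^ (L + e - l) * derivCofactor f (L + e) l (s j)) * X ^ (p * j)) =
        eval x f ^ (L - l) * eval x ((derivCofactor f L l (r j) +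
          C a * derivCofactor f (L + e) l (s j)) * X ^ j) := by
      intro j
      have : L + e - l = (L - l) + e := by omega
      simp only [eval_mul, eval_add, eval_pow, eval_X, eval_C, pow_mul, ZMod.pow_card, this,
        pow_add, hN x hx]
      ring
    simp only [h1]
    rw [← mul_sum, ← eval_finsetSum, hG l hl]
    simp
  have hmult : ∀ x ∈ N, L ≤ F.rootMultiplicity x := by
    intro x hx
    rcases Nat.eq_zero_or_pos L with h0 | h0
    · omega
    have := lt_rootMultiplicity_of_isRoot_iterate_derivative_of_mem_nonZeroDivisors'
      (t := x) (n := L - 1) hF0 (fun m hm => hroot x hx m (by omega)) (by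
        intro m hm hm0
        refine mem_nonZeroDivisors_of_ne_zero ?_
        intro h
        rw [ZMod.natCast_eq_zero_iff] at h
        have := Nat.le_of_dvd (Nat.pos_of_ne_zero hm0) h
        omega)
    omega
  have hcard : L * N.card ≤ F.natDegree := by
    calc L * N.card = ∑ x ∈ N, L := by rw [sum_const, smul_eq_mul, mul_comm]
      _ ≤ ∑ x ∈ N, F.roots.count x := sum_le_sum fun x hx => by
          rw [count_roots]; exact hmult x hx
      _ ≤ Multiset.card F.roots := by
          rw [← Multiset.sum_count_eq_card (s := N ∪ F.roots.toFinset)]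
          · exact sum_le_sum_of_subset subset_union_left
          · intro x hx; simp [Multiset.mem_toFinset.2 hx]
      _ ≤ F.natDegree := card_roots' F
  refine hcard.trans ?_
  have hnd : ∀ u : (ZMod p)[X], u.degree < B → u.natDegree ≤ B := by
    intro u hu
    exact natDegree_le_of_degree_le hu.le
  rw [hF]
  refine natDegree_sum_le_of_forall_le _ _ fun j hj => ?_
  have hj' : j ≤ J := (mem_range.1 hj).le
  refine natDegree_mul_le.trans ?_
  rw [natDegree_X_pow]
  refine Nat.add_le_add ((natDegree_add_le _ _).trans (max_le ?_ ?_)) (Nat.mul_le_mul_left _ hj')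
  · refine natDegree_mul_le.trans (Nat.add_le_add (natDegree_pow_le.trans ?_) (hnd _ (hr j)))
    gcongr; omega
  · exact natDegree_mul_le.trans (Nat.add_le_add natDegree_pow_le (hnd _ (hs j)))

lemma stepanov_card_le {f : (ZMod p)[X]} (hf0 : f.eval 0 ≠ 0) {c : ZMod p}
    (hc : Odd (f.rootMultiplicity c)) (hp2 : p ≠ 2) (hp : 400 * f.natDegree ^ 2 < p) (a : ZMod p)
    (N : Finset (ZMod p)) (hN : ∀ x ∈ N, f.eval x ^ (p / 2) = a) :
    (N.card : ℝ) ≤ p / 2 + 9 * f.natDegree * √p := by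
  have hf : f ≠ 0 := by rintro rfl; simp at hf0
  set d := f.natDegree with hd
  have hd1 : 1 ≤ d := by
    have h1 : f.rootMultiplicity c ≤ d :=
      (count_roots f (a := c) ▸ Multiset.count_le_card c f.roots).trans (card_roots' f)
    have := hc.pos
    omega
  have hodd : 2 * (p / 2) + 1 = p := by
    have := (Fact.out : p.Prime).eq_two_or_odd
    omega
  set e := p / 2 with he
  set L := Nat.sqrt p with hL
  have hL1 : L * L ≤ p := Nat.sqrt_le p
  have hL2 : p < (L + 1) * (L + 1) := Nat.lt_succ_sqrt p
  have hLd : 20 * d ≤ L := by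
    rw [hL, Nat.le_sqrt]; nlinarith
  obtain ⟨B, hB1, hB2⟩ : ∃ B, 2 * B + d ≤ p ∧ p ≤ 2 * B + d + 1 :=
    ⟨(p - d) / 2, by have : d ≤ p := by nlinarith
                     omega, by omega⟩
  obtain ⟨J, hJ1, hJ2⟩ : ∃ J, L + 2 * (d + 2) ≤ 2 * J ∧ 2 * J ≤ L + 1 + 2 * (d + 2) :=
    ⟨(L + 1) / 2 + (d + 2), by omega, by omega⟩
  have hdim : L * (B + L * d + J) < 2 * J * B := by
    zify at *
    have e1 : (L : ℤ) * L * d ≤ p * d := by gcongr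
    have e2 : (2 * J : ℤ) * L ≤ (L + 1 + 2 * (d + 2)) * L := by gcongr
    have e3 : (L + 2 * (d + 2) : ℤ) * B ≤ 2 * J * B := by gcongr
    have e4 : (20 * d : ℤ) * L ≤ L * L := by gcongr
    have e5 : (d + 2 : ℤ) * p ≤ (d + 2) * (2 * B + d + 1) := by gcongr
    have e6 : (L : ℤ) ≤ d * L := by nlinarith
    have e7 : (d : ℤ) ≤ d ^ 2 := by nlinarith
    nlinarith
  have hdp : d < p := by nlinarith
  have key := stepanov_card_mul_le hf0 hc (a := a) (B := B) (J := J) (L := L) (e := e)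
    (by omega) hodd (by nlinarith) hdim N hN
  rw [← hd] at key
  have key' : 2 * (L * N.card) ≤ 2 * L * d + p * d + p + p * (L + 1 + 2 * (d + 2)) := by
    have e1 : p * (2 * J) ≤ p * (L + 1 + 2 * (d + 2)) := by gcongr
    have e2 : 2 * e * d ≤ p * d := by gcongr; omega
    nlinarith
  have hLr : (L : ℝ) ≤ √p := by
    rw [hL]; exact Real.nat_sqrt_le_real_sqrt
  have hL0 : (0 : ℝ) < L := by
    have : 0 < L := by omega
    exact_mod_cast this
  have key'' : 2 * ((L : ℝ) * N.card) ≤ 2 * L * d + p * d + p + p * (L + 1 + 2 * (d + 2)) := by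
    exact_mod_cast key'
  have hp3 : (p : ℝ) ≤ L * (L * 1.2) := by
    have h1 : (p : ℝ) < (L + 1) * (L + 1) := by exact_mod_cast hL2
    have h2 : (20 : ℝ) ≤ L := by
      have : 20 ≤ L := by omega
      exact_mod_cast this
    nlinarith
  have hd1' : (1 : ℝ) ≤ d := by exact_mod_cast hd1
  have h3 : (L : ℝ) * N.card ≤ L * (p / 2 + 9 * d * L) := by
    have h2 : (20 : ℝ) ≤ L := by
      have : 20 ≤ L := by omega
      exact_mod_cast this
    have h4 : (p : ℝ) * (3 * d + 6) ≤ L * (L * 1.2) * (3 * d + 6) := by gcongr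
    have h5 : L * (L * 1.2) * (3 * d + 6) ≤ L * (L * 1.2) * (9 * d : ℝ) := by gcongr; linarith
    have h6 : (L : ℝ) * d ≤ L * (L * d) := by nlinarith
    nlinarith
  have h4 := le_of_mul_le_mul_left h3 hL0
  have : (d : ℝ) * L ≤ d * √p := by gcongr
  nlinarith

lemma abs_sum_quadraticChar_eval_le {f : (ZMod p)[X]} (hf0 : f.eval 0 ≠ 0) {c : ZMod p}
    (hc : Odd (f.rootMultiplicity c)) (hp2 : p ≠ 2) :
    |∑ x : ZMod p, (quadraticChar (ZMod p) (f.eval x) : ℝ)| ≤ 20 * f.natDegree * √p := by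
  classical
  have hf : f ≠ 0 := by rintro rfl; simp at hf0
  set d := f.natDegree with hd
  have hd1 : 1 ≤ d := by
    have h1 : f.rootMultiplicity c ≤ d :=
      (count_roots f (a := c) ▸ Multiset.count_le_card c f.roots).trans (card_roots' f)
    have := hc.pos
    omega
  have hsq : √(p : ℝ) * √p = p := Real.mul_self_sqrt (Nat.cast_nonneg p)
  have hs0 : 0 ≤ √(p : ℝ) := Real.sqrt_nonneg _
  have hchar : ∀ y : ZMod p, |(quadraticChar (ZMod p) y : ℝ)| ≤ 1 := by
    intro y
    rcases eq_or_ne y 0 with rfl | hy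
    · simp
    · rcases quadraticChar_dichotomy hy with h | h <;> simp [h]
  rcases le_or_gt p (400 * d ^ 2) with hp | hp
  · have h1 : |∑ x : ZMod p, (quadraticChar (ZMod p) (f.eval x) : ℝ)| ≤ p := by
      refine (abs_sum_le_sum_abs _ _).trans ((sum_le_sum fun x _ => hchar _).trans ?_)
      simp [ZMod.card]
    have h2 : √(p : ℝ) ≤ 20 * d := by
      rw [Real.sqrt_le_left (by positivity)]
      have : (p : ℝ) ≤ 400 * d ^ 2 := by exact_mod_cast hp
      linarith
    nlinarith
  · have hrc : ringChar (ZMod p) ≠ 2 := by rwa [ZMod.ringChar_zmod_n]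
    have hcardp : Fintype.card (ZMod p) = p := ZMod.card p
    set N1 : Finset (ZMod p) := univ.filter fun x => quadraticChar (ZMod p) (f.eval x) = 1
    set N2 : Finset (ZMod p) := univ.filter fun x => quadraticChar (ZMod p) (f.eval x) = -1
    set N0 : Finset (ZMod p) := univ.filter fun x => f.eval x = 0
    have hN1 : (N1.card : ℝ) ≤ p / 2 + 9 * d * √p := by
      refine stepanov_card_le hf0 hc hp2 hp 1 N1 fun x hx => ?_
      have h := (mem_filter.1 hx).2
      have := quadraticChar_eq_pow_of_char_ne_two' hrc (f.eval x)
      rw [h, hcardp] at this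
      simpa using this.symm
    have hN2 : (N2.card : ℝ) ≤ p / 2 + 9 * d * √p := by
      refine stepanov_card_le hf0 hc hp2 hp (-1) N2 fun x hx => ?_
      have h := (mem_filter.1 hx).2
      have := quadraticChar_eq_pow_of_char_ne_two' hrc (f.eval x)
      rw [h, hcardp] at this
      simpa using this.symm
    have hN0 : (N0.card : ℝ) ≤ d := by
      have h1 : N0.card ≤ d := by
        refine le_trans (card_le_card (t := f.roots.toFinset) fun x hx => ?_)
          ((Multiset.toFinset_card_le _).trans (card_roots' f))
        rw [Multiset.mem_toFinset, mem_roots hf]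
        exact (mem_filter.1 hx).2
      exact_mod_cast h1
    have hpt : ∀ y : ZMod p, (1 : ℝ) = (if quadraticChar (ZMod p) y = 1 then 1 else 0) +
        (if quadraticChar (ZMod p) y = -1 then 1 else 0) + (if y = 0 then 1 else 0) := by
      intro y
      rcases eq_or_ne y 0 with rfl | hy
      · simp
      · rcases quadraticChar_dichotomy hy with h | h
        · simp [h, hy]
        · simp [h, hy]
    have hpt2 : ∀ y : ZMod p, (quadraticChar (ZMod p) y : ℝ) =
        (if quadraticChar (ZMod p) y = 1 then 1 else 0) -
        (if quadraticChar (ZMod p) y = -1 then 1 else 0) := by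
      intro y
      rcases eq_or_ne y 0 with rfl | hy
      · simp
      · rcases quadraticChar_dichotomy hy with h | h
        · simp [h]
        · simp [h]
    have htot : (p : ℝ) = N1.card + N2.card + N0.card := by
      have : (p : ℝ) = ∑ x : ZMod p, (1 : ℝ) := by simp [ZMod.card]
      rw [this, sum_congr rfl fun x _ => hpt (f.eval x), sum_add_distrib, sum_add_distrib]
      simp [N1, N2, N0, sum_boole]
    have hsum : ∑ x : ZMod p, (quadraticChar (ZMod p) (f.eval x) : ℝ) = N1.card - N2.card := by
      rw [sum_congr rfl fun x _ => hpt2 (f.eval x), sum_sub_distrib]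
      simp [N1, N2, sum_boole]
    have h1p : 1 ≤ √(p : ℝ) := by
      rw [Real.one_le_sqrt]
      exact_mod_cast (Fact.out : p.Prime).one_lt.le
    have hd0 : (0 : ℝ) ≤ d := Nat.cast_nonneg d
    rw [hsum, abs_le]
    constructor <;> nlinarith

end ZModStepanov

end Stepanov

/-- Weil's bound (with a worse constant) for products of shifted quadratic characters. -/
lemma abs_sum_prod_quadraticChar_le {p : ℕ} [Fact p.Prime] (hp2 : p ≠ 2) {ι : Type*}
    (s : Finset ι) (h : ι → ZMod p) (hodd : ∃ c, Odd (s.filter fun i => h i = c).card) :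
    |∑ x : ZMod p, ∏ i ∈ s, (quadraticChar (ZMod p) (x + h i) : ℝ)| ≤ 20 * s.card * √p := by
  classical
  have hs0 : 0 ≤ √(p : ℝ) := Real.sqrt_nonneg _
  have hsq : √(p : ℝ) * √p = p := Real.mul_self_sqrt (Nat.cast_nonneg p)
  have hchar : ∀ y : ZMod p, |(quadraticChar (ZMod p) y : ℝ)| ≤ 1 := by
    intro y
    rcases eq_or_ne y 0 with rfl | hy
    · simp
    · rcases quadraticChar_dichotomy hy with h | h <;> simp [h]
  rcases le_or_gt p s.card with hps | hps
  · have h1 : |∑ x : ZMod p, ∏ i ∈ s, (quadraticChar (ZMod p) (x + h i) : ℝ)| ≤ p := by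
      refine (abs_sum_le_sum_abs _ _).trans ((sum_le_sum (g := fun _ => (1 : ℝ)) fun x _ => ?_).trans
        ?_)
      · rw [abs_prod]
        exact prod_le_one (fun _ _ => abs_nonneg _) fun _ _ => hchar _
      · simp [ZMod.card]
    have h2 : (p : ℝ) ≤ s.card := by exact_mod_cast hps
    have h1p : 1 ≤ √(p : ℝ) := by
      rw [Real.one_le_sqrt]
      exact_mod_cast (Fact.out : p.Prime).one_lt.le
    nlinarith
  · obtain ⟨t, ht⟩ : ∃ t : ZMod p, ∀ i ∈ s, t + h i ≠ 0 := by
      have hc : (s.image fun i => - h i).card < (univ : Finset (ZMod p)).card := by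
        rw [card_univ, ZMod.card]
        exact card_image_le.trans_lt hps
      obtain ⟨t, -, ht⟩ := exists_mem_notMem_of_card_lt_card hc
      refine ⟨t, fun i hi h0 => ht (mem_image.2 ⟨i, hi, ?_⟩)⟩
      linear_combination -h0
    let f : Polynomial (ZMod p) := ∏ i ∈ s, (Polynomial.X + Polynomial.C (t + h i))
    have hfdeg : f.natDegree = s.card := by
      simp only [f]
      rw [Polynomial.natDegree_prod_of_monic _ _ fun i _ => Polynomial.monic_X_add_C _]
      rw [sum_congr rfl fun i _ => Polynomial.natDegree_X_add_C (t + h i)]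
      simp
    have hfe : ∀ x, f.eval x = ∏ i ∈ s, (x + (t + h i)) := by
      intro x; simp [f, Polynomial.eval_prod]
    obtain ⟨c, hc⟩ := hodd
    have hf0 : f.eval 0 ≠ 0 := by
      rw [hfe, prod_ne_zero_iff]
      simpa using ht
    have hroot : f.rootMultiplicity (-(t + c)) = (s.filter fun i => h i = c).card := by
      rw [← Polynomial.count_roots]
      have hfr : f.roots = s.val.map fun i => -(t + h i) := by
        have : f = (Multiset.map (fun a => Polynomial.X - Polynomial.C a)
            (s.val.map fun i => -(t + h i))).prod := by
          simp only [f, Multiset.map_map]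
          refine prod_congr rfl fun i _ => ?_
          rw [Function.comp, Polynomial.C_neg, sub_neg_eq_add]
        rw [this, Polynomial.roots_multiset_prod_X_sub_C]
      rw [hfr, Multiset.count_map, Finset.card_def, filter_val]
      congr 1
      refine Multiset.filter_congr fun i _ => ?_
      constructor
      · intro h'; linear_combination h'
      · intro h'; rw [h']
    have key := abs_sum_quadraticChar_eval_le hf0 (hroot ▸ hc) hp2
    rw [hfdeg] at key
    convert key using 2
    rw [← Equiv.sum_comp (Equiv.addRight t)]
    refine sum_congr rfl fun x _ => ?_
    rw [hfe, map_prod]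
    push_cast
    refine prod_congr rfl fun i _ => ?_
    simp [add_assoc]

/-! ### Sums over residues modulo products of primes -/

lemma sum_range_mul_mod {a b : ℕ} (hab : a.Coprime b) (ha : 0 < a) (hb : 0 < b)
    (H : ℕ → ℕ → ℝ) :
    ∑ x ∈ range (a * b), H (x % a) (x % b) = ∑ u ∈ range a, ∑ v ∈ range b, H u v := by
  rw [← sum_product' (range a) (range b) H]
  refine sum_nbij' (fun x => (x % a, x % b)) (fun uv => Nat.chineseRemainder hab uv.1 uv.2)
    ?_ ?_ ?_ ?_ ?_
  · intro x _
    simp [Nat.mod_lt, ha, hb]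
  · intro uv _
    simpa using Nat.chineseRemainder_lt_mul hab uv.1 uv.2 ha.ne' hb.ne'
  · intro x hx
    have := Nat.chineseRemainder_modEq_unique hab (a := x % a) (b := x % b) (z := x)
      (Nat.mod_modEq _ _).symm (Nat.mod_modEq _ _).symm
    have h2 := Nat.chineseRemainder_lt_mul hab (x % a) (x % b) ha.ne' hb.ne'
    exact (Nat.ModEq.eq_of_lt_of_lt this (mem_range.1 hx) h2).symm
  · rintro ⟨u, v⟩ huv
    simp only [mem_product, mem_range] at huv
    have h1 := (Nat.chineseRemainder hab u v).2
    have h2 : _ % a = u % a := h1.1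
    have h3 : _ % b = v % b := h1.2
    rw [Nat.mod_eq_of_lt huv.1] at h2
    rw [Nat.mod_eq_of_lt huv.2] at h3
    exact Prod.ext h2 h3
  · intro x _
    rfl

lemma prod_primes_pos {P : Finset ℕ} (hP : ∀ p ∈ P, p.Prime) : 0 < ∏ p ∈ P, p :=
  prod_pos fun p hp => (hP p hp).pos

lemma coprime_prod_primes {P : Finset ℕ} (hP : ∀ p ∈ P, p.Prime) {q : ℕ} (hq : q.Prime)
    (hqP : q ∉ P) : q.Coprime (∏ p ∈ P, p) :=
  Nat.Coprime.prod_right fun p hp =>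
    (Nat.coprime_primes hq (hP p hp)).2 fun h => hqP (h ▸ hp)

lemma sum_range_prod_primes {P : Finset ℕ} (hP : ∀ p ∈ P, p.Prime) (F : ℕ → ℕ → ℝ)
    (hF : ∀ p ∈ P, ∀ x, F p (x % p) = F p x) :
    ∑ x ∈ range (∏ p ∈ P, p), ∏ p ∈ P, F p x = ∏ p ∈ P, ∑ x ∈ range p, F p x := by
  classical
  induction P using Finset.induction_on with
  | empty => simp
  | insert q P hq ih =>
    have hP' : ∀ p ∈ P, p.Prime := fun p hp => hP p (mem_insert_of_mem hp)
    have hF' : ∀ p ∈ P, ∀ x, F p (x % p) = F p x := fun p hp => hF p (mem_insert_of_mem hp)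
    have hqp := hP q (mem_insert_self _ _)
    rw [prod_insert hq, prod_insert hq, ← ih hP' hF', sum_mul_sum,
      ← sum_range_mul_mod (coprime_prod_primes hP' hqp hq) hqp.pos (prod_primes_pos hP')
        (fun u v => F q u * ∏ p ∈ P, F p v)]
    refine sum_congr rfl fun x _ => ?_
    rw [prod_insert hq, hF q (mem_insert_self _ _)]
    congr 1
    refine prod_congr rfl fun p hp => ?_
    rw [← hF' p hp (x % _), Nat.mod_mod_of_dvd _ (dvd_prod_of_mem _ hp), hF' p hp]

/-- The Jacobi symbol on natural numbers, with real values. -/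
noncomputable def chi (D x : ℕ) : ℝ := (jacobiSym (x : ℤ) D : ℝ)

lemma chi_mod (D x : ℕ) : chi D (x % D) = chi D x := by
  unfold chi
  rw [jacobiSym.mod_left (x : ℤ) D]
  push_cast; rfl

lemma chi_congr {D x y : ℕ} (h : x ≡ y [MOD D]) : chi D x = chi D y := by
  rw [← chi_mod, h, chi_mod]

lemma chi_mul (D x y : ℕ) : chi D (x * y) = chi D x * chi D y := by
  unfold chi
  rw [Nat.cast_mul, jacobiSym.mul_left]; push_cast; rfl

lemma chi_prod (P : Finset ℕ) (hP : ∀ p ∈ P, p.Prime) (x : ℕ) :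
    chi (∏ p ∈ P, p) x = ∏ p ∈ P, chi p x := by
  classical
  induction P using Finset.induction_on with
  | empty => simp [chi]
  | insert q P hq ih =>
    have hP' : ∀ p ∈ P, p.Prime := fun p hp => hP p (mem_insert_of_mem hp)
    have h1 : NeZero q := ⟨(hP q (mem_insert_self _ _)).ne_zero⟩
    have h2 : NeZero (∏ p ∈ P, p) := ⟨(prod_primes_pos hP').ne'⟩
    rw [prod_insert hq, prod_insert hq, ← ih hP']
    unfold chi
    rw [jacobiSym.mul_right]; push_cast; rfl

lemma abs_chi_le_one (D x : ℕ) : |chi D x| ≤ 1 := by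
  unfold chi
  rcases jacobiSym.trichotomy (x : ℤ) D with h | h | h <;> simp [h]

lemma abs_chi_eq_one {D x : ℕ} (h : x.Coprime D) : |chi D x| = 1 := by
  unfold chi
  rcases jacobiSym.eq_one_or_neg_one (a := (x : ℤ)) (b := D) (by simpa using h) with h | h <;>
    simp [h]

lemma chi_prime (p : ℕ) [Fact p.Prime] (x : ℕ) :
    chi p x = (quadraticChar (ZMod p) (x : ZMod p) : ℝ) := by
  unfold chi
  rw [← jacobiSym.legendreSym.to_jacobiSym, legendreSym]
  simp

lemma sum_range_zmod (p : ℕ) [NeZero p] (F : ZMod p → ℝ) :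
    ∑ x ∈ range p, F (x : ZMod p) = ∑ x : ZMod p, F x := by
  refine sum_nbij' (fun x => (x : ZMod p)) (fun x => x.val) ?_ ?_ ?_ ?_ ?_
  · simp
  · intro x _; simpa using ZMod.val_lt x
  · intro x hx; simpa using ZMod.val_cast_of_lt (mem_range.1 hx)
  · intro x _; simp
  · intro x _; rfl

lemma abs_sum_prod_chi_le {p : ℕ} (hp : p.Prime) (hp2 : p ≠ 2) {ι : Type*}
    (s : Finset ι) (h : ι → ℕ) (hodd : ∃ c, Odd (s.filter fun i => h i ≡ c [MOD p]).card) :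
    |∑ x ∈ range p, ∏ i ∈ s, chi p (x + h i)| ≤ 20 * s.card * √p := by
  have := Fact.mk hp
  obtain ⟨c, hc⟩ := hodd
  have := abs_sum_prod_quadraticChar_le hp2 s (fun i => (h i : ZMod p))
    ⟨(c : ZMod p), by simpa only [ZMod.natCast_eq_natCast_iff] using hc⟩
  rw [← sum_range_zmod] at this
  simpa [chi_prime] using this

/-! ### The fourth moment of short character sums -/

lemma exists_odd_card_fiber (j : Fin 4 → ℕ)
    (h : ¬ ((j 0 = j 1 ∧ j 2 = j 3) ∨ (j 0 = j 2 ∧ j 1 = j 3) ∨ (j 0 = j 3 ∧ j 1 = j 2))) :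
    ∃ c, Odd (univ.filter fun i => j i = c).card := by
  by_contra! hc
  have h0 := hc (j 0)
  have h1 := hc (j 1)
  have h2 := hc (j 2)
  have h3 := hc (j 3)
  simp only [card_filter, Fin.sum_univ_four] at h0 h1 h2 h3
  generalize j 0 = a at *
  generalize j 1 = b at *
  generalize j 2 = c at *
  generalize j 3 = d at *
  by_cases hab : a = b <;> by_cases hac : a = c <;> by_cases had : a = d <;>
    by_cases hbc : b = c <;> by_cases hbd : b = d <;> by_cases hcd : c = d <;>
    simp_all [Nat.not_odd_iff_even, eq_comm]

/-- The complete sum of a product of four shifted characters. -/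
noncomputable def fourSum (D a b c d : ℕ) : ℝ :=
  ∑ x ∈ range D, chi D (x + a) * chi D (x + b) * chi D (x + c) * chi D (x + d)

lemma abs_fourSum_le (D a b c d : ℕ) : |fourSum D a b c d| ≤ D := by
  unfold fourSum
  refine (abs_sum_le_sum_abs _ _).trans ((sum_le_sum (g := fun _ => (1 : ℝ)) fun x _ => ?_).trans
    (by simp))
  rw [abs_mul, abs_mul, abs_mul]
  have := abs_chi_le_one D
  have h1 := mul_le_one₀ (this (x + a)) (abs_nonneg _) (this (x + b))
  have h2 := mul_le_one₀ h1 (abs_nonneg _) (this (x + c))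
  exact mul_le_one₀ h2 (abs_nonneg _) (this (x + d))

/-- The four residues match in pairs modulo `p`. -/
def PairedMod (p a b c d : ℕ) : Prop :=
  (a ≡ b [MOD p] ∧ c ≡ d [MOD p]) ∨ (a ≡ c [MOD p] ∧ b ≡ d [MOD p]) ∨
    (a ≡ d [MOD p] ∧ b ≡ c [MOD p])

lemma abs_fourSum_prime_le {p : ℕ} (hp : p.Prime) (hp2 : p ≠ 2) {a b c d : ℕ}
    (h : ¬ PairedMod p a b c d) : |fourSum p a b c d| ≤ 80 * √p := by
  obtain ⟨k, hk⟩ := exists_odd_card_fiber (fun i => (![a, b, c, d] i) % p)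
    (by simpa [PairedMod, Nat.ModEq] using h)
  have hk' : k % p = k ∨ p ≤ k := by
    rcases lt_or_ge k p with h | h
    · exact Or.inl (Nat.mod_eq_of_lt h)
    · exact Or.inr h
  rcases hk' with hk' | hk'
  · have := abs_sum_prod_chi_le hp hp2 (univ : Finset (Fin 4)) ![a, b, c, d]
      ⟨k, by simpa only [Nat.ModEq, hk'] using hk⟩
    simp only [Fin.prod_univ_four, card_univ, Fintype.card_fin] at this
    norm_num at this
    exact this
  · exfalso
    rw [filter_false_of_mem] at hk
    · simp at hk
    · intro i _ hi
      have := Nat.mod_lt (![a, b, c, d] i) hp.pos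
      omega

lemma fourSum_prod {P : Finset ℕ} (hP : ∀ p ∈ P, p.Prime) (a b c d : ℕ) :
    fourSum (∏ p ∈ P, p) a b c d = ∏ p ∈ P, fourSum p a b c d := by
  unfold fourSum
  rw [← sum_range_prod_primes hP (fun p x => chi p (x + a) * chi p (x + b) * chi p (x + c) *
    chi p (x + d))]
  · simp only [chi_prod P hP, prod_mul_distrib]
  · intro p _ x
    have h : ∀ e, chi p (x % p + e) = chi p (x + e) := fun e =>
      chi_congr ((Nat.mod_modEq x p).add_right e)
    simp only [h]

/-- The product of the primes in `P` dividing `u`. -/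
def gcdPart (P : Finset ℕ) (a b : ℕ) : ℕ := ∏ p ∈ P with a ≡ b [MOD p], p

lemma card_modEq_mul_le {d J v : ℕ} (hd : 0 < d) (hv : v < J) :
    ((range J).filter fun j => j ≠ v ∧ v ≡ j [MOD d]).card * d ≤ J := by
  have h1 : ((range J).filter fun j => j ≡ v [MOD d]).card ≤ J / d + 1 := by
    rw [← Nat.count_eq_card_filter_range, Nat.count_modEq_card J hd v]
    split_ifs <;> omega
  have h2 : ((range J).filter fun j => j ≠ v ∧ v ≡ j [MOD d]) =
      ((range J).filter fun j => j ≡ v [MOD d]).erase v := by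
    ext j
    simp only [mem_filter, mem_erase, mem_range]
    constructor
    · rintro ⟨h, h', h''⟩; exact ⟨h', h, h''.symm⟩
    · rintro ⟨h', h, h''⟩; exact ⟨h, h', h''.symm⟩
  have hm : v ∈ (range J).filter fun j => j ≡ v [MOD d] :=
    mem_filter.2 ⟨mem_range.2 hv, Nat.ModEq.refl v⟩
  rw [h2, card_erase_of_mem hm]
  have h3 := Nat.sub_le_sub_right h1 1
  calc _ ≤ J / d * d := Nat.mul_le_mul_right _ h3
    _ ≤ J := Nat.div_mul_le_self J d

lemma sum_gcdPart_le {P : Finset ℕ} (hP : ∀ p ∈ P, p.Prime) {J v : ℕ} (hv : v < J) :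
    ∑ j ∈ range J with j ≠ v, gcdPart P v j ≤ 2 ^ P.card * J := by
  classical
  have h1 : ∀ j, gcdPart P v j ≤ ∑ Q ∈ P.powerset, (if v ≡ j [MOD ∏ p ∈ Q, p] then ∏ p ∈ Q, p
      else 0) := by
    intro j
    have hQ : (P.filter fun p => v ≡ j [MOD p]) ∈ P.powerset := by simp
    refine le_trans (le_of_eq ?_) (single_le_sum (fun _ _ => Nat.zero_le _) hQ)
    rw [if_pos, gcdPart]
    have hsub : ∀ Q ⊆ P, (∀ q ∈ Q, v ≡ j [MOD q]) → v ≡ j [MOD ∏ p ∈ Q, p] := by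
      intro Q
      induction Q using Finset.induction_on with
      | empty => intro _ _; simpa using Nat.modEq_one
      | insert q Q hq ih =>
        intro hsub hmod
        rw [prod_insert hq]
        have hP' : ∀ p ∈ Q, p.Prime := fun p hp => hP p (hsub (mem_insert_of_mem hp))
        refine (Nat.modEq_and_modEq_iff_modEq_mul (coprime_prod_primes hP'
          (hP q (hsub (mem_insert_self _ _))) hq)).1 ⟨hmod q (mem_insert_self _ _), ?_⟩
        exact ih ((subset_insert _ _).trans hsub) fun p hp => hmod p (mem_insert_of_mem hp)
    exact hsub _ (filter_subset _ _) fun q hq => (mem_filter.1 hq).2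
  calc _ ≤ ∑ j ∈ range J with j ≠ v, ∑ Q ∈ P.powerset,
        (if v ≡ j [MOD ∏ p ∈ Q, p] then ∏ p ∈ Q, p else 0) := sum_le_sum fun j _ => h1 j
    _ = ∑ Q ∈ P.powerset, ∑ j ∈ range J with j ≠ v,
        (if v ≡ j [MOD ∏ p ∈ Q, p] then ∏ p ∈ Q, p else 0) := sum_comm
    _ ≤ ∑ Q ∈ P.powerset, J := by
        refine sum_le_sum fun Q hQ => ?_
        rw [← sum_filter, sum_const, filter_filter, smul_eq_mul]
        exact card_modEq_mul_le (prod_primes_pos fun p hp => hP p (mem_powerset.1 hQ hp)) hv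
    _ = 2 ^ P.card * J := by simp

/-- The off-diagonal part of `gcdPart`. -/
def gcdOff (P : Finset ℕ) (a b : ℕ) : ℕ := if b ≠ a then gcdPart P a b else 0

lemma sum_gcdOff_le {P : Finset ℕ} (hP : ∀ p ∈ P, p.Prime) {J v : ℕ} (hv : v < J) :
    ∑ j ∈ range J, gcdOff P v j ≤ 2 ^ P.card * J := by
  unfold gcdOff
  rw [← sum_filter]
  exact sum_gcdPart_le hP hv

/-- A majorant of the product of the primes for which `a, b, c, d` are paired. -/
def pairWeight (P : Finset ℕ) (a b c d : ℕ) : ℕ :=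
  gcdOff P a b * gcdOff P a c * gcdOff P a d + (if b = a then gcdOff P c d else 0) +
    (if c = a then gcdOff P b d else 0) + (if d = a then gcdOff P b c else 0)

lemma prod_paired_le {P : Finset ℕ} (hP : ∀ p ∈ P, p.Prime) {a b c d : ℕ}
    (h : ¬ ((a = b ∧ c = d) ∨ (a = c ∧ b = d) ∨ (a = d ∧ b = c)))
    (T : Finset ℕ) (hT : T ⊆ P) (hpair : ∀ p ∈ T, PairedMod p a b c d) :
    ∏ p ∈ T, p ≤ pairWeight P a b c d := by
  have key : ∀ u v, (∀ p ∈ T, u ≡ v [MOD p]) → ∏ p ∈ T, p ≤ gcdPart P u v := by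
    intro u v huv
    refine prod_le_prod_of_subset_of_one_le' (fun p hp => mem_filter.2 ⟨hT hp, huv p hp⟩) ?_
    intro p hp _
    exact (hP p (mem_filter.1 hp).1).one_lt.le
  have key2 : ∀ u v, v ≠ u → (∀ p ∈ T, u ≡ v [MOD p]) → ∏ p ∈ T, p ≤ gcdOff P u v := by
    intro u v huv h
    rw [gcdOff, if_pos huv]
    exact key u v h
  unfold pairWeight
  by_cases hb : b = a
  · have : ∏ p ∈ T, p ≤ gcdOff P c d := by
      refine key2 c d (fun h' => h (Or.inl ⟨hb.symm, h'.symm⟩)) fun p hp => ?_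
      subst hb
      rcases hpair p hp with ⟨_, h⟩ | ⟨h, h'⟩ | ⟨h, h'⟩
      · exact h
      · exact h.symm.trans h'
      · exact h'.symm.trans h
    rw [if_pos hb]; omega
  by_cases hc : c = a
  · have : ∏ p ∈ T, p ≤ gcdOff P b d := by
      refine key2 b d (fun h' => h (Or.inr (Or.inl ⟨hc.symm, h'.symm⟩))) fun p hp => ?_
      subst hc
      rcases hpair p hp with ⟨h, h'⟩ | ⟨_, h'⟩ | ⟨h, h'⟩
      · exact h.symm.trans h'
      · exact h'
      · exact h'.trans h
    rw [if_pos hc]; omega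
  by_cases hd : d = a
  · have : ∏ p ∈ T, p ≤ gcdOff P b c := by
      refine key2 b c (fun h' => h (Or.inr (Or.inr ⟨hd.symm, h'.symm⟩))) fun p hp => ?_
      subst hd
      rcases hpair p hp with ⟨h, h'⟩ | ⟨h, h'⟩ | ⟨_, h'⟩
      · exact h.symm.trans h'.symm
      · exact h'.trans h
      · exact h'
    rw [if_pos hd]; omega
  have hprod : ∏ p ∈ T, p ≤ gcdPart P a b * gcdPart P a c * gcdPart P a d := by
    unfold gcdPart
    have e : ∀ u v, ∏ p ∈ P with u ≡ v [MOD p], p = ∏ p ∈ P, (if u ≡ v [MOD p] then p else 1) :=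
      fun u v => prod_filter _ _
    rw [e, e, e, ← prod_mul_distrib, ← prod_mul_distrib]
    calc ∏ p ∈ T, p ≤ ∏ p ∈ T, ((if a ≡ b [MOD p] then p else 1) *
          (if a ≡ c [MOD p] then p else 1) * (if a ≡ d [MOD p] then p else 1)) := by
          refine prod_le_prod' fun p hp => ?_
          have hp1 : 1 ≤ p := (hP p (hT hp)).one_lt.le
          have hx : ∀ q : Prop, ∀ [Decidable q], 1 ≤ (if q then p else 1) := by
            intro q _; split_ifs <;> omega
          rcases hpair p hp with ⟨h, h'⟩ | ⟨h, h'⟩ | ⟨h, h'⟩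
          · rw [if_pos h, mul_assoc]
            exact Nat.le_mul_of_pos_right _ (Nat.mul_pos (hx _) (hx _))
          · rw [if_pos h, mul_right_comm, mul_comm]
            exact Nat.le_mul_of_pos_right _ (Nat.mul_pos (hx _) (hx _))
          · rw [if_pos h, mul_comm]
            exact Nat.le_mul_of_pos_right _ (Nat.mul_pos (hx _) (hx _))
      _ ≤ _ := by
          refine prod_le_prod_of_subset_of_one_le' hT fun p hp _ => ?_
          have hp1 : 1 ≤ p := (hP p hp).one_lt.le
          have hx : ∀ q : Prop, ∀ [Decidable q], 1 ≤ (if q then p else 1) := by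
            intro q _; split_ifs <;> omega
          exact Nat.mul_pos (Nat.mul_pos (hx _) (hx _)) (hx _)
  simp only [gcdOff, ne_eq, hb, hc, hd, not_false_eq_true, if_true, if_false]
  exact hprod.trans (by omega)

lemma abs_fourSum_prod_le {P : Finset ℕ} (hP : ∀ p ∈ P, p.Prime) (hP2 : 2 ∉ P) {a b c d : ℕ}
    (h : ¬ ((a = b ∧ c = d) ∨ (a = c ∧ b = d) ∨ (a = d ∧ b = c))) :
    |fourSum (∏ p ∈ P, p) a b c d| ≤
      80 ^ P.card * √((∏ p ∈ P, p : ℕ) : ℝ) * pairWeight P a b c d := by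
  classical
  have h1 := prod_paired_le hP h (P.filter fun p => PairedMod p a b c d) (filter_subset _ _)
    fun p hp => (mem_filter.1 hp).2
  have h2 : ((∏ p ∈ P with PairedMod p a b c d, p : ℕ) : ℝ) ≤ pairWeight P a b c d := by
    exact_mod_cast h1
  refine le_trans ?_ (mul_le_mul_of_nonneg_left h2 (by positivity))
  rw [fourSum_prod hP, abs_prod, prod_filter]
  push_cast
  rw [Real.sqrt_prod _ fun _ _ => Nat.cast_nonneg _, ← prod_const, ← prod_mul_distrib,
    ← prod_mul_distrib]
  refine prod_le_prod (fun _ _ => abs_nonneg _) fun p hp => ?_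
  have hp1 : (1 : ℝ) ≤ √(p : ℝ) := by
    rw [Real.one_le_sqrt]; exact_mod_cast (hP p hp).one_lt.le
  split_ifs with hpair
  · refine (abs_fourSum_le p a b c d).trans ?_
    have : (0 : ℝ) ≤ p := Nat.cast_nonneg p
    nlinarith
  · rw [mul_one]
    exact abs_fourSum_prime_le (hP p hp) (fun h => hP2 (h ▸ hp)) hpair

lemma sum_pairWeight_le {P : Finset ℕ} (hP : ∀ p ∈ P, p.Prime) (J : ℕ) :
    ∑ a ∈ range J, ∑ b ∈ range J, ∑ c ∈ range J, ∑ d ∈ range J, pairWeight P a b c d ≤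
      4 * 8 ^ P.card * J ^ 4 := by
  set K := 2 ^ P.card * J with hK
  have hs : ∀ v ∈ range J, ∑ j ∈ range J, gcdOff P v j ≤ K := fun v hv =>
    sum_gcdOff_le hP (mem_range.1 hv)
  have hs2 : ∑ v ∈ range J, ∑ j ∈ range J, gcdOff P v j ≤ J * K := by
    refine (sum_le_sum hs).trans ?_
    simp
  have h1 : ∑ a ∈ range J, ∑ b ∈ range J, ∑ c ∈ range J, ∑ d ∈ range J,
      gcdOff P a b * gcdOff P a c * gcdOff P a d ≤ J * K ^ 3 := by
    calc _ = ∑ a ∈ range J, (∑ j ∈ range J, gcdOff P a j) ^ 3 := by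
          refine sum_congr rfl fun a _ => ?_
          simp only [← mul_sum, ← sum_mul]
          ring
      _ ≤ ∑ a ∈ range J, K ^ 3 := sum_le_sum fun a ha => Nat.pow_le_pow_left (hs a ha) 3
      _ = J * K ^ 3 := by simp
  have h2 : ∑ a ∈ range J, ∑ b ∈ range J, ∑ c ∈ range J, ∑ d ∈ range J,
      (if b = a then gcdOff P c d else 0) ≤ J * (J * K) := by
    calc _ = ∑ a ∈ range J, ∑ c ∈ range J, ∑ d ∈ range J, gcdOff P c d := by
          refine sum_congr rfl fun a ha => ?_
          rw [sum_eq_single a]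
          · simp
          · intro b _ hb; simp [hb]
          · intro h; exact absurd ha h
      _ ≤ _ := by
          rw [sum_const, card_range, smul_eq_mul]; gcongr
  have h3 : ∑ a ∈ range J, ∑ b ∈ range J, ∑ c ∈ range J, ∑ d ∈ range J,
      (if c = a then gcdOff P b d else 0) ≤ J * (J * K) := by
    calc _ = ∑ a ∈ range J, ∑ b ∈ range J, ∑ d ∈ range J, gcdOff P b d := by
          refine sum_congr rfl fun a ha => sum_congr rfl fun b _ => ?_
          rw [sum_eq_single a]
          · simp
          · intro b _ hb; simp [hb]
          · intro h; exact absurd ha h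
      _ ≤ _ := by
          rw [sum_const, card_range, smul_eq_mul]; gcongr
  have h4 : ∑ a ∈ range J, ∑ b ∈ range J, ∑ c ∈ range J, ∑ d ∈ range J,
      (if d = a then gcdOff P b c else 0) ≤ J * (J * K) := by
    calc _ = ∑ a ∈ range J, ∑ b ∈ range J, ∑ c ∈ range J, gcdOff P b c := by
          refine sum_congr rfl fun a ha => sum_congr rfl fun b _ => sum_congr rfl fun c _ => ?_
          rw [sum_eq_single a]
          · simp
          · intro b _ hb; simp [hb]
          · intro h; exact absurd ha h
      _ ≤ _ := by
          rw [sum_const, card_range, smul_eq_mul]; gcongr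
  simp only [pairWeight, sum_add_distrib]
  have h5 : J * K ^ 3 = 8 ^ P.card * J ^ 4 := by
    rw [hK, mul_pow, ← pow_mul, mul_comm P.card, pow_mul]; norm_num; ring
  have h6 : J * (J * K) ≤ 8 ^ P.card * J ^ 4 := by
    rcases Nat.eq_zero_or_pos J with h | h
    · simp [h]
    calc J * (J * K) = 2 ^ P.card * J ^ 3 := by rw [hK]; ring
      _ ≤ 8 ^ P.card * J ^ 4 := by gcongr <;> omega
  calc _ ≤ J * K ^ 3 + J * (J * K) + J * (J * K) + J * (J * K) := by gcongr
    _ ≤ 4 * 8 ^ P.card * J ^ 4 := by linarith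

lemma sum_pow_four (s : Finset ℕ) (f : ℕ → ℝ) :
    (∑ j ∈ s, f j) ^ 4 = ∑ a ∈ s, ∑ b ∈ s, ∑ c ∈ s, ∑ d ∈ s, f a * f b * f c * f d := by
  simp only [← mul_sum, ← sum_mul]; ring

/-- The fourth moment of short character sums. -/
lemma fourth_moment_le {P : Finset ℕ} (hP : ∀ p ∈ P, p.Prime) (hP2 : 2 ∉ P) (J : ℕ) :
    ∑ x ∈ range (∏ p ∈ P, p), (∑ j ∈ range J, chi (∏ p ∈ P, p) (x + j)) ^ 4 ≤
      3 * J ^ 2 * (∏ p ∈ P, p : ℕ) +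
        4 * 640 ^ P.card * √((∏ p ∈ P, p : ℕ) : ℝ) * J ^ 4 := by
  set D := ∏ p ∈ P, p with hD
  have h0 : ∑ x ∈ range D, (∑ j ∈ range J, chi D (x + j)) ^ 4 =
      ∑ a ∈ range J, ∑ b ∈ range J, ∑ c ∈ range J, ∑ d ∈ range J, fourSum D a b c d := by
    unfold fourSum
    simp only [sum_pow_four]
    rw [sum_comm]; refine sum_congr rfl fun a _ => ?_
    rw [sum_comm]; refine sum_congr rfl fun b _ => ?_
    rw [sum_comm]; refine sum_congr rfl fun c _ => ?_
    rw [sum_comm]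
  have hpt : ∀ a b c d, fourSum D a b c d ≤
      ((if b = a then (if d = c then (D : ℝ) else 0) else 0) +
      (if c = a then (if d = b then (D : ℝ) else 0) else 0) +
      (if d = a then (if c = b then (D : ℝ) else 0) else 0)) +
        80 ^ P.card * √(D : ℝ) * pairWeight P a b c d := by
    intro a b c d
    have hw : 0 ≤ 80 ^ P.card * √(D : ℝ) * pairWeight P a b c d := by positivity
    have hi : ∀ q r : Prop, ∀ [Decidable q] [Decidable r],
        (0 : ℝ) ≤ if q then (if r then (D : ℝ) else 0) else 0 := by
      intro q r _ _; split_ifs <;> positivity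
    by_cases h : (a = b ∧ c = d) ∨ (a = c ∧ b = d) ∨ (a = d ∧ b = c)
    · have h1 := (le_abs_self _).trans (abs_fourSum_le D a b c d)
      have i1 := hi (b = a) (d = c)
      have i2 := hi (c = a) (d = b)
      have i3 := hi (d = a) (c = b)
      rcases h with ⟨h, h'⟩ | ⟨h, h'⟩ | ⟨h, h'⟩
      · rw [if_pos h.symm, if_pos h'.symm]; linarith
      · rw [if_pos h.symm, if_pos h'.symm]; linarith
      · rw [if_pos h.symm, if_pos h'.symm]; linarith
    · have h1 := (le_abs_self _).trans (abs_fourSum_prod_le hP hP2 h)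
      have i1 := hi (b = a) (d = c)
      have i2 := hi (c = a) (d = b)
      have i3 := hi (d = a) (c = b)
      linarith
  rw [h0]
  have hsum := sum_le_sum fun a (_ : a ∈ range J) => sum_le_sum fun b (_ : b ∈ range J) =>
    sum_le_sum fun c (_ : c ∈ range J) => sum_le_sum fun d (_ : d ∈ range J) => hpt a b c d
  refine hsum.trans ?_
  simp only [sum_add_distrib, ← mul_sum]
  have hW : ∑ a ∈ range J, ∑ b ∈ range J, ∑ c ∈ range J, ∑ d ∈ range J,
      (pairWeight P a b c d : ℝ) ≤ 4 * 8 ^ P.card * J ^ 4 := by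
    exact_mod_cast sum_pairWeight_le hP J
  have hd1 : ∑ a ∈ range J, ∑ b ∈ range J, ∑ c ∈ range J, ∑ d ∈ range J,
      (if b = a then (if d = c then (D : ℝ) else 0) else 0) = J ^ 2 * D := by
    calc _ = ∑ a ∈ range J, ∑ c ∈ range J, (D : ℝ) := by
          refine sum_congr rfl fun a ha => ?_
          rw [sum_eq_single a (fun b _ hb => by simp [hb]) (fun h => absurd ha h)]
          refine sum_congr rfl fun c hc => ?_
          rw [sum_eq_single c (fun b _ hb => by simp [hb]) (fun h => absurd hc h)]
          simp
      _ = _ := by simp; ring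
  have hd2 : ∑ a ∈ range J, ∑ b ∈ range J, ∑ c ∈ range J, ∑ d ∈ range J,
      (if c = a then (if d = b then (D : ℝ) else 0) else 0) = J ^ 2 * D := by
    calc _ = ∑ a ∈ range J, ∑ b ∈ range J, (D : ℝ) := by
          refine sum_congr rfl fun a ha => sum_congr rfl fun b hb => ?_
          rw [sum_eq_single a (fun b _ hb => by simp [hb]) (fun h => absurd ha h)]
          rw [sum_eq_single b (fun b _ hb => by simp [hb]) (fun h => absurd hb h)]
          simp
      _ = _ := by simp; ring
  have hd3 : ∑ a ∈ range J, ∑ b ∈ range J, ∑ c ∈ range J, ∑ d ∈ range J,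
      (if d = a then (if c = b then (D : ℝ) else 0) else 0) = J ^ 2 * D := by
    calc _ = ∑ a ∈ range J, ∑ b ∈ range J, (D : ℝ) := by
          refine sum_congr rfl fun a ha => sum_congr rfl fun b hb => ?_
          rw [sum_eq_single b (fun b _ hb => by simp [hb]) (fun h => absurd hb h)]
          rw [sum_eq_single a (fun b _ hb => by simp [hb]) (fun h => absurd ha h)]
          simp
      _ = _ := by simp; ring
  rw [hd1, hd2, hd3]
  have h80 : (80 : ℝ) ^ P.card * √(D : ℝ) * (4 * 8 ^ P.card * J ^ 4) =
      4 * 640 ^ P.card * √(D : ℝ) * J ^ 4 := by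
    rw [show (640 : ℝ) = 80 * 8 by norm_num, mul_pow]; ring
  have := mul_le_mul_of_nonneg_left hW (by positivity : 0 ≤ (80 : ℝ) ^ P.card * √(D : ℝ))
  linarith

/-! ### Burgess' bound for short character sums -/

lemma abs_sum_range_shift_le {f : ℕ → ℝ} (hf : ∀ n, |f n| ≤ 1) (s J : ℕ) :
    |∑ j ∈ range J, f j - ∑ j ∈ range J, f (s + j)| ≤ 2 * s := by
  have h1 := sum_range_add f J s
  have h2 := sum_range_add f s J
  rw [add_comm s J] at h2
  have hb : ∀ g : ℕ → ℝ, (∀ n, |g n| ≤ 1) → |∑ j ∈ range s, g j| ≤ s := fun g hg =>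
    (abs_sum_le_sum_abs _ _).trans ((sum_le_sum fun j _ => hg j).trans (by simp))
  have h3 := hb f hf
  have h4 := hb (fun j => f (J + j)) fun n => hf _
  have : ∑ j ∈ range J, f j - ∑ j ∈ range J, f (s + j) =
      ∑ j ∈ range s, f j - ∑ j ∈ range s, f (J + j) := by linarith
  rw [this]
  have := abs_sub (∑ j ∈ range s, f j) (∑ j ∈ range s, f (J + j))
  linarith

lemma eq_of_collision {k J D a a' x j₁ j₁' j₂ j₂' : ℕ} (hD : 4 * k ^ 3 * J ≤ D)
    (ha : a ∈ Ioc (k ^ 3) (k ^ 3 + k)) (ha' : a' ∈ Ioc (k ^ 3) (k ^ 3 + k)) (haa : a ≠ a')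
    (h₁ : a' * (x + j₁) ≡ a * (x + j₁') [MOD D]) (h₂ : a' * (x + j₂) ≡ a * (x + j₂') [MOD D])
    (hj₁ : j₁ < J) (hj₁' : j₁' < J) (hj₂ : j₂ < J) (hj₂' : j₂' < J)
    (hdiv : j₁ / k ^ 2 = j₂ / k ^ 2) : j₁ = j₂ ∧ j₁' = j₂' := by
  rw [mem_Ioc] at ha ha'
  have hk1 : 1 ≤ k := by omega
  have hkk : k ≤ k ^ 3 := by nlinarith [Nat.pow_le_pow_left hk1 2]
  have hdvd : (D : ℤ) ∣ a * ((j₁' : ℤ) - j₂') - a' * ((j₁ : ℤ) - j₂) := by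
    have e1 := (Nat.modEq_iff_dvd.1 h₁)
    have e2 := (Nat.modEq_iff_dvd.1 h₂)
    have := dvd_sub e1 e2
    push_cast at this
    refine this.trans (dvd_of_eq ?_)
    ring
  have hu : |(j₁ : ℤ) - j₂| < J := by rw [abs_lt]; constructor <;> omega
  have hu' : |(j₁' : ℤ) - j₂'| < J := by rw [abs_lt]; constructor <;> omega
  have hA : (a : ℤ) ≤ 2 * k ^ 3 := by exact_mod_cast (by omega : a ≤ 2 * k ^ 3)
  have hA' : (a' : ℤ) ≤ 2 * k ^ 3 := by exact_mod_cast (by omega : a' ≤ 2 * k ^ 3)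
  have hpos : (0 : ℤ) < 2 * k ^ 3 := by positivity
  have hzero : (a : ℤ) * ((j₁' : ℤ) - j₂') - a' * ((j₁ : ℤ) - j₂) = 0 := by
    refine Int.eq_zero_of_abs_lt_dvd hdvd ?_
    have e1 : |(a : ℤ) * ((j₁' : ℤ) - j₂')| < 2 * k ^ 3 * J := by
      rw [abs_mul, Nat.abs_cast]
      exact (mul_le_mul_of_nonneg_right hA (abs_nonneg _)).trans_lt
        (mul_lt_mul_of_pos_left hu' hpos)
    have e2 : |(a' : ℤ) * ((j₁ : ℤ) - j₂)| < 2 * k ^ 3 * J := by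
      rw [abs_mul, Nat.abs_cast]
      exact (mul_le_mul_of_nonneg_right hA' (abs_nonneg _)).trans_lt
        (mul_lt_mul_of_pos_left hu hpos)
    have e3 := abs_sub ((a : ℤ) * ((j₁' : ℤ) - j₂')) (a' * ((j₁ : ℤ) - j₂))
    have e4 : (4 * k ^ 3 * J : ℤ) ≤ D := by exact_mod_cast hD
    linarith
  have ha0 : (a : ℤ) ≠ 0 := by
    have : 0 < a := by omega
    exact_mod_cast this.ne'
  by_cases hu0 : (j₁ : ℤ) - j₂ = 0
  · rw [hu0, mul_zero, sub_zero] at hzero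
    have := (mul_eq_zero.1 hzero).resolve_left ha0
    omega
  · exfalso
    have hlt : |(j₁ : ℤ) - j₂| < k ^ 2 := by
      have hk2 : 0 < k ^ 2 := by positivity
      have d1 := Nat.div_add_mod j₁ (k ^ 2)
      have d2 := Nat.div_add_mod j₂ (k ^ 2)
      have m1 := Nat.mod_lt j₁ hk2
      have m2 := Nat.mod_lt j₂ hk2
      have n1 := Nat.zero_le (j₁ % k ^ 2)
      have n2 := Nat.zero_le (j₂ % k ^ 2)
      rw [hdiv] at d1
      rw [abs_lt]
      zify at *
      constructor <;> linarith
    have heq : ((a' : ℤ) - a) * ((j₁ : ℤ) - j₂) = a * (((j₁' : ℤ) - j₂') - ((j₁ : ℤ) - j₂)) := by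
      linear_combination -hzero
    have hne : ((j₁' : ℤ) - j₂') - ((j₁ : ℤ) - j₂) ≠ 0 := by
      intro h0
      rw [h0, mul_zero] at heq
      rcases mul_eq_zero.1 heq with h | h
      · omega
      · exact hu0 h
    have h1 : (a : ℤ) ≤ |((a' : ℤ) - a) * ((j₁ : ℤ) - j₂)| := by
      rw [heq, abs_mul, Nat.abs_cast]
      have := Int.one_le_abs hne
      nlinarith
    rw [abs_mul] at h1
    have h2 : |(a' : ℤ) - a| ≤ k := by rw [abs_le]; constructor <;> omega
    have h3 : |(a' : ℤ) - a| * |(j₁ : ℤ) - j₂| ≤ k * k ^ 2 := by gcongr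
    have h4 : (k ^ 3 : ℤ) < a := by exact_mod_cast ha.1
    nlinarith

lemma sum_mul_pow_four_le {ι : Type*} (I : Finset ι) (y : ι → ℕ) (D : ℕ)
    (hy : ∀ i ∈ I, y i < D) (f : ℕ → ℝ) :
    (∑ i ∈ I, f (y i)) ^ 4 ≤
      (I.card : ℝ) ^ 2 * ((I ×ˢ I).filter fun ij => y ij.1 = y ij.2).card *
        ∑ n ∈ range D, f n ^ 4 := by
  classical
  set ν : ℕ → ℝ := fun n => ((I.filter fun i => y i = n).card : ℝ) with hν
  have hfib : ∀ g : ℕ → ℝ, ∑ i ∈ I, g (y i) = ∑ n ∈ range D, ν n * g n := by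
    intro g
    rw [← sum_fiberwise_of_maps_to (t := range D) (g := y) fun i hi => mem_range.2 (hy i hi)]
    refine sum_congr rfl fun n _ => ?_
    rw [sum_congr rfl fun i hi => by rw [(mem_filter.1 hi).2]]
    simp [hν]
  have h1 : (∑ i ∈ I, f (y i)) ^ 2 ≤ I.card * ∑ i ∈ I, f (y i) ^ 2 := sq_sum_le_card_mul_sum_sq
  have h2 : (∑ i ∈ I, f (y i) ^ 2) ^ 2 ≤ (∑ n ∈ range D, ν n ^ 2) * ∑ n ∈ range D, f n ^ 4 := by
    rw [hfib fun n => f n ^ 2]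
    refine (sum_mul_sq_le_sq_mul_sq _ _ _).trans (le_of_eq ?_)
    congr 1
    exact sum_congr rfl fun n _ => by ring
  have h3 : (((I ×ˢ I).filter fun ij => y ij.1 = y ij.2).card : ℝ) = ∑ n ∈ range D, ν n ^ 2 := by
    have e1 : (((I ×ˢ I).filter fun ij => y ij.1 = y ij.2).card : ℝ) = ∑ i ∈ I, ν (y i) := by
      rw [card_filter, sum_product]
      push_cast
      refine sum_congr rfl fun i _ => ?_
      simp only [hν, card_filter]
      push_cast
      exact sum_congr rfl fun j _ => by simp [eq_comm]
    rw [e1, hfib]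
    exact sum_congr rfl fun n _ => by ring
  calc (∑ i ∈ I, f (y i)) ^ 4 = ((∑ i ∈ I, f (y i)) ^ 2) ^ 2 := by ring
    _ ≤ (I.card * ∑ i ∈ I, f (y i) ^ 2) ^ 2 := by gcongr
    _ = (I.card : ℝ) ^ 2 * (∑ i ∈ I, f (y i) ^ 2) ^ 2 := by ring
    _ ≤ (I.card : ℝ) ^ 2 * ((∑ n ∈ range D, ν n ^ 2) * ∑ n ∈ range D, f n ^ 4) := by gcongr
    _ = _ := by rw [h3]; ring

lemma card_collisions_le {k J D x : ℕ} (y : ℕ × ℕ → ℕ) (hkJ : k ≤ J) (hD : 4 * k ^ 3 * J ≤ D)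
    (hy : ∀ a ∈ Ioc (k ^ 3) (k ^ 3 + k), ∀ j, a * y (a, j) ≡ x + j [MOD D]) :
    (((Ioc (k ^ 3) (k ^ 3 + k) ×ˢ range J) ×ˢ (Ioc (k ^ 3) (k ^ 3 + k) ×ˢ range J)).filter
      fun ij => y ij.1 = y ij.2).card ≤ 3 * k * J := by
  classical
  set T := Ioc (k ^ 3) (k ^ 3 + k) with hT
  have hTc : T.card = k := by simp [hT]
  rcases Nat.eq_zero_or_pos k with hk0 | hk
  · subst hk0; simp [hT]
  have hJ : 0 < J := by omega
  have hJD : J ≤ D := by nlinarith [Nat.pow_pos (n := 3) hk]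
  have hsplit : (((T ×ˢ range J) ×ˢ (T ×ˢ range J)).filter fun ij => y ij.1 = y ij.2).card =
      ∑ a ∈ T, ∑ a' ∈ T,
        ((range J ×ˢ range J).filter fun jj => y (a, jj.1) = y (a', jj.2)).card := by
    simp only [card_filter, sum_product]
    refine sum_congr rfl fun a _ => ?_
    rw [sum_comm]
  have hdiag : ∀ a ∈ T,
      ((range J ×ˢ range J).filter fun jj => y (a, jj.1) = y (a, jj.2)).card ≤ J := by
    intro a ha
    refine (card_le_card_of_injOn (t := range J) (fun jj => jj.1) ?_ ?_).trans (by simp)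
    · intro jj hjj
      simp only [coe_filter, mem_product, Set.mem_ofPred_eq] at hjj
      exact hjj.1.1
    · have key : ∀ j j', j < J → j' < J → y (a, j) = y (a, j') → j = j' := by
        intro j j' hj hj' h
        have h1 := (hy a ha j).symm.trans (h ▸ hy a ha j')
        exact Nat.ModEq.eq_of_lt_of_lt (Nat.ModEq.add_left_cancel' x h1) (by omega) (by omega)
      rintro ⟨j₁, j₁'⟩ h₁ ⟨j₂, j₂'⟩ h₂ (rfl : j₁ = j₂)
      simp only [coe_filter, mem_product, mem_range, Set.mem_ofPred_eq] at h₁ h₂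
      have e1 := key _ _ h₁.1.1 h₁.1.2 h₁.2
      have e2 := key _ _ h₂.1.1 h₂.1.2 h₂.2
      rw [← e1, ← e2]
  have hoff : ∀ a ∈ T, ∀ a' ∈ T, a ≠ a' →
      ((range J ×ˢ range J).filter fun jj => y (a, jj.1) = y (a', jj.2)).card ≤
        J / k ^ 2 + 1 := by
    intro a ha a' ha' haa
    refine (card_le_card_of_injOn (t := range (J / k ^ 2 + 1)) (fun jj => jj.1 / k ^ 2) ?_
      ?_).trans (by simp)
    · intro jj hjj
      simp only [coe_filter, mem_product, mem_range, Set.mem_ofPred_eq] at hjj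
      rw [mem_coe, mem_range, Nat.lt_succ_iff]
      exact Nat.div_le_div_right hjj.1.1.le
    · rintro ⟨j₁, j₁'⟩ h₁ ⟨j₂, j₂'⟩ h₂ hdiv
      simp only [coe_filter, mem_product, mem_range, Set.mem_ofPred_eq] at h₁ h₂ hdiv
      have hmod : ∀ j j', y (a, j) = y (a', j') → a' * (x + j) ≡ a * (x + j') [MOD D] := by
        intro j j' h
        have e1 := (hy a ha j).mul_left a'
        have e2 := (hy a' ha' j').mul_left a
        rw [h] at e1
        refine e1.symm.trans (Nat.ModEq.trans ?_ e2)
        rw [mul_left_comm]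
      obtain ⟨e1, e2⟩ := eq_of_collision hD ha ha' haa (hmod _ _ h₁.2) (hmod _ _ h₂.2)
        h₁.1.1 h₁.1.2 h₂.1.1 h₂.1.2 hdiv
      rw [e1, e2]
  rw [hsplit]
  have hrow : ∀ a ∈ T, ∑ a' ∈ T,
      ((range J ×ˢ range J).filter fun jj => y (a, jj.1) = y (a', jj.2)).card ≤
        J + k * (J / k ^ 2 + 1) := by
    intro a ha
    rw [← add_sum_erase T _ ha]
    refine add_le_add (hdiag a ha) ?_
    refine (sum_le_sum fun a' ha' => hoff a ha a' (mem_of_mem_erase ha')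
      (ne_of_mem_erase ha').symm).trans ?_
    rw [sum_const, smul_eq_mul]
    refine Nat.mul_le_mul_right _ ?_
    rw [← hTc]; exact card_le_card (erase_subset _ _)
  refine (sum_le_sum hrow).trans ?_
  rw [sum_const, hTc, smul_eq_mul]
  have h1 : k ^ 2 * (J / k ^ 2) ≤ J := Nat.mul_div_le J _
  nlinarith

lemma burgess_block {P : Finset ℕ} (hP : ∀ p ∈ P, p.Prime) {k J B x : ℕ} {ε : ℝ}
    (hk : 1 ≤ k) (hkP : ∀ p ∈ P, 2 * k ^ 3 < p) (hkJ : k ≤ J)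
    (hD : 4 * k ^ 3 * J ≤ ∏ p ∈ P, p) (hB1 : 1 ≤ B) (hB : √((∏ p ∈ P, p : ℕ) : ℝ) ≤ B ^ 2)
    (hε : 0 ≤ ε) (hεk : 21 * 640 ^ P.card * √((∏ p ∈ P, p : ℕ) : ℝ) ≤ ε ^ 4 * (k * J)) :
    |∑ j ∈ range J, chi (∏ p ∈ P, p) (x + j)| ≤ ε * J + 4 * k ^ 3 * B := by
  have hP2 : 2 ∉ P := fun h => by
    have := hkP 2 h
    have := Nat.one_le_pow 3 k hk
    omega
  have hM4 := fourth_moment_le hP hP2 B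
  have hprod0 := prod_primes_pos hP
  have hcop0 : ∀ a ∈ Ioc (k ^ 3) (k ^ 3 + k), a.Coprime (∏ p ∈ P, p) := by
    intro a ha
    rw [mem_Ioc] at ha
    refine Nat.Coprime.prod_right fun p hp => Nat.Coprime.symm ?_
    refine (Nat.Prime.coprime_iff_not_dvd (hP p hp)).2 fun hdvd => ?_
    have h1 := Nat.le_of_dvd (by omega) hdvd
    have h2 := hkP p hp
    have hkk : k ≤ k ^ 3 := by nlinarith [Nat.pow_le_pow_left hk 2]
    omega
  set D := ∏ p ∈ P, p with hDdef
  set T := Ioc (k ^ 3) (k ^ 3 + k) with hT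
  have hTc : T.card = k := by simp [hT]
  have hinv : ∀ a : ℕ, ∃ r : ℕ, a ∈ T → a * r ≡ 1 [MOD D] := by
    intro a
    by_cases ha : a ∈ T
    · obtain ⟨r, hr⟩ := Int.mod_coprime (hcop0 a ha)
      have : NeZero D := ⟨hprod0.ne'⟩
      refine ⟨(r : ZMod D).val, fun _ => ?_⟩
      rw [← ZMod.natCast_eq_natCast_iff]
      have := (ZMod.intCast_eq_intCast_iff _ _ _).2 hr
      push_cast at this ⊢
      simpa using this
    · exact ⟨0, fun h => absurd h ha⟩
  choose r hr using hinv
  let y : ℕ × ℕ → ℕ := fun i => (r i.1 * (x + i.2)) % D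
  have hy : ∀ a ∈ T, ∀ j, a * y (a, j) ≡ x + j [MOD D] := by
    intro a ha j
    have h1 : a * y (a, j) ≡ a * (r a * (x + j)) [MOD D] := (Nat.mod_modEq _ _).mul_left a
    have h2 := (hr a ha).mul_right (x + j)
    rw [one_mul, mul_assoc] at h2
    exact h1.trans h2
  have hyD : ∀ i ∈ T ×ˢ range J, y i < D := fun i _ => Nat.mod_lt _ hprod0
  set S := ∑ j ∈ range J, chi D (x + j) with hS
  have hM := sum_mul_pow_four_le (T ×ˢ range J) y D hyD
    (fun n => |∑ b ∈ range B, chi D (n + b)|)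
  set V := ∑ i ∈ T ×ˢ range J, |∑ b ∈ range B, chi D (y i + b)| with hV
  have hcoll := card_collisions_le (x := x) y hkJ hD hy
  have hk0 : (0 : ℝ) < k := by exact_mod_cast hk
  have hB0 : (0 : ℝ) < B := by exact_mod_cast hB1
  have hJ0 : (0 : ℝ) < J := by exact_mod_cast (by omega : 0 < J)
  -- the shifted sums
  have hshift : k * B * |S| ≤ V + k * B * (4 * k ^ 3 * B) := by
    have e1 : ∀ a ∈ T, ∀ b ∈ range B,
        |S - ∑ j ∈ range J, chi D (x + j + a * b)| ≤ 4 * k ^ 3 * B := by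
      intro a ha b hb
      have h1 := abs_sum_range_shift_le (f := fun j => chi D (x + j))
        (fun n => abs_chi_le_one _ _) (a * b) J
      have h2 : ∀ j, x + (a * b + j) = x + j + a * b := fun j => by ring
      simp only [h2] at h1
      refine h1.trans ?_
      rw [mem_Ioc] at ha
      have hkk : k ≤ k ^ 3 := by nlinarith [Nat.pow_le_pow_left hk 2]
      have h3 : a * b ≤ (2 * k ^ 3) * B :=
        Nat.mul_le_mul (by omega) (mem_range.1 hb).le
      have h4 : ((a * b : ℕ) : ℝ) ≤ 2 * k ^ 3 * B := by exact_mod_cast h3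
      linarith
    have e2 : |k * B * S - ∑ a ∈ T, ∑ b ∈ range B, ∑ j ∈ range J, chi D (x + j + a * b)| ≤
        k * B * (4 * k ^ 3 * B) := by
      have : (k : ℝ) * B * S = ∑ a ∈ T, ∑ b ∈ range B, S := by
        simp [hTc, mul_assoc]
      rw [this, ← sum_sub_distrib]
      simp only [← sum_sub_distrib]
      refine (abs_sum_le_sum_abs _ _).trans ?_
      calc _ ≤ ∑ a ∈ T, ∑ b ∈ range B, (4 * (k : ℝ) ^ 3 * B) := by
            refine sum_le_sum fun a ha => (abs_sum_le_sum_abs _ _).trans ?_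
            refine sum_le_sum fun b hb => ?_
            exact e1 a ha b hb
        _ = _ := by simp [hTc, mul_assoc]
    have e3 : |∑ a ∈ T, ∑ b ∈ range B, ∑ j ∈ range J, chi D (x + j + a * b)| ≤ V := by
      rw [hV, sum_product]
      refine (abs_sum_le_sum_abs _ _).trans (sum_le_sum fun a ha => ?_)
      rw [sum_comm]
      refine (abs_sum_le_sum_abs _ _).trans (sum_le_sum fun j _ => le_of_eq ?_)
      have : ∀ b, chi D (x + j + a * b) = chi D a * chi D (y (a, j) + b) := by
        intro b
        rw [← chi_mul, mul_add]
        exact chi_congr ((hy a ha j).symm.add_right _)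
      simp only [this, ← mul_sum]
      rw [abs_mul, abs_chi_eq_one (hcop0 a ha), one_mul]
    have e4 : |(k : ℝ) * B * S| = k * B * |S| := by
      rw [abs_mul, abs_of_pos (mul_pos hk0 hB0)]
    have e5 := abs_sub_abs_le_abs_sub ((k : ℝ) * B * S)
      (∑ a ∈ T, ∑ b ∈ range B, ∑ j ∈ range J, chi D (x + j + a * b))
    linarith
  have hV4 : V ^ 4 ≤ (ε * J * (k * B)) ^ 4 := by
    have hcard : ((T ×ˢ range J).card : ℝ) = k * J := by
      rw [card_product, hTc, card_range]; push_cast; ring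
    have hcoll' : (((((T ×ˢ range J) ×ˢ (T ×ˢ range J)).filter
      fun ij => y ij.1 = y ij.2).card : ℕ) : ℝ) ≤ 3 * k * J := by exact_mod_cast hcoll
    have hDs : (D : ℝ) = √(D : ℝ) * √D := (Real.mul_self_sqrt (Nat.cast_nonneg D)).symm
    have hs0 : 0 ≤ √(D : ℝ) := Real.sqrt_nonneg _
    have h640 : (1 : ℝ) ≤ 640 ^ P.card := one_le_pow₀ (by norm_num)
    have hM4' : ∑ n ∈ range D, |∑ b ∈ range B, chi D (n + b)| ^ 4 ≤
        7 * 640 ^ P.card * √(D : ℝ) * B ^ 4 := by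
      have : ∀ n, |∑ b ∈ range B, chi D (n + b)| ^ 4 = (∑ b ∈ range B, chi D (n + b)) ^ 4 :=
        fun n => Even.pow_abs (by decide) _
      simp only [this]
      refine hM4.trans ?_
      have h1 : 3 * (B : ℝ) ^ 2 * D ≤ 3 * √(D : ℝ) * B ^ 4 := by
        calc 3 * (B : ℝ) ^ 2 * D = 3 * B ^ 2 * √(D : ℝ) * √(D : ℝ) := by
              rw [mul_assoc _ √(D : ℝ), ← hDs]
          _ ≤ 3 * B ^ 2 * √(D : ℝ) * B ^ 2 := by gcongr
          _ = _ := by ring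
      have h2 : 3 * √(D : ℝ) * B ^ 4 ≤ 640 ^ P.card * (3 * √(D : ℝ) * B ^ 4) :=
        le_mul_of_one_le_left (by positivity) h640
      linarith
    rw [hcard] at hM
    refine (hM.trans (mul_le_mul (mul_le_mul_of_nonneg_left hcoll' (by positivity)) hM4'
      (sum_nonneg fun _ _ => by positivity) (by positivity))).trans ?_
    calc (k * J : ℝ) ^ 2 * (3 * k * J) * (7 * 640 ^ P.card * √(D : ℝ) * B ^ 4)
        = k ^ 3 * J ^ 3 * B ^ 4 * (21 * 640 ^ P.card * √(D : ℝ)) := by ring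
      _ ≤ k ^ 3 * J ^ 3 * B ^ 4 * (ε ^ 4 * (k * J)) := by gcongr
      _ = _ := by ring
  have hV1 : V ≤ ε * J * (k * B) := le_of_pow_le_pow_left₀ (by norm_num) (by positivity) hV4
  have : k * B * |S| ≤ k * B * (ε * J + 4 * k ^ 3 * B) := by linarith
  exact le_of_mul_le_mul_left this (mul_pos hk0 hB0)

lemma abs_sum_range_le_of_blocks {f : ℕ → ℝ} (hf : ∀ n, |f n| ≤ 1) {J₀ : ℕ} (hJ₀ : 0 < J₀) {β : ℝ}
    (hβ : ∀ x, |∑ j ∈ range J₀, f (x + j)| ≤ β * J₀) (J : ℕ) :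
    |∑ j ∈ range J, f j| ≤ β * J + J₀ := by
  have hb : ∀ s, ∀ g : ℕ → ℝ, (∀ n, |g n| ≤ 1) → |∑ j ∈ range s, g j| ≤ s := fun s g hg =>
    (abs_sum_le_sum_abs _ _).trans ((sum_le_sum fun j _ => hg j).trans (by simp))
  have hβ0 : 0 ≤ β := by
    have h1 := (abs_nonneg _).trans (hβ 0)
    have h2 : (0 : ℝ) < J₀ := by exact_mod_cast hJ₀
    exact nonneg_of_mul_nonneg_left h1 h2
  have hq : ∀ q : ℕ, |∑ j ∈ range (q * J₀), f j| ≤ q * (β * J₀) := by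
    intro q
    induction q with
    | zero => simp
    | succ q ih =>
      rw [Nat.succ_mul, sum_range_add]
      refine (abs_add_le _ _).trans ?_
      have := hβ (q * J₀)
      push_cast
      linarith
  have h1 := Nat.div_add_mod' J J₀
  rw [← h1, sum_range_add]
  refine (abs_add_le _ _).trans ?_
  have h2 := hq (J / J₀)
  have h3 := hb (J % J₀) (fun j => f (J / J₀ * J₀ + j)) fun n => hf _
  have h4 : ((J % J₀ : ℕ) : ℝ) ≤ J₀ := by exact_mod_cast (Nat.mod_lt J hJ₀).le
  have h5 : 0 ≤ β * (J % J₀ : ℕ) := by positivity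
  push_cast
  nlinarith

set_option exponentiation.threshold 600 in
/-- Burgess' bound in the form needed below: a saving of `1 / ℓ` for sums of length at least
`√D / ℓ ^ 16`. -/
lemma abs_sum_chi_lt {P : Finset ℕ} (hP : ∀ p ∈ P, p.Prime) {ℓ J x : ℕ} (hℓ : 21 ≤ ℓ)
    (hPℓ : ∀ p ∈ P, ℓ ^ 500 < p) (h640 : 640 ^ P.card ≤ ℓ ^ 8) (hne : P.Nonempty)
    (hJ : √((∏ p ∈ P, p : ℕ) : ℝ) ≤ J * ℓ ^ 16) :
    |∑ j ∈ range J, chi (∏ p ∈ P, p) (x + j)| < J / ℓ := by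
  have hℓr : (21 : ℝ) ≤ ℓ := by exact_mod_cast hℓ
  have hℓ0 : (0 : ℝ) < ℓ := by linarith
  have hDbig : ℓ ^ 500 < ∏ p ∈ P, p := by
    obtain ⟨q, hq⟩ := hne
    exact (hPℓ q hq).trans_le (Nat.le_of_dvd (prod_primes_pos hP) (dvd_prod_of_mem _ hq))
  have hblock := fun (k J₀ B x : ℕ) (ε : ℝ) => burgess_block hP (k := k) (J := J₀) (B := B)
    (x := x) (ε := ε)
  set D := ∏ p ∈ P, p with hD
  set s := √(D : ℝ) with hs
  have hs2 : s * s = D := Real.mul_self_sqrt (Nat.cast_nonneg D)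
  have hs0 : 0 ≤ s := Real.sqrt_nonneg _
  have hsbig : (ℓ : ℝ) ^ 250 ≤ s := by
    refine Real.le_sqrt_of_sq_le ?_
    rw [← pow_mul]
    exact_mod_cast hDbig.le
  have hpow : ∀ a b : ℕ, a ≤ b → (ℓ : ℝ) ^ a ≤ ℓ ^ b := fun a b h =>
    pow_le_pow_right₀ (by linarith) h
  set J₀ := ⌊s / ℓ ^ 18⌋₊ with hJ₀
  have hJ₀le : (J₀ : ℝ) ≤ s / ℓ ^ 18 := Nat.floor_le (by positivity)
  have hJ₀le' : (J₀ : ℝ) * ℓ ^ 18 ≤ s := by rwa [le_div_iff₀ (by positivity)] at hJ₀le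
  have h232 : (ℓ : ℝ) ^ 232 ≤ s / ℓ ^ 18 := by
    rw [le_div_iff₀ (by positivity), ← pow_add]; exact hsbig
  have h2' : (2 : ℝ) ≤ ℓ ^ 232 := by
    have := hpow 1 232 (by norm_num)
    rw [pow_one] at this; linarith
  have hJ₀ge : s / ℓ ^ 18 ≤ 2 * J₀ := by
    have := Nat.lt_floor_add_one (s / (ℓ : ℝ) ^ 18)
    rw [← hJ₀] at this
    linarith
  have hJ₀ge' : s ≤ 2 * J₀ * ℓ ^ 18 := by rwa [div_le_iff₀ (by positivity)] at hJ₀ge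
  have hJ₀big : (ℓ : ℝ) ^ 231 ≤ J₀ := by
    have : (2 : ℝ) * ℓ ^ 231 ≤ ℓ ^ 232 := by
      rw [pow_succ _ 231]
      have : (0 : ℝ) < ℓ ^ 231 := by positivity
      nlinarith
    linarith
  set B := ⌈√s⌉₊ with hB
  have hBge : √s ≤ B := Nat.le_ceil _
  have hss : √s * √s = s := Real.mul_self_sqrt hs0
  have hsqs : (ℓ : ℝ) ^ 125 ≤ √s := by
    refine Real.le_sqrt_of_sq_le ?_
    rw [← pow_mul]; exact hsbig
  have h1ℓ : (1 : ℝ) ≤ ℓ ^ 125 := one_le_pow₀ (by linarith)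
  have hBle : (B : ℝ) ≤ 2 * √s := by
    have := (Nat.ceil_lt_add_one (Real.sqrt_nonneg s)).le
    rw [← hB] at this
    linarith
  have hB1 : 1 ≤ B := by
    have : (1 : ℝ) ≤ B := by linarith
    exact_mod_cast this
  have hℓ4 : (172032 : ℝ) ≤ ℓ ^ 4 := by
    calc (172032 : ℝ) ≤ 21 ^ 4 := by norm_num
      _ ≤ ℓ ^ 4 := by gcongr
  have hkJ : ℓ ^ 34 ≤ J₀ := by
    have : (ℓ : ℝ) ^ 34 ≤ J₀ := (hpow 34 231 (by norm_num)).trans hJ₀big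
    exact_mod_cast this
  have h4k : 4 * (ℓ ^ 34) ^ 3 * J₀ ≤ D := by
    have h1 : (4 : ℝ) * (ℓ ^ 34) ^ 3 ≤ s := by
      calc (4 : ℝ) * (ℓ ^ 34) ^ 3 ≤ (ℓ : ℝ) ^ 4 * (ℓ ^ 34) ^ 3 := by gcongr; linarith
        _ = (ℓ : ℝ) ^ 106 := by ring
        _ ≤ (ℓ : ℝ) ^ 250 := hpow _ _ (by norm_num)
        _ ≤ s := hsbig
    have h2 : (J₀ : ℝ) ≤ s := by
      have : (1 : ℝ) ≤ ℓ ^ 18 := one_le_pow₀ (by linarith)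
      nlinarith [Nat.cast_nonneg (α := ℝ) J₀]
    have : (4 : ℝ) * (ℓ ^ 34) ^ 3 * J₀ ≤ D := by
      rw [← hs2]; gcongr
    exact_mod_cast this
  have hkP : ∀ p ∈ P, 2 * (ℓ ^ 34) ^ 3 < p := by
    intro p hp
    refine lt_of_le_of_lt ?_ (hPℓ p hp)
    calc 2 * (ℓ ^ 34) ^ 3 ≤ ℓ * (ℓ ^ 34) ^ 3 := by gcongr; omega
      _ = ℓ ^ 103 := by ring
      _ ≤ ℓ ^ 500 := Nat.pow_le_pow_right (by omega) (by norm_num)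
  have hεk : 21 * 640 ^ P.card * s ≤ (1 / (8 * ℓ : ℝ)) ^ 4 * ((ℓ ^ 34 : ℕ) * J₀) := by
    have h640' : (640 : ℝ) ^ P.card ≤ ℓ ^ 8 := by exact_mod_cast h640
    have h1 : 21 * 640 ^ P.card * s ≤ 21 * ℓ ^ 8 * (2 * J₀ * ℓ ^ 18) := by gcongr
    refine h1.trans ?_
    rw [div_pow, one_pow, mul_pow, div_mul_eq_mul_div, one_mul, le_div_iff₀ (by positivity)]
    push_cast
    calc 21 * (ℓ : ℝ) ^ 8 * (2 * J₀ * ℓ ^ 18) * (8 ^ 4 * ℓ ^ 4) = 172032 * ((J₀ : ℝ) * ℓ ^ 30) := by ring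
      _ ≤ (ℓ : ℝ) ^ 4 * (J₀ * ℓ ^ 30) := by gcongr
      _ = _ := by ring
  have hfin : ∀ x, |∑ j ∈ range J₀, chi D (x + j)| ≤ 1 / (4 * ℓ) * J₀ := by
    intro x
    refine (hblock (ℓ ^ 34) J₀ B x (1 / (8 * ℓ)) (Nat.one_le_pow _ _ (by omega)) hkP hkJ h4k hB1
      (by rw [← hss, sq]; gcongr) (by positivity) hεk).trans ?_
    have h1 : 4 * ((ℓ ^ 34 : ℕ) : ℝ) ^ 3 * B ≤ 1 / (8 * ℓ) * J₀ := by
      rw [div_mul_eq_mul_div, one_mul, le_div_iff₀ (by positivity)]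
      push_cast
      refine le_of_mul_le_mul_right ?_ (by positivity : (0 : ℝ) < ℓ ^ 18)
      refine le_trans ?_ (by linarith : s / 2 ≤ J₀ * ℓ ^ 18)
      calc 4 * ((ℓ : ℝ) ^ 34) ^ 3 * B * (8 * ℓ) * ℓ ^ 18
          ≤ 4 * ((ℓ : ℝ) ^ 34) ^ 3 * (2 * √s) * (8 * ℓ) * ℓ ^ 18 := by gcongr
        _ = 64 * ℓ ^ 121 * √s := by ring
        _ ≤ √s / 2 * √s := by
            gcongr
            have : (128 : ℝ) * ℓ ^ 121 ≤ ℓ ^ 4 * ℓ ^ 121 := by gcongr; linarith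
            rw [← pow_add] at this
            norm_num at this
            linarith
        _ = s / 2 := by rw [div_mul_eq_mul_div, hss]
    have h2 : (1 : ℝ) / (4 * ℓ) * J₀ = 1 / (8 * ℓ) * J₀ + 1 / (8 * ℓ) * J₀ := by
      field_simp; ring
    linarith
  have hJ₀pos : 0 < J₀ := by
    have : 0 < ℓ ^ 34 := by positivity
    omega
  have key := abs_sum_range_le_of_blocks (f := fun j => chi D (x + j)) (fun n => abs_chi_le_one _ _)
    hJ₀pos (β := 1 / (4 * ℓ)) (fun y => by
      have := hfin (x + y)
      simpa only [add_assoc] using this) J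
  refine key.trans_lt ?_
  have hJpos : (0 : ℝ) < J := by
    by_contra h
    have : (J : ℝ) = 0 := le_antisymm (not_lt.1 h) (Nat.cast_nonneg _)
    rw [this, zero_mul] at hJ
    have : (0 : ℝ) < ℓ ^ 250 := by positivity
    linarith
  have h3 : (J₀ : ℝ) ≤ J / (4 * ℓ) := by
    rw [le_div_iff₀ (by positivity)]
    refine le_of_mul_le_mul_right ?_ (by positivity : (0 : ℝ) < ℓ ^ 16)
    refine le_trans ?_ (hJ₀le'.trans hJ)
    calc (J₀ : ℝ) * (4 * ℓ) * ℓ ^ 16 = (J₀ : ℝ) * (4 * ℓ ^ 17) := by ring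
      _ ≤ (J₀ : ℝ) * (ℓ * ℓ ^ 17) := by gcongr; linarith
      _ = (J₀ : ℝ) * ℓ ^ 18 := by ring
  have h4 : (1 : ℝ) / (4 * ℓ) * J + J / (4 * ℓ) = (J / ℓ) / 2 := by field_simp; norm_num
  have h5 : (0 : ℝ) < J / ℓ := by positivity
  linarith

/-! ### Long gaps between residues -/

lemma exists_large_sum_of_window {P : Finset ℕ} (hP : ∀ p ∈ P, p.Prime) {A r c J : ℕ} (hJ0 : 0 < J)
    (hr : A * r ≡ 1 [MOD ∏ p ∈ P, p])
    (h : ∀ j < J, ∃ p ∈ P, chi p (c + A * j) = -1) :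
    ∃ Q ∈ P.powerset, Q.Nonempty ∧
      (J : ℝ) / 2 ^ P.card ≤ |∑ j ∈ range J, chi (∏ p ∈ Q, p) (r * c + j)| := by
  classical
  by_contra! hcon
  have h0 : ∑ j ∈ range J, ∏ p ∈ P, (1 + chi p (c + A * j)) = 0 := by
    refine sum_eq_zero fun j hj => ?_
    obtain ⟨p, hp, hpj⟩ := h j (mem_range.1 hj)
    exact prod_eq_zero hp (by rw [hpj]; norm_num)
  have h1 : ∀ Q ∈ P.powerset, ∑ j ∈ range J, ∏ p ∈ Q, chi p (c + A * j) =
      chi (∏ p ∈ Q, p) A * ∑ j ∈ range J, chi (∏ p ∈ Q, p) (r * c + j) := by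
    intro Q hQ
    rw [mem_powerset] at hQ
    rw [mul_sum]
    refine sum_congr rfl fun j _ => ?_
    rw [← chi_prod Q fun p hp => hP p (hQ hp), ← chi_mul]
    refine chi_congr ?_
    have := (hr.of_dvd (prod_dvd_prod_of_subset _ _ _ hQ)).mul_right c
    rw [one_mul, mul_assoc] at this
    rw [mul_add]
    exact (this.add_right _).symm
  simp only [prod_one_add] at h0
  rw [sum_comm, sum_congr rfl h1, ← add_sum_erase _ _ (empty_mem_powerset P)] at h0
  simp only [prod_empty] at h0
  have h2 : chi 1 A * ∑ j ∈ range J, chi 1 (r * c + j) = J := by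
    simp [chi]
  rw [h2] at h0
  have h3 : |∑ Q ∈ P.powerset.erase ∅, chi (∏ p ∈ Q, p) A *
      ∑ j ∈ range J, chi (∏ p ∈ Q, p) (r * c + j)| ≤
      ∑ Q ∈ P.powerset.erase ∅, |∑ j ∈ range J, chi (∏ p ∈ Q, p) (r * c + j)| := by
    refine (abs_sum_le_sum_abs _ _).trans (sum_le_sum fun Q _ => ?_)
    rw [abs_mul]
    exact mul_le_of_le_one_left (abs_nonneg _) (abs_chi_le_one _ _)
  have hJ : |∑ Q ∈ P.powerset.erase ∅, chi (∏ p ∈ Q, p) A *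
      ∑ j ∈ range J, chi (∏ p ∈ Q, p) (r * c + j)| = J := by
    rw [eq_neg_of_add_eq_zero_right h0, abs_neg, Nat.abs_cast]
  have hcard : ((P.powerset.erase ∅).card : ℝ) = 2 ^ P.card - 1 := by
    rw [card_erase_of_mem (empty_mem_powerset P), card_powerset,
      Nat.cast_sub (Nat.one_le_two_pow)]
    push_cast; rfl
  have h4 : ∑ Q ∈ P.powerset.erase ∅, |∑ j ∈ range J, chi (∏ p ∈ Q, p) (r * c + j)| ≤
      (2 ^ P.card - 1) * (J / 2 ^ P.card) := by
    rw [← hcard, ← nsmul_eq_mul]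
    refine sum_le_card_nsmul _ _ _ fun Q hQ => ?_
    rw [mem_erase] at hQ
    exact (hcon Q hQ.2 (nonempty_iff_ne_empty.2 hQ.1)).le
  have h2w : (0 : ℝ) < 2 ^ P.card := by positivity
  have h5 : ((2 : ℝ) ^ P.card - 1) * (J / 2 ^ P.card) = J - J / 2 ^ P.card := by
    field_simp
  have h6 : (0 : ℝ) < J / 2 ^ P.card := by positivity
  linarith

lemma sum_range_prod_eq_mul {P Q : Finset ℕ} (hP : ∀ p ∈ P, p.Prime) (hQ : Q ⊆ P) (f : ℕ → ℝ)
    (hf : ∀ y, f (y % ∏ p ∈ Q, p) = f y) :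
    ∑ y ∈ range (∏ p ∈ P, p), f y =
      ((∏ p ∈ P \ Q, p : ℕ) : ℝ) * ∑ y ∈ range (∏ p ∈ Q, p), f y := by
  have hQP : ∀ p ∈ Q, p.Prime := fun p hp => hP p (hQ hp)
  have hSP : ∀ p ∈ P \ Q, p.Prime := fun p hp => hP p (mem_sdiff.1 hp).1
  have hcop : (∏ p ∈ P \ Q, p).Coprime (∏ p ∈ Q, p) := by
    refine Nat.Coprime.prod_left fun p hp => ?_
    exact coprime_prod_primes hQP (hSP p hp) (mem_sdiff.1 hp).2
  rw [← prod_sdiff hQ]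
  have := sum_range_mul_mod hcop (prod_primes_pos hSP) (prod_primes_pos hQP) (fun _ v => f v)
  simp only [hf] at this
  rw [this, sum_const, card_range, nsmul_eq_mul]

lemma card_large_sum_le {P Q : Finset ℕ} (hP : ∀ p ∈ P, p.Prime) (hP2 : 2 ∉ P) (hQ : Q ⊆ P)
    {J : ℕ} (hJ : 0 < J) :
    (((range (∏ p ∈ P, p)).filter fun y => (J : ℝ) / 2 ^ P.card ≤
      |∑ j ∈ range J, chi (∏ p ∈ Q, p) (y + j)|).card : ℝ) ≤
      ((∏ p ∈ P, p : ℕ) : ℝ) * (16 ^ P.card * (3 / (J : ℝ) ^ 2 +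
        4 * 640 ^ P.card / √((∏ p ∈ Q, p : ℕ) : ℝ))) := by
  have hQP : ∀ p ∈ Q, p.Prime := fun p hp => hP p (hQ hp)
  set D := ∏ p ∈ Q, p with hD
  have hDpos : (0 : ℝ) < D := by exact_mod_cast prod_primes_pos hQP
  have hJ' : (0 : ℝ) < J := by exact_mod_cast hJ
  set f : ℕ → ℝ := fun y => (∑ j ∈ range J, chi D (y + j)) ^ 4 with hf
  have h1 := sum_range_prod_eq_mul hP hQ f (fun y => by
    simp only [hf]
    congr 1
    refine sum_congr rfl fun j _ => chi_congr ?_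
    exact (Nat.mod_modEq y D).add_right j)
  have h2 : ∑ y ∈ range D, f y ≤ _ := fourth_moment_le hQP (fun h => hP2 (hQ h)) J
  have hprod : ((∏ p ∈ P, p : ℕ) : ℝ) = ((∏ p ∈ P \ Q, p : ℕ) : ℝ) * D := by
    rw [hD, ← Nat.cast_mul, prod_sdiff hQ]
  have hcard : Q.card ≤ P.card := card_le_card hQ
  have h3 : (((range (∏ p ∈ P, p)).filter fun y => (J : ℝ) / 2 ^ P.card ≤
      |∑ j ∈ range J, chi D (y + j)|).card : ℝ) * (J / 2 ^ P.card) ^ 4 ≤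
      ∑ y ∈ range (∏ p ∈ P, p), f y := by
    rw [← nsmul_eq_mul]
    refine (card_nsmul_le_sum _ f _ fun y hy => ?_).trans
      (sum_le_sum_of_subset_of_nonneg (filter_subset _ _) fun y _ _ => by positivity)
    have := (mem_filter.1 hy).2
    simp only [hf]
    rw [← Even.pow_abs (by decide : Even 4) (∑ j ∈ range J, chi D (y + j))]
    gcongr
  have hs : √(D : ℝ) * √(D : ℝ) = D := Real.mul_self_sqrt hDpos.le
  have hspos : 0 < √(D : ℝ) := Real.sqrt_pos.2 hDpos
  have h4 : ((J : ℝ) / 2 ^ P.card) ^ 4 = J ^ 4 / 16 ^ P.card := by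
    rw [div_pow, ← pow_mul, mul_comm, pow_mul]; norm_num
  rw [h4] at h3
  have h5 : (0 : ℝ) < J ^ 4 / 16 ^ P.card := by positivity
  refine le_of_mul_le_mul_right (h3.trans ?_) h5
  rw [h1, hprod]
  calc ((∏ p ∈ P \ Q, p : ℕ) : ℝ) * ∑ y ∈ range D, f y
      ≤ ((∏ p ∈ P \ Q, p : ℕ) : ℝ) * (3 * J ^ 2 * D + 4 * 640 ^ P.card * √(D : ℝ) * J ^ 4) := by
        gcongr
        refine h2.trans ?_
        gcongr
        norm_num
    _ = ((∏ p ∈ P \ Q, p : ℕ) : ℝ) *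
        (3 * J ^ 2 * D + 4 * 640 ^ P.card * (D / √(D : ℝ)) * J ^ 4) := by
        rw [Real.div_sqrt]
    _ = _ := by field_simp

lemma sum_card_large_sum_le {P Q : Finset ℕ} (hP : ∀ p ∈ P, p.Prime) (hP2 : 2 ∉ P) (hQ : Q ⊆ P)
    (hne : Q.Nonempty) {ℓ : ℕ} (hℓ : 21 ≤ ℓ) (hPℓ : ∀ p ∈ P, ℓ ^ 500 < p)
    (h640 : 640 ^ P.card ≤ ℓ ^ 8) (h2 : 2 ^ P.card ≤ ℓ) {J₁ J₂ : ℕ} (hJ₁ : 0 < J₁) :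
    ∑ J ∈ Ico J₁ J₂, (((range (∏ p ∈ P, p)).filter fun y => (J : ℝ) / 2 ^ P.card ≤
      |∑ j ∈ range J, chi (∏ p ∈ Q, p) (y + j)|).card : ℝ) ≤
      ((∏ p ∈ P, p : ℕ) : ℝ) * (16 ^ P.card * (6 / J₁ + 4 / (ℓ : ℝ) ^ 8)) := by
  have hQP : ∀ p ∈ Q, p.Prime := fun p hp => hP p (hQ hp)
  set D := ∏ p ∈ Q, p with hD
  have hDpos : (0 : ℝ) < D := by exact_mod_cast prod_primes_pos hQP
  have hspos : 0 < √(D : ℝ) := Real.sqrt_pos.2 hDpos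
  have hℓ0 : (0 : ℝ) < ℓ := by exact_mod_cast (by omega : 0 < ℓ)
  have hcard : Q.card ≤ P.card := card_le_card hQ
  have hterm : ∀ J ∈ Ico J₁ J₂, (((range (∏ p ∈ P, p)).filter fun y => (J : ℝ) / 2 ^ P.card ≤
      |∑ j ∈ range J, chi D (y + j)|).card : ℝ) ≤
      ((∏ p ∈ P, p : ℕ) : ℝ) * (16 ^ P.card * (3 * ((J : ℝ) ^ 2)⁻¹ +
        if (J : ℝ) * ℓ ^ 16 < √(D : ℝ) then 4 * ℓ ^ 8 / √(D : ℝ) else 0)) := by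
    intro J hJ
    have hJ0 : 0 < J := hJ₁.trans_le (mem_Ico.1 hJ).1
    split_ifs with hc
    · refine (card_large_sum_le hP hP2 hQ hJ0).trans ?_
      rw [← div_eq_mul_inv]
      gcongr
      exact_mod_cast h640
    · have hempty : ((range (∏ p ∈ P, p)).filter fun y => (J : ℝ) / 2 ^ P.card ≤
          |∑ j ∈ range J, chi D (y + j)|) = ∅ := by
        refine filter_eq_empty_iff.2 fun y _ => not_le.2 ?_
        refine (abs_sum_chi_lt hQP hℓ (fun p hp => hPℓ p (hQ hp)) ?_ hne (not_lt.1 hc)).trans_le ?_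
        · exact (Nat.pow_le_pow_right (by norm_num) hcard).trans h640
        · gcongr
          exact_mod_cast h2
      rw [hempty, card_empty, Nat.cast_zero]
      positivity
  refine (sum_le_sum hterm).trans ?_
  rw [← mul_sum, ← mul_sum, sum_add_distrib, ← mul_sum]
  gcongr
  · have h1 : Ico J₁ J₂ = Ioo (J₁ - 1) J₂ := by
      ext x; simp only [mem_Ico, mem_Ioo]; omega
    have := sum_Ioo_inv_sq_le (α := ℝ) (J₁ - 1) J₂
    rw [h1]
    have h3 : ((J₁ - 1 : ℕ) : ℝ) + 1 = J₁ := by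
      rw [Nat.cast_sub hJ₁]; simp
    rw [h3] at this
    calc 3 * ∑ i ∈ Ioo (J₁ - 1) J₂, ((i : ℝ) ^ 2)⁻¹ ≤ 3 * (2 / J₁) := by gcongr
      _ = 6 / J₁ := by ring
  · rw [← sum_filter, sum_const, nsmul_eq_mul]
    have hc : (((Ico J₁ J₂).filter fun J : ℕ => (J : ℝ) * ℓ ^ 16 < √(D : ℝ)).card : ℝ) ≤
        √(D : ℝ) / ℓ ^ 16 := by
      have hsub : ((Ico J₁ J₂).filter fun J : ℕ => (J : ℝ) * ℓ ^ 16 < √(D : ℝ)) ⊆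
          Ioc 0 ⌊√(D : ℝ) / ℓ ^ 16⌋₊ := by
        intro J hJ
        rw [mem_filter, mem_Ico] at hJ
        rw [mem_Ioc]
        refine ⟨by omega, Nat.le_floor ?_⟩
        rw [le_div_iff₀ (by positivity)]
        exact hJ.2.le
      refine (Nat.cast_le.2 (card_le_card hsub)).trans ?_
      rw [Nat.card_Ioc, Nat.sub_zero]
      exact Nat.floor_le (by positivity)
    calc _ ≤ √(D : ℝ) / ℓ ^ 16 * (4 * ℓ ^ 8 / √(D : ℝ)) := by gcongr
      _ = 4 / (ℓ : ℝ) ^ 8 := by field_simp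

/-- Starting points of long windows on which some nontrivial character sum is large. -/
noncomputable def badSet (P : Finset ℕ) (J : ℕ) : Finset ℕ := by
  classical
  exact (range (∏ p ∈ P, p)).filter fun y => ∃ Q ∈ P.powerset, Q.Nonempty ∧
    (J : ℝ) / 2 ^ P.card ≤ |∑ j ∈ range J, chi (∏ p ∈ Q, p) (y + j)|

lemma sum_card_badSet_le {P : Finset ℕ} (hP : ∀ p ∈ P, p.Prime) (hP2 : 2 ∉ P)
    {ℓ : ℕ} (hℓ : 21 ≤ ℓ) (hPℓ : ∀ p ∈ P, ℓ ^ 500 < p)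
    (h640 : 640 ^ P.card ≤ ℓ ^ 8) (h2 : 2 ^ P.card ≤ ℓ) {J₁ J₂ : ℕ} (hJ₁ : ℓ ^ 8 ≤ J₁) :
    ∑ J ∈ Ico J₁ J₂, ((badSet P J).card : ℝ) ≤ ((∏ p ∈ P, p : ℕ) : ℝ) * (10 / (ℓ : ℝ) ^ 3) := by
  classical
  have hℓ0 : (0 : ℝ) < ℓ := by exact_mod_cast (by omega : 0 < ℓ)
  have hJ0 : 0 < J₁ := lt_of_lt_of_le (by positivity) hJ₁
  have hb : ∀ J, ((badSet P J).card : ℝ) ≤ ∑ Q ∈ P.powerset.filter (·.Nonempty),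
      (((range (∏ p ∈ P, p)).filter fun y => (J : ℝ) / 2 ^ P.card ≤
      |∑ j ∈ range J, chi (∏ p ∈ Q, p) (y + j)|).card : ℝ) := by
    intro J
    have : badSet P J ⊆ (P.powerset.filter (·.Nonempty)).biUnion fun Q =>
        (range (∏ p ∈ P, p)).filter fun y => (J : ℝ) / 2 ^ P.card ≤
      |∑ j ∈ range J, chi (∏ p ∈ Q, p) (y + j)| := by
      intro y hy
      simp only [badSet, mem_filter] at hy
      obtain ⟨hy1, Q, hQ, hQ1, hQ2⟩ := hy
      simp only [mem_biUnion, mem_filter]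
      exact ⟨Q, ⟨hQ, hQ1⟩, hy1, hQ2⟩
    exact_mod_cast (card_le_card this).trans card_biUnion_le
  refine (sum_le_sum fun J _ => hb J).trans ?_
  rw [sum_comm]
  have hQ : ∀ Q ∈ P.powerset.filter (·.Nonempty), _ ≤ _ := fun Q hQ =>
    sum_card_large_sum_le hP hP2 (mem_powerset.1 (mem_filter.1 hQ).1) (mem_filter.1 hQ).2
      hℓ hPℓ h640 h2 (J₂ := J₂) hJ0
  refine (sum_le_card_nsmul _ _ _ hQ).trans ?_
  rw [nsmul_eq_mul]
  have hc : ((P.powerset.filter (·.Nonempty)).card : ℝ) ≤ 2 ^ P.card := by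
    have := card_filter_le P.powerset (·.Nonempty)
    rw [card_powerset] at this
    exact_mod_cast this
  have h2' : (2 : ℝ) ^ P.card ≤ ℓ := by exact_mod_cast h2
  have hJ' : (ℓ : ℝ) ^ 8 ≤ J₁ := by exact_mod_cast hJ₁
  calc _ ≤ (2 : ℝ) ^ P.card * (((∏ p ∈ P, p : ℕ) : ℝ) * (16 ^ P.card *
        (6 / (ℓ : ℝ) ^ 8 + 4 / (ℓ : ℝ) ^ 8))) := by gcongr
    _ = ((∏ p ∈ P, p : ℕ) : ℝ) * (((2 : ℝ) ^ P.card) ^ 5 * (10 / (ℓ : ℝ) ^ 8)) := by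
        have : (16 : ℝ) ^ P.card = (2 ^ P.card) ^ 4 := by
          rw [← pow_mul, mul_comm, pow_mul]; norm_num
        rw [this]; ring
    _ ≤ ((∏ p ∈ P, p : ℕ) : ℝ) * ((ℓ : ℝ) ^ 5 * (10 / (ℓ : ℝ) ^ 8)) := by gcongr
    _ = _ := by field_simp

lemma isSquare_natCast_mul_iff {a b : ℕ} (hab : a.Coprime b) (x : ℕ) :
    IsSquare (x : ZMod (a * b)) ↔ IsSquare (x : ZMod a) ∧ IsSquare (x : ZMod b) := by
  constructor
  · intro h
    have h1 := h.map (ZMod.castHom (dvd_mul_right a b) (ZMod a))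
    have h2 := h.map (ZMod.castHom (dvd_mul_left b a) (ZMod b))
    rw [map_natCast] at h1 h2
    exact ⟨h1, h2⟩
  · rintro ⟨⟨u, hu⟩, ⟨v, hv⟩⟩
    have h : IsSquare (((x : ZMod a), (x : ZMod b))) :=
      ⟨(u, v), by rw [Prod.mk_mul_mk, ← hu, ← hv]⟩
    have := h.map (ZMod.chineseRemainder hab).symm
    have h3 : ((x : ZMod a), (x : ZMod b)) = ((x : ℕ) : ZMod a × ZMod b) := by
      ext <;> simp
    rwa [h3, map_natCast] at this

lemma isSquare_natCast_prod_iff {P : Finset ℕ} (hP : ∀ p ∈ P, p.Prime) (x : ℕ) :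
    IsSquare (x : ZMod (∏ p ∈ P, p)) ↔ ∀ p ∈ P, IsSquare (x : ZMod p) := by
  induction P using Finset.induction_on with
  | empty =>
    simp only [notMem_empty, false_imp_iff, implies_true, iff_true]
    refine ⟨0, ?_⟩
    rw [prod_empty]
    exact Subsingleton.elim _ _
  | insert q P hq ih =>
    have hP' : ∀ p ∈ P, p.Prime := fun p hp => hP p (mem_insert_of_mem hp)
    rw [prod_insert hq, isSquare_natCast_mul_iff
      (coprime_prod_primes hP' (hP q (mem_insert_self _ _)) hq), ih hP', forall_mem_insert]

lemma not_isSquare_iff_chi {p : ℕ} (hp : p.Prime) (x : ℕ) :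
    ¬ IsSquare (x : ZMod p) ↔ chi p x = -1 := by
  have := Fact.mk hp
  rw [chi_prime, ← quadraticChar_neg_one_iff_not_isSquare]
  norm_cast

lemma isSquare_natCast_congr {n x y : ℕ} (h : x ≡ y [MOD n]) :
    IsSquare (x : ZMod n) ↔ IsSquare (y : ZMod n) := by
  rw [(ZMod.natCast_eq_natCast_iff x y n).2 h]

/-- The starting points of square-free windows of length `h` modulo `M`. -/
noncomputable def gapSet (M h : ℕ) : Finset ℕ := by
  classical
  exact (range M).filter fun x => ∀ i < h, ¬ IsSquare ((x + (i + 1) : ℕ) : ZMod M)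

lemma gapSet_subset (M h : ℕ) : gapSet M h ⊆ range M := by
  classical
  exact filter_subset _ _

lemma badSet_subset (P : Finset ℕ) (J : ℕ) : badSet P J ⊆ range (∏ p ∈ P, p) := by
  classical
  exact filter_subset _ _

lemma gapSet_anti (M : ℕ) {h h' : ℕ} (hh : h ≤ h') : gapSet M h' ⊆ gapSet M h := by
  classical
  intro x hx
  simp only [gapSet, mem_filter] at hx ⊢
  exact ⟨hx.1, fun i hi => hx.2 i (hi.trans_le hh)⟩

lemma card_gapSet_le_badSet {P : Finset ℕ} (hP : ∀ p ∈ P, p.Prime) {A : ℕ} (hA : 0 < A)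
    (hAP : A.Coprime (∏ p ∈ P, p)) {h : ℕ} (hh : A ≤ h) :
    (gapSet (A * ∏ p ∈ P, p) h).card ≤ A * (badSet P (h / A)).card := by
  classical
  set m := ∏ p ∈ P, p with hm
  have hmpos : 0 < m := prod_primes_pos hP
  have : NeZero m := ⟨hmpos.ne'⟩
  set J := h / A with hJ
  have hJ0 : 0 < J := Nat.div_pos hh hA
  have hJh : A * J ≤ h := Nat.mul_div_le h A
  obtain ⟨r, hr⟩ := Nat.exists_mul_mod_eq_of_coprime 1 hAP hmpos.ne'
  replace hr : A * r ≡ 1 [MOD m] := hr.2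
  set i₀ : ℕ → ℕ := fun u => 1 + (A - u) % A with hi₀
  have hi₀A : ∀ u, i₀ u ≤ A := fun u => by
    have := Nat.mod_lt (A - u) hA
    simp only [hi₀]; omega
  set G : ZMod m → ℝ := fun z => if z.val ∈ badSet P J then 1 else 0 with hG
  set H : ℕ → ℕ → ℝ := fun u v => G ((r : ZMod m) * (v + i₀ u)) with hH
  have hcard : ((gapSet (A * m) h).card : ℝ) ≤ ∑ x ∈ range (A * m), H (x % A) (x % m) := by
    have : ((gapSet (A * m) h).card : ℝ) =
        ∑ x ∈ range (A * m), if x ∈ gapSet (A * m) h then (1 : ℝ) else 0 := by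
      rw [sum_ite_mem, inter_eq_right.2 (gapSet_subset _ _)]
      simp
    rw [this]
    refine sum_le_sum fun x _ => ?_
    split_ifs with hx
    · have key : (r * (x + i₀ (x % A))) % m ∈ badSet P J := by
        simp only [badSet, mem_filter, mem_range]
        refine ⟨Nat.mod_lt _ hmpos, ?_⟩
        have hw := exists_large_sum_of_window hP (c := x + i₀ (x % A)) hJ0 hr (fun j hj => by
          simp only [gapSet, mem_filter] at hx
          have h1 : A * (j + 1) ≤ A * J := Nat.mul_le_mul_left _ hj
          have hle : i₀ (x % A) + A * j ≤ h := by
            have := hi₀A (x % A)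
            rw [mul_add] at h1
            omega
          have hns := hx.2 (i₀ (x % A) + A * j - 1) (by simp only [hi₀] at hle ⊢; omega)
          have h2 : x + (i₀ (x % A) + A * j - 1 + 1) = x + i₀ (x % A) + A * j := by
            simp only [hi₀]; omega
          rw [h2, isSquare_natCast_mul_iff hAP, isSquare_natCast_prod_iff hP] at hns
          have h3 : IsSquare ((x + i₀ (x % A) + A * j : ℕ) : ZMod A) := by
            have h4 : x + i₀ (x % A) + A * j ≡ 1 [MOD A] := by
              have h5 : x % A < A := Nat.mod_lt _ hA
              have e1 : x + i₀ (x % A) + A * j ≡ x % A + (1 + (A - x % A)) + A * 0 [MOD A] := by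
                refine Nat.ModEq.add (Nat.ModEq.add (Nat.mod_modEq _ _).symm
                  ((Nat.mod_modEq _ _).add_left 1)) ?_
                rw [mul_zero]
                exact (Nat.modEq_zero_iff_dvd.2 (dvd_mul_right _ _))
              have e2 : x % A + (1 + (A - x % A)) + A * 0 = 1 + A := by omega
              rw [e2] at e1
              exact e1.trans (by simp [Nat.ModEq])
            rw [isSquare_natCast_congr h4]
            exact ⟨1, by simp⟩
          by_contra! hcon
          refine hns ⟨h3, fun p hp => ?_⟩
          by_contra hnot
          exact hcon p hp ((not_isSquare_iff_chi (hP p hp) _).1 hnot))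
        obtain ⟨Q, hQ, hQ1, hQ2⟩ := hw
        refine ⟨Q, hQ, hQ1, hQ2.trans (le_of_eq ?_)⟩
        congr 1
        refine sum_congr rfl fun j _ => chi_congr ?_
        have hd : (∏ p ∈ Q, p) ∣ m := prod_dvd_prod_of_subset _ _ _ (mem_powerset.1 hQ)
        exact (((Nat.mod_modEq _ m).of_dvd hd).symm).add_right j
      have : (r : ZMod m) * (((x % m : ℕ) : ZMod m) + ((i₀ (x % A) : ℕ) : ZMod m)) =
          ((r * (x + i₀ (x % A)) : ℕ) : ZMod m) := by
        push_cast
        rw [ZMod.natCast_mod]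
      simp only [hH, hG]
      rw [this, ZMod.val_natCast, if_pos key]
    · simp only [hH, hG]
      split_ifs <;> norm_num
  have hsum : ∀ u, ∑ v ∈ range m, H u v = (badSet P J).card := by
    intro u
    have h1 : ∑ v ∈ range m, H u v = ∑ z : ZMod m, G ((r : ZMod m) * (z + i₀ u)) :=
      sum_range_zmod m fun z => G ((r : ZMod m) * (z + i₀ u))
    have hAr : (A : ZMod m) * r = 1 := by
      have := (ZMod.natCast_eq_natCast_iff _ _ _).2 hr
      push_cast at this
      exact this
    have hbij : Function.Bijective fun z : ZMod m => (r : ZMod m) * (z + i₀ u) := by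
      rw [Fintype.bijective_iff_injective_and_card]
      refine ⟨fun z z' hz => ?_, rfl⟩
      have := congrArg (fun t => (A : ZMod m) * t) hz
      simp only [← mul_assoc, hAr, one_mul] at this
      exact add_right_cancel this
    rw [h1, hbij.sum_comp G, ← sum_range_zmod m G]
    have h2 : ∀ x ∈ range m, G (x : ZMod m) = if x ∈ badSet P J then 1 else 0 := by
      intro x hx
      simp only [hG]
      rw [ZMod.val_natCast, Nat.mod_eq_of_lt (mem_range.1 hx)]
    rw [sum_congr rfl h2, sum_ite_mem, inter_eq_right.2 (badSet_subset _ _)]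
    simp
  have := hcard.trans_eq (sum_range_mul_mod hAP hA hmpos H)
  simp only [hsum, sum_const, card_range, nsmul_eq_mul] at this
  exact_mod_cast this

lemma sum_range_mul_div {A : ℕ} (hA : 0 < A) (n : ℕ) (G : ℕ → ℝ) :
    ∑ h ∈ range (A * n), G (h / A) = A * ∑ J ∈ range n, G J := by
  induction n with
  | zero => simp
  | succ n ih =>
    rw [Nat.mul_succ, sum_range_add, ih, sum_range_succ, mul_add]
    congr 1
    have : ∀ x ∈ range A, G ((A * n + x) / A) = G n := by
      intro x hx
      rw [Nat.mul_add_div hA, Nat.div_eq_of_lt (mem_range.1 hx), add_zero]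
    rw [sum_congr rfl this, sum_const, card_range, nsmul_eq_mul]

lemma sum_card_gapSet_tail_le {P : Finset ℕ} (hP : ∀ p ∈ P, p.Prime) (hP2 : 2 ∉ P) {A : ℕ}
    (hA : 0 < A) (hAP : A.Coprime (∏ p ∈ P, p))
    {ℓ : ℕ} (hℓ : 21 ≤ ℓ) (hPℓ : ∀ p ∈ P, ℓ ^ 500 < p)
    (h640 : 640 ^ P.card ≤ ℓ ^ 8) (h2 : 2 ^ P.card ≤ ℓ) :
    ∑ h ∈ Ico (A * ℓ ^ 8) (A * ∏ p ∈ P, p), ((gapSet (A * ∏ p ∈ P, p) h).card : ℝ) ≤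
      (A * ∏ p ∈ P, p : ℕ) * (10 * A / (ℓ : ℝ) ^ 3) := by
  classical
  set m := ∏ p ∈ P, p with hm
  have h8 : 0 < ℓ ^ 8 := by positivity
  set G : ℕ → ℝ := fun J => if ℓ ^ 8 ≤ J then (A : ℝ) * (badSet P J).card else 0 with hG
  have hG0 : ∀ J, 0 ≤ G J := fun J => by simp only [hG]; split_ifs <;> positivity
  calc ∑ h ∈ Ico (A * ℓ ^ 8) (A * m), ((gapSet (A * m) h).card : ℝ)
      ≤ ∑ h ∈ Ico (A * ℓ ^ 8) (A * m), G (h / A) := by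
        refine sum_le_sum fun h hh => ?_
        rw [mem_Ico] at hh
        have h1 : ℓ ^ 8 ≤ h / A := (Nat.le_div_iff_mul_le hA).2 (by rw [mul_comm]; exact hh.1)
        simp only [hG]
        rw [if_pos h1]
        exact_mod_cast card_gapSet_le_badSet hP hA hAP
          ((Nat.le_mul_of_pos_right A h8).trans hh.1)
    _ ≤ ∑ h ∈ range (A * m), G (h / A) :=
        sum_le_sum_of_subset_of_nonneg (fun x hx => by
          rw [mem_Ico] at hx; exact mem_range.2 hx.2) fun _ _ _ => hG0 _
    _ = A * ∑ J ∈ range m, G J := sum_range_mul_div hA m G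
    _ = A * ∑ J ∈ Ico (ℓ ^ 8) m, (A : ℝ) * (badSet P J).card := by
        congr 1
        simp only [hG]
        rw [← sum_filter]
        refine sum_congr ?_ fun _ _ => rfl
        ext x
        simp only [mem_filter, mem_range, mem_Ico]
        tauto
    _ ≤ A * (A * ((m : ℝ) * (10 / (ℓ : ℝ) ^ 3))) := by
        rw [← mul_sum]
        gcongr
        exact sum_card_badSet_le hP hP2 hℓ hPℓ h640 h2 le_rfl
    _ = _ := by push_cast; ring

lemma cycGap_le {M : ℕ} {U : Finset (ZMod M)} {x : ZMod M} {k : ℕ} (hk : 0 < k) (h : x + (k : ZMod M) ∈ U) :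
    cycGap M U x ≤ k := Nat.sInf_le (s := {k : ℕ | 0 < k ∧ x + (k : ZMod M) ∈ U}) ⟨hk, h⟩

lemma card_window {M h : ℕ} (hh : h < M) (x : ZMod M) [DecidableEq (ZMod M)] :
    ((range h).image fun i => x + ((i + 1 : ℕ) : ZMod M)).card = h := by
  rw [card_image_of_injOn, card_range]
  intro i hi j hj hij
  simp only [coe_range, Set.mem_Iio] at hi hj
  have := add_left_cancel hij
  rw [ZMod.natCast_eq_natCast_iff', Nat.mod_eq_of_lt (by omega), Nat.mod_eq_of_lt (by omega)] at this
  omega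

lemma sum_range_choose_sub {k : ℕ} (hk : 0 < k) (M : ℕ) :
    ∑ h ∈ range M, (M - h).choose k = (M + 1).choose (k + 1) := by
  induction M with
  | zero => simp [Nat.choose_eq_zero_of_lt (show 1 < k + 1 by omega)]
  | succ M ih =>
    rw [sum_range_succ', Nat.choose_succ_succ' (M + 1) k, ← ih, add_comm, Nat.sub_zero]
    simp only [Nat.add_sub_add_right]


section Gaps

variable {M : ℕ} [NeZero M] {U : Finset (ZMod M)}

lemma univM_eq_univ : univM M = univ := by
  ext x
  simp only [univM, mem_image, mem_range, mem_univ, iff_true]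
  exact ⟨x.val, ZMod.val_lt x, ZMod.natCast_zmod_val x⟩

lemma mem_QR_iff (x : ZMod M) : x ∈ QR M ↔ IsSquare x := by
  simp only [QR, mem_image, mem_range]
  constructor
  · rintro ⟨a, -, rfl⟩
    exact ⟨a, sq _⟩
  · rintro ⟨y, rfl⟩
    exact ⟨y.val, ZMod.val_lt y, by rw [ZMod.natCast_zmod_val, sq]⟩

lemma exists_add_natCast_mem (hU : U.Nonempty) (x : ZMod M) :
    ∃ k : ℕ, (0 < k ∧ x + (k : ZMod M) ∈ U) ∧ k ≤ M := by
  obtain ⟨u, hu⟩ := hU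
  by_cases h : (u - x).val = 0
  · refine ⟨M, ⟨NeZero.pos M, ?_⟩, le_rfl⟩
    have : u = x := sub_eq_zero.1 ((ZMod.val_eq_zero _).1 h)
    rw [ZMod.natCast_self, add_zero, ← this]
    exact hu
  · refine ⟨(u - x).val, ⟨Nat.pos_of_ne_zero h, ?_⟩, (ZMod.val_lt _).le⟩
    rw [ZMod.natCast_zmod_val, add_sub_cancel]
    exact hu

lemma cycGap_spec (hU : U.Nonempty) (x : ZMod M) :
    0 < cycGap M U x ∧ x + (cycGap M U x : ZMod M) ∈ U := by
  obtain ⟨k, hk, -⟩ := exists_add_natCast_mem hU x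
  exact Nat.sInf_mem (s := {k : ℕ | 0 < k ∧ x + (k : ZMod M) ∈ U}) ⟨k, hk⟩

lemma cycGap_le_modulus (hU : U.Nonempty) (x : ZMod M) : cycGap M U x ≤ M := by
  obtain ⟨k, hk, hkM⟩ := exists_add_natCast_mem hU x
  exact (cycGap_le hk.1 hk.2).trans hkM

lemma lt_cycGap_iff (hU : U.Nonempty) (x : ZMod M) (h : ℕ) :
    h < cycGap M U x ↔ ∀ i < h, x + ((i + 1 : ℕ) : ZMod M) ∉ U := by
  constructor
  · intro hh i hi hmem
    have := cycGap_le (Nat.succ_pos i) hmem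
    omega
  · intro hall
    by_contra! hle
    obtain ⟨h1, h2⟩ := cycGap_spec hU x
    refine hall (cycGap M U x - 1) (by omega) ?_
    rwa [Nat.sub_add_cancel h1]

lemma cycGap_add (hU : U.Nonempty) {u : ZMod M} {j : ℕ} (hj : j < cycGap M U u) :
    cycGap M U (u + j) = cycGap M U u - j := by
  refine le_antisymm (cycGap_le (by omega) ?_) ?_
  · rw [add_assoc, ← Nat.cast_add, Nat.add_sub_cancel' hj.le]
    exact (cycGap_spec hU u).2
  · obtain ⟨h1, h2⟩ := cycGap_spec hU (u + j)
    rw [add_assoc, ← Nat.cast_add] at h2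
    have := cycGap_le (by omega) h2
    omega

lemma sum_eq_sum_cycGap (hU : U.Nonempty) (f : ZMod M → ℤ) :
    ∑ x, f x = ∑ u ∈ U, ∑ j ∈ range (cycGap M U u), f (u + j) := by
  rw [sum_sigma']
  symm
  refine sum_bij (fun a _ => a.1 + (a.2 : ZMod M)) (fun _ _ => mem_univ _) ?_ ?_ fun _ _ => rfl
  · have key : ∀ u ∈ U, ∀ u' ∈ U, ∀ j j' : ℕ, j' < cycGap M U u' → j ≤ j' →
        u + (j : ZMod M) = u' + (j' : ZMod M) → u = u' ∧ j = j' := by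
      intro u hu u' _ j j' hj' hjj h
      obtain ⟨d, rfl⟩ := Nat.exists_eq_add_of_le hjj
      have h1 : u = u' + (d : ZMod M) := by
        push_cast at h
        linear_combination h
      rcases Nat.eq_zero_or_pos d with hd | hd
      · subst hd
        simpa using h1
      · have := cycGap_le hd (h1 ▸ hu)
        omega
    rintro ⟨u, j⟩ hu ⟨u', j'⟩ hu' h
    simp only [mem_sigma, mem_range] at hu hu' h
    rcases le_total j j' with hjj | hjj
    · obtain ⟨rfl, rfl⟩ := key u hu.1 u' hu'.1 j j' hu'.2 hjj h
      rfl
    · obtain ⟨rfl, rfl⟩ := key u' hu'.1 u hu.1 j' j hu.2 hjj h.symm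
      rfl
  · intro x _
    have hex : ∃ j : ℕ, x - (j : ZMod M) ∈ U := by
      obtain ⟨u, hu⟩ := hU
      exact ⟨(x - u).val, by rwa [ZMod.natCast_zmod_val, sub_sub_cancel]⟩
    classical
    refine ⟨⟨x - (Nat.find hex : ZMod M), Nat.find hex⟩, ?_, by simp⟩
    simp only [mem_sigma, mem_range]
    refine ⟨Nat.find_spec hex, ?_⟩
    rw [lt_cycGap_iff hU]
    intro i hi hmem
    refine Nat.find_min hex (m := Nat.find hex - (i + 1)) (by omega) ?_
    rw [Nat.cast_sub (by omega)]
    convert hmem using 1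
    ring

lemma sum_range_gap (g : ℕ) : ∑ j ∈ range g, (2 * ((g - j : ℕ) : ℤ) - 1) = (g : ℤ) ^ 2 := by
  rw [← sum_range_reflect]
  have : ∀ j ∈ range g, (2 * ((g - (g - 1 - j) : ℕ) : ℤ) - 1) = 2 * (j : ℤ) + 1 := by
    intro j hj
    have := mem_range.1 hj
    have h : g - (g - 1 - j) = j + 1 := by omega
    rw [h]; push_cast; ring
  rw [sum_congr rfl this]
  clear this
  induction g with
  | zero => simp
  | succ n ih => rw [sum_range_succ, ih]; push_cast; ring

lemma stoch_eq_sum_cycGap (hU : U.Nonempty) :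
    (stoch M U : ℤ) = 2 * ∑ x, (cycGap M U x : ℤ) - M := by
  have h := sum_eq_sum_cycGap hU fun x => 2 * (cycGap M U x : ℤ) - 1
  rw [sum_sub_distrib, ← mul_sum, sum_const, card_univ, ZMod.card, nsmul_eq_mul, mul_one] at h
  rw [h, stoch]
  push_cast
  refine sum_congr rfl fun u _ => ?_
  rw [← sum_range_gap]
  refine sum_congr rfl fun j hj => ?_
  rw [cycGap_add hU (mem_range.1 hj)]

lemma sum_cycGap (hU : U.Nonempty) [DecidableEq (ZMod M)] :
    ∑ x, cycGap M U x =
      ∑ h ∈ range M, (univ.filter fun x : ZMod M =>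
        ∀ i < h, x + ((i + 1 : ℕ) : ZMod M) ∉ U).card := by
  have h1 : ∀ x, cycGap M U x = ∑ h ∈ range M, if h < cycGap M U x then 1 else 0 := by
    intro x
    rw [← sum_filter, ← card_eq_sum_ones]
    have : (range M).filter (fun h => h < cycGap M U x) = range (cycGap M U x) := by
      ext h
      have := cycGap_le_modulus hU x
      simp only [mem_filter, mem_range]
      omega
    rw [this, card_range]
  rw [sum_congr rfl fun x _ => h1 x, sum_comm]
  refine sum_congr rfl fun h _ => ?_
  rw [card_filter]
  refine sum_congr rfl fun x _ => ?_
  simp only [lt_cycGap_iff hU]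

lemma stoch_QR_eq :
    (stoch M (QR M) : ℝ) = 2 * ∑ h ∈ range M, ((gapSet M h).card : ℝ) - M := by
  classical
  have hne : (QR M).Nonempty := ⟨0, (mem_QR_iff 0).2 ⟨0, by simp⟩⟩
  have h1 := stoch_eq_sum_cycGap hne
  have h2 := sum_cycGap hne
  have h3 : ∀ h ∈ range M, (univ.filter fun x : ZMod M =>
        ∀ i < h, x + ((i + 1 : ℕ) : ZMod M) ∉ QR M).card = (gapSet M h).card := by
    intro h _
    symm
    refine card_bij (fun x _ => (x : ZMod M)) ?_ ?_ ?_
    · intro x hx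
      simp only [gapSet, mem_filter, mem_univ, true_and, mem_QR_iff] at hx ⊢
      intro i hi
      have := hx.2 i hi
      rwa [Nat.cast_add] at this
    · intro x hx y hy hxy
      have hx' := mem_range.1 (gapSet_subset _ _ hx)
      have hy' := mem_range.1 (gapSet_subset _ _ hy)
      have := (ZMod.natCast_eq_natCast_iff' _ _ _).1 hxy
      rwa [Nat.mod_eq_of_lt hx', Nat.mod_eq_of_lt hy'] at this
    · intro x hx
      refine ⟨x.val, ?_, ZMod.natCast_zmod_val x⟩
      simp only [gapSet, mem_filter, mem_univ, true_and, mem_QR_iff, mem_range] at hx ⊢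
      refine ⟨ZMod.val_lt x, fun i hi => ?_⟩
      rw [Nat.cast_add, ZMod.natCast_zmod_val]
      exact hx i hi
  rw [sum_congr rfl h3] at h2
  rw [← Nat.cast_sum, h2] at h1
  exact_mod_cast h1

lemma savg_eq {k : ℕ} (hk : 0 < k) (hkM : k ≤ M) :
    savg M k = 2 * M * (M + 1) / (k + 1) - M := by
  classical
  have hC : (0 : ℚ) < Nat.choose M k := by exact_mod_cast Nat.choose_pos hkM
  have hcount : ∀ h ∈ range M, ∑ U ∈ (univ : Finset (ZMod M)).powersetCard k,
      (univ.filter fun x : ZMod M => ∀ i < h, x + ((i + 1 : ℕ) : ZMod M) ∉ U).card =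
      M * (M - h).choose k := by
    intro h hh
    simp only [card_filter]
    rw [sum_comm]
    have : ∀ x ∈ (univ : Finset (ZMod M)), (∑ U ∈ (univ : Finset (ZMod M)).powersetCard k,
        if ∀ i < h, x + ((i + 1 : ℕ) : ZMod M) ∉ U then 1 else 0) = (M - h).choose k := by
      intro x _
      rw [← card_filter]
      set W := (range h).image fun i => x + ((i + 1 : ℕ) : ZMod M) with hW
      have hWc : W.card = h := card_window (mem_range.1 hh) x
      have : ((univ : Finset (ZMod M)).powersetCard k).filter
          (fun U => ∀ i < h, x + ((i + 1 : ℕ) : ZMod M) ∉ U) = powersetCard k Wᶜ := by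
        ext U
        simp only [mem_filter, mem_powersetCard, subset_univ, true_and]
        rw [and_comm]
        refine and_congr_left fun _ => ?_
        rw [subset_compl_iff_disjoint_right, disjoint_right]
        simp [hW]
      rw [this, card_powersetCard, card_compl, ZMod.card, hWc]
    rw [sum_congr rfl this, sum_const, card_univ, ZMod.card, smul_eq_mul]
  have hhs : ∑ h ∈ range M, (M - h).choose k = (M + 1).choose (k + 1) :=
    sum_range_choose_sub hk M
  have hst : ∀ U ∈ (univ : Finset (ZMod M)).powersetCard k, (stoch M U : ℚ) =
      2 * ((∑ h ∈ range M, (univ.filter fun x : ZMod M =>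
        ∀ i < h, x + ((i + 1 : ℕ) : ZMod M) ∉ U).card : ℕ) : ℚ) - M := by
    intro U hU
    have hne : U.Nonempty := card_pos.1 (by rw [(mem_powersetCard.1 hU).2]; exact hk)
    rw [← sum_cycGap hne]
    have := stoch_eq_sum_cycGap hne
    have h2 := congrArg (fun z : ℤ => (z : ℚ)) this
    push_cast at h2 ⊢
    exact h2
  rw [savg, univM_eq_univ, sum_congr rfl hst, sum_sub_distrib, ← mul_sum, ← Nat.cast_sum, sum_comm,
    sum_congr rfl hcount, ← mul_sum, hhs, sum_const, card_powersetCard, card_univ, ZMod.card,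
    nsmul_eq_mul]
  have h1 := Nat.add_one_mul_choose_eq M k
  have h2 : ((M : ℚ) + 1) * M.choose k = (M + 1).choose (k + 1) * (k + 1) := by exact_mod_cast h1
  have h3 : ((M + 1).choose (k + 1) : ℚ) = (M + 1) * M.choose k / (k + 1) := by
    rw [h2]; field_simp
  push_cast
  rw [h3]
  field_simp

end Gaps

/-- The indicator of squares modulo `p`. -/
noncomputable def sqInd (p x : ℕ) : ℝ := by
  classical
  exact if IsSquare (x : ZMod p) then 1 else 0

lemma sqInd_congr {p x y : ℕ} (h : x ≡ y [MOD p]) : sqInd p x = sqInd p y := by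
  have hi := isSquare_natCast_congr h
  unfold sqInd
  by_cases hx : IsSquare (x : ZMod p)
  · rw [if_pos hx, if_pos (hi.1 hx)]
  · rw [if_neg hx, if_neg (fun h' => hx (hi.2 h'))]

lemma sqInd_nonneg (p x : ℕ) : 0 ≤ sqInd p x := by
  unfold sqInd; split_ifs <;> norm_num

lemma sqInd_le_one (p x : ℕ) : sqInd p x ≤ 1 := by
  unfold sqInd; split_ifs <;> norm_num

lemma abs_sqInd_sub_le {p : ℕ} (hp : p.Prime) (x : ℕ) :
    |sqInd p x - (1 + chi p x) / 2| ≤ if p ∣ x then 1 else 0 := by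
  have := Fact.mk hp
  by_cases hx : p ∣ x
  · rw [if_pos hx]
    have h1 := abs_le.1 (abs_chi_le_one p x)
    have h2 := sqInd_nonneg p x
    have h3 := sqInd_le_one p x
    rw [abs_le]
    constructor <;> linarith
  · rw [if_neg hx]
    have hx0 : (x : ZMod p) ≠ 0 := by rwa [Ne, ZMod.natCast_eq_zero_iff]
    by_cases hs : IsSquare (x : ZMod p)
    · have h1 : chi p x = 1 := by
        rw [chi_prime, (quadraticChar_one_iff_isSquare hx0).2 hs]; norm_num
      rw [h1, sqInd, if_pos hs]; norm_num
    · rw [(not_isSquare_iff_chi hp x).1 hs, sqInd, if_neg hs]; norm_num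

lemma abs_prod_sub_prod_le {ι : Type*} (s : Finset ι) {f g : ι → ℝ} (hf : ∀ i, |f i| ≤ 1)
    (hg : ∀ i, |g i| ≤ 1) : |∏ i ∈ s, f i - ∏ i ∈ s, g i| ≤ ∑ i ∈ s, |f i - g i| := by
  classical
  induction s using Finset.induction_on with
  | empty => simp
  | insert a s ha ih =>
    rw [prod_insert ha, prod_insert ha, sum_insert ha]
    have h1 : |∏ i ∈ s, f i| ≤ 1 := by
      rw [abs_prod]; exact prod_le_one (fun i _ => abs_nonneg _) fun i _ => hf i
    calc |f a * ∏ i ∈ s, f i - g a * ∏ i ∈ s, g i|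
        = |(f a - g a) * ∏ i ∈ s, f i + g a * (∏ i ∈ s, f i - ∏ i ∈ s, g i)| := by ring_nf
      _ ≤ |f a - g a| * |∏ i ∈ s, f i| + |g a| * |∏ i ∈ s, f i - ∏ i ∈ s, g i| := by
        rw [← abs_mul, ← abs_mul]; exact abs_add_le _ _
      _ ≤ |f a - g a| * 1 + 1 * ∑ i ∈ s, |f i - g i| := by
        gcongr
        exact hg a
      _ = _ := by ring

lemma abs_sum_prod_half_le {p : ℕ} (hp : p.Prime) (hp2 : p ≠ 2) (T : Finset ℕ)
    (hT : ∀ i ∈ T, ∀ j ∈ T, i ≡ j [MOD p] → i = j) :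
    |∑ y ∈ range p, ∏ i ∈ T, (1 + chi p (y + i)) / 2 - p / 2 ^ T.card| ≤ 20 * T.card * √p := by
  classical
  have h2 : (0 : ℝ) < 2 ^ T.card := by positivity
  have h1 : ∑ y ∈ range p, ∏ i ∈ T, (1 + chi p (y + i)) / 2 =
      (∑ S ∈ T.powerset, ∑ y ∈ range p, ∏ i ∈ S, chi p (y + i)) / 2 ^ T.card := by
    rw [sum_comm, sum_div]
    refine sum_congr rfl fun y _ => ?_
    rw [prod_div_distrib, prod_const, prod_one_add]
  have h3 : ∑ S ∈ T.powerset, ∑ y ∈ range p, ∏ i ∈ S, chi p (y + i) =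
      p + ∑ S ∈ T.powerset.erase ∅, ∑ y ∈ range p, ∏ i ∈ S, chi p (y + i) := by
    rw [← add_sum_erase _ _ (empty_mem_powerset T)]
    simp
  have h4 : |∑ S ∈ T.powerset.erase ∅, ∑ y ∈ range p, ∏ i ∈ S, chi p (y + i)| ≤
      2 ^ T.card * (20 * T.card * √p) := by
    refine (abs_sum_le_sum_abs _ _).trans ?_
    have hb : ∀ S ∈ T.powerset.erase ∅, |∑ y ∈ range p, ∏ i ∈ S, chi p (y + i)| ≤
        20 * T.card * √p := by
      intro S hS
      rw [mem_erase, mem_powerset] at hS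
      obtain ⟨c, hc⟩ := nonempty_iff_ne_empty.2 hS.1
      refine (abs_sum_prod_chi_le hp hp2 S (fun i => i) ⟨c, ?_⟩).trans ?_
      · have : S.filter (fun i => i ≡ c [MOD p]) = {c} := by
          ext i
          simp only [mem_filter, mem_singleton]
          constructor
          · rintro ⟨hi, hic⟩
            exact hT i (hS.2 hi) c (hS.2 hc) hic
          · rintro rfl
            exact ⟨hc, rfl⟩
        rw [this, card_singleton]
        exact odd_one
      · have := card_le_card hS.2
        gcongr
    refine (sum_le_card_nsmul _ _ _ hb).trans ?_
    rw [nsmul_eq_mul]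
    have : ((T.powerset.erase ∅).card : ℝ) ≤ 2 ^ T.card := by
      have := card_le_card (erase_subset ∅ T.powerset)
      rw [card_powerset] at this
      exact_mod_cast this
    gcongr
  rw [h1, h3, add_div, add_sub_cancel_left, abs_div, abs_of_pos h2, div_le_iff₀ h2]
  linarith

lemma abs_sum_prod_sqInd_sub_le {p : ℕ} (hp : p.Prime) (hp2 : p ≠ 2) (T : Finset ℕ)
    (hT : ∀ i ∈ T, ∀ j ∈ T, i ≡ j [MOD p] → i = j) :
    |∑ y ∈ range p, ∏ i ∈ T, sqInd p (y + i) - p / 2 ^ T.card| ≤ 21 * T.card * √p := by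
  have hp0 : 0 < p := hp.pos
  have h1 : |∑ y ∈ range p, ∏ i ∈ T, sqInd p (y + i) -
      ∑ y ∈ range p, ∏ i ∈ T, (1 + chi p (y + i)) / 2| ≤ T.card := by
    rw [← sum_sub_distrib]
    refine (abs_sum_le_sum_abs _ _).trans ?_
    have hb : ∀ y ∈ range p, |∏ i ∈ T, sqInd p (y + i) - ∏ i ∈ T, (1 + chi p (y + i)) / 2| ≤
        ∑ i ∈ T, if p ∣ y + i then (1 : ℝ) else 0 := by
      intro y _
      refine (abs_prod_sub_prod_le T (fun i => ?_) (fun i => ?_)).trans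
        (sum_le_sum fun i _ => abs_sqInd_sub_le hp _)
      · rw [abs_of_nonneg (sqInd_nonneg _ _)]; exact sqInd_le_one _ _
      · have := abs_le.1 (abs_chi_le_one p (y + i))
        rw [abs_le]; constructor <;> linarith
    refine (sum_le_sum hb).trans ?_
    rw [sum_comm, card_eq_sum_ones, Nat.cast_sum]
    refine sum_le_sum fun i _ => ?_
    rw [← sum_filter, sum_const, nsmul_eq_mul, mul_one]
    refine Nat.cast_le.2 (card_le_one.2 fun a ha b hb => ?_)
    rw [mem_filter, mem_range] at ha hb
    have h : a + i ≡ b + i [MOD p] :=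
      ((Nat.modEq_zero_iff_dvd.2 ha.2).trans (Nat.modEq_zero_iff_dvd.2 hb.2).symm)
    exact (Nat.ModEq.add_right_cancel' i h).eq_of_lt_of_lt ha.1 hb.1
  have h2 := abs_sum_prod_half_le hp hp2 T hT
  have h3 : (1 : ℝ) ≤ √p := by
    rw [Real.one_le_sqrt]; exact_mod_cast hp0
  have h4 : (T.card : ℝ) ≤ T.card * √p := le_mul_of_one_le_right (Nat.cast_nonneg _) h3
  calc _ ≤ |∑ y ∈ range p, ∏ i ∈ T, sqInd p (y + i) -
      ∑ y ∈ range p, ∏ i ∈ T, (1 + chi p (y + i)) / 2| +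
      |∑ y ∈ range p, ∏ i ∈ T, (1 + chi p (y + i)) / 2 - p / 2 ^ T.card| := abs_sub_le _ _ _
    _ ≤ _ := by linarith

/-- The density of shifts at which every element of `T` becomes a square modulo every `p ∈ P`. -/
lemma abs_density_sub_one_le {P : Finset ℕ} (hP : ∀ p ∈ P, p.Prime) (hP2 : 2 ∉ P) (T : Finset ℕ)
    (hT : ∀ p ∈ P, ∀ i ∈ T, ∀ j ∈ T, i ≡ j [MOD p] → i = j) {ε : ℝ}
    (hε : ∀ p ∈ P, 2 ^ T.card * (21 * T.card) / √p ≤ ε) :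
    |(2 ^ P.card) ^ T.card * ((∑ y ∈ range (∏ p ∈ P, p), ∏ i ∈ T, ∏ p ∈ P, sqInd p (y + i)) /
      (∏ p ∈ P, p : ℕ)) - 1| ≤ Real.exp (P.card * ε) - 1 := by
  have h1 : ∑ y ∈ range (∏ p ∈ P, p), ∏ i ∈ T, ∏ p ∈ P, sqInd p (y + i) =
      ∏ p ∈ P, ∑ y ∈ range p, ∏ i ∈ T, sqInd p (y + i) := by
    rw [← sum_range_prod_primes hP (fun p y => ∏ i ∈ T, sqInd p (y + i)) fun p _ x =>
      prod_congr rfl fun i _ => sqInd_congr ((Nat.mod_modEq x p).add_right i)]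
    exact sum_congr rfl fun y _ => prod_comm
  set e : ℕ → ℝ := fun p => 2 ^ T.card * ((∑ y ∈ range p, ∏ i ∈ T, sqInd p (y + i)) / p) - 1
    with he
  have h2 : (2 ^ P.card) ^ T.card * ((∑ y ∈ range (∏ p ∈ P, p), ∏ i ∈ T, ∏ p ∈ P,
      sqInd p (y + i)) / (∏ p ∈ P, p : ℕ)) = ∏ p ∈ P, (1 + e p) := by
    rw [h1, Nat.cast_prod, ← prod_div_distrib, ← pow_mul, mul_comm P.card, pow_mul,
      ← prod_const, ← prod_mul_distrib]
    refine prod_congr rfl fun p _ => ?_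
    simp only [he]; ring
  have h3 : ∀ p ∈ P, ‖e p‖ ≤ ε := by
    intro p hp
    have hp0 : (0 : ℝ) < p := by exact_mod_cast (hP p hp).pos
    have hs : 0 < √(p : ℝ) := Real.sqrt_pos.2 hp0
    have hss : √(p : ℝ) * √(p : ℝ) = p := Real.mul_self_sqrt hp0.le
    have h2T : (0 : ℝ) < 2 ^ T.card := by positivity
    have := abs_sum_prod_sqInd_sub_le (hP p hp) (fun h => hP2 (h ▸ hp)) T (hT p hp)
    refine le_trans ?_ (hε p hp)
    have h4 : e p = (∑ y ∈ range p, ∏ i ∈ T, sqInd p (y + i) - p / 2 ^ T.card) *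
        (2 ^ T.card / p) := by
      simp only [he]; field_simp
    rw [Real.norm_eq_abs, h4, abs_mul, abs_of_pos (by positivity : (0 : ℝ) < 2 ^ T.card / p)]
    calc _ ≤ 21 * T.card * √(p : ℝ) * (2 ^ T.card / p) := by gcongr
      _ = 21 * T.card * √(p : ℝ) * (2 ^ T.card / (√(p : ℝ) * √(p : ℝ))) := by rw [hss]
      _ = _ := by field_simp
  rw [h2, ← Real.norm_eq_abs]
  refine (Finset.norm_prod_one_add_sub_one_le P e).trans ?_
  have := sum_le_card_nsmul _ _ _ h3
  rw [nsmul_eq_mul] at this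
  gcongr

lemma abs_indicator_sub_alternating_choose_le (X R : ℕ) :
    |(if X = 0 then (1 : ℝ) else 0) - ∑ r ∈ range (R + 1), (-1 : ℝ) ^ r * X.choose r| ≤
      X.choose (R + 1) := by
  rcases X with _ | n
  · have : ∑ r ∈ range (R + 1), (-1 : ℝ) ^ r * (Nat.choose 0 r : ℝ) = 1 := by
      rw [sum_range_succ']
      simp
    rw [this]; simp
  · have h := Int.alternating_sum_range_choose_eq_choose (n := n) (m := R)
    have h' : ∑ r ∈ range (R + 1), (-1 : ℝ) ^ r * ((n + 1).choose r : ℝ) =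
        (-1) ^ R * n.choose R := by exact_mod_cast h
    rw [h', if_neg (Nat.succ_ne_zero n), zero_sub, abs_neg, abs_mul, abs_pow, abs_neg, abs_one,
      one_pow, one_mul, Nat.abs_cast, Nat.choose_succ_succ]
    push_cast
    linarith [(Nat.cast_nonneg (n.choose (R + 1)) : (0 : ℝ) ≤ _)]

lemma sum_range_choose_mul_pow {n N : ℕ} (hN : n < N) (t : ℝ) :
    ∑ r ∈ range N, (n.choose r : ℝ) * t ^ r = (1 + t) ^ n := by
  rw [add_comm 1 t, add_pow]
  symm
  rw [sum_subset (range_mono (Nat.succ_le_of_lt hN)) fun r _ hr => by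
    rw [Nat.choose_eq_zero_of_lt (by rw [mem_range] at hr; omega)]; simp]
  refine sum_congr rfl fun r _ => ?_
  rw [one_pow]; ring

lemma one_add_pow_le_exp {t : ℝ} (ht : 0 ≤ t) (n : ℕ) : (1 + t) ^ n ≤ Real.exp (n * t) := by
  rw [Real.exp_nat_mul]
  have := Real.add_one_le_exp t
  gcongr
  linarith

lemma sum_Ico_choose_mul_pow_le {ρ : ℝ} (hρ : 0 ≤ ρ) {n N : ℕ} (hN : n < N) (R : ℕ) :
    ∑ r ∈ Ico (R + 1) N, (n.choose r : ℝ) * ρ ^ r ≤ Real.exp (Real.exp 1 * (n * ρ) - R) := by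
  have h1 : ∀ r ∈ Ico (R + 1) N, (n.choose r : ℝ) * ρ ^ r ≤
      Real.exp (-R) * ((n.choose r : ℝ) * (Real.exp 1 * ρ) ^ r) := by
    intro r hr
    have hr' : (R : ℝ) ≤ r := by
      have := (mem_Ico.1 hr).1
      exact_mod_cast (by omega : R ≤ r)
    have : (1 : ℝ) ≤ Real.exp (-R) * Real.exp 1 ^ r := by
      rw [← Real.exp_nat_mul, ← Real.exp_add]
      exact Real.one_le_exp (by linarith)
    calc (n.choose r : ℝ) * ρ ^ r ≤ (Real.exp (-R) * Real.exp 1 ^ r) * (n.choose r * ρ ^ r) :=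
          le_mul_of_one_le_left (by positivity) this
      _ = _ := by rw [mul_pow]; ring
  refine (sum_le_sum h1).trans ?_
  rw [← mul_sum]
  calc Real.exp (-R) * ∑ r ∈ Ico (R + 1) N, (n.choose r : ℝ) * (Real.exp 1 * ρ) ^ r
      ≤ Real.exp (-R) * ∑ r ∈ range N, (n.choose r : ℝ) * (Real.exp 1 * ρ) ^ r := by
        gcongr
        exact fun x hx => mem_range.2 (mem_Ico.1 hx).2
    _ = Real.exp (-R) * (1 + Real.exp 1 * ρ) ^ n := by rw [sum_range_choose_mul_pow hN]
    _ ≤ Real.exp (-R) * Real.exp (n * (Real.exp 1 * ρ)) := by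
        gcongr
        exact one_add_pow_le_exp (by positivity) n
    _ = _ := by rw [← Real.exp_add]; congr 1; ring

lemma abs_one_sub_pow_sub_le {ρ : ℝ} (hρ : 0 ≤ ρ) (n R : ℕ) :
    |(1 - ρ) ^ n - ∑ r ∈ range (R + 1), (-1 : ℝ) ^ r * (n.choose r * ρ ^ r)| ≤
      Real.exp (Real.exp 1 * (n * ρ) - R) := by
  have hN : n < n + R + 2 := by omega
  have h1 : (1 - ρ) ^ n - ∑ r ∈ range (R + 1), (-1 : ℝ) ^ r * (n.choose r * ρ ^ r) =
      ∑ r ∈ Ico (R + 1) (n + R + 2), (-1 : ℝ) ^ r * (n.choose r * ρ ^ r) := by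
    rw [sub_eq_add_neg 1 ρ, ← sum_range_choose_mul_pow hN, sub_eq_iff_eq_add',
      range_eq_Ico, range_eq_Ico, sum_Ico_consecutive _ (Nat.zero_le _) (by omega)]
    refine sum_congr rfl fun r _ => ?_
    rw [neg_pow]; ring
  rw [h1]
  refine (abs_sum_le_sum_abs _ _).trans ((le_of_eq ?_).trans (sum_Ico_choose_mul_pow_le hρ hN R))
  refine sum_congr rfl fun r _ => ?_
  rw [abs_mul, abs_pow, abs_neg, abs_one, one_pow, one_mul, abs_of_nonneg (by positivity)]

lemma choose_mul_pow_le {ρ : ℝ} (hρ : 0 ≤ ρ) (n R : ℕ) :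
    (n.choose (R + 1) : ℝ) * ρ ^ (R + 1) ≤ Real.exp (Real.exp 1 * (n * ρ) - R) := by
  refine le_trans ?_ (sum_Ico_choose_mul_pow_le hρ (show n < n + R + 2 by omega) R)
  exact single_le_sum (f := fun r => (n.choose r : ℝ) * ρ ^ r) (fun _ _ => by positivity)
    (mem_Ico.2 ⟨le_rfl, by omega⟩)

/-- The proportion of shifts `y` for which no `y + i` with `i ∈ W` is a square modulo all
`p ∈ P`. -/
noncomputable def avoidDensity (P W : Finset ℕ) : ℝ := by
  classical
  exact (((range (∏ p ∈ P, p)).filter fun y =>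
    ∀ i ∈ W, ¬ ∀ p ∈ P, IsSquare ((y + i : ℕ) : ZMod p)).card : ℝ) / (∏ p ∈ P, p : ℕ)

lemma abs_avoidDensity_sub_le {P : Finset ℕ} (hP : ∀ p ∈ P, p.Prime) (W : Finset ℕ) {R : ℕ}
    {η : ℝ} (hη : ∀ T ⊆ W, T.card ≤ R + 1 →
      |(2 ^ P.card) ^ T.card * ((∑ y ∈ range (∏ p ∈ P, p), ∏ i ∈ T, ∏ p ∈ P, sqInd p (y + i)) /
      (∏ p ∈ P, p : ℕ)) - 1| ≤ η) :
    |avoidDensity P W - (1 - ((2 : ℝ) ^ P.card)⁻¹) ^ W.card| ≤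
      η * Real.exp (W.card * ((2 : ℝ) ^ P.card)⁻¹) +
        (2 + η) * Real.exp (Real.exp 1 * (W.card * ((2 : ℝ) ^ P.card)⁻¹) - R) := by
  classical
  set m := ∏ p ∈ P, p with hm
  have hm0 : (0 : ℝ) < m := by exact_mod_cast prod_primes_pos hP
  set n := W.card with hn
  have hη0 : 0 ≤ η := (abs_nonneg _).trans (hη ∅ (empty_subset _) (by simp))
  set ρ : ℝ := ((2 : ℝ) ^ P.card)⁻¹ with hρ
  have hρ0 : 0 < ρ := by positivity
  set g : ℕ → Prop := fun x => ∀ p ∈ P, IsSquare (x : ZMod p) with hg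
  set V : ℕ → Finset ℕ := fun y => W.filter fun i => g (y + i) with hV
  set E : ℕ → ℝ := fun r => (∑ y ∈ range m, ((V y).card.choose r : ℝ)) / m with hE
  have hs : ∀ x, ∏ p ∈ P, sqInd p x = if g x then 1 else 0 := by
    intro x
    simp only [sqInd, hg]
    convert prod_boole
  have hprod : ∀ T ⊆ W, ∀ y, ∏ i ∈ T, ∏ p ∈ P, sqInd p (y + i) =
      if T ⊆ V y then 1 else 0 := by
    intro T hT y
    simp only [hs]
    rw [prod_boole]
    have : (∀ i ∈ T, g (y + i)) ↔ T ⊆ V y := by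
      simp only [hV, subset_iff, mem_filter]
      exact ⟨fun h i hi => ⟨hT hi, h i hi⟩, fun h i hi => (h hi).2⟩
    simp only [this]
  have hEr : ∀ r, E r = ∑ T ∈ W.powersetCard r,
      (∑ y ∈ range m, ∏ i ∈ T, ∏ p ∈ P, sqInd p (y + i)) / m := by
    intro r
    rw [← sum_div, sum_comm]
    simp only [hE]
    congr 1
    refine sum_congr rfl fun y _ => ?_
    rw [sum_congr rfl fun T hT => hprod T (mem_powersetCard.1 hT).1 y, ← sum_filter, sum_const,
      nsmul_eq_mul, mul_one, ← card_powersetCard]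
    congr 2
    ext T
    simp only [mem_filter, mem_powersetCard]
    exact ⟨fun h => ⟨⟨h.1.trans (filter_subset _ _), h.2⟩, h.1⟩, fun h => ⟨h.2, h.1.2⟩⟩
  have hEb : ∀ r ≤ R + 1, |E r - n.choose r * ρ ^ r| ≤ η * (n.choose r * ρ ^ r) := by
    intro r hr
    have h1 : (n.choose r : ℝ) * ρ ^ r = ∑ T ∈ W.powersetCard r, ρ ^ r := by
      rw [sum_const, card_powersetCard, nsmul_eq_mul]
    rw [hEr, h1, ← sum_sub_distrib, mul_sum]
    refine (abs_sum_le_sum_abs _ _).trans (sum_le_sum fun T hT => ?_)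
    rw [mem_powersetCard] at hT
    have h2 := hη T hT.1 (hT.2.trans_le hr)
    rw [hT.2] at h2
    have h3 : ∀ q : ℝ, q - ρ ^ r = ((2 ^ P.card) ^ r * q - 1) * ρ ^ r := by
      intro q
      have : ((2 : ℝ) ^ P.card) ^ r * ρ ^ r = 1 := by
        rw [← mul_pow, hρ, mul_inv_cancel₀ (by positivity), one_pow]
      linear_combination -q * this
    rw [h3, abs_mul, abs_of_nonneg (by positivity : 0 ≤ ρ ^ r)]
    gcongr
  have hQ : |avoidDensity P W - ∑ r ∈ range (R + 1), (-1 : ℝ) ^ r * E r| ≤ E (R + 1) := by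
    have h1 : avoidDensity P W = (∑ y ∈ range m, if (V y).card = 0 then (1 : ℝ) else 0) / m := by
      unfold avoidDensity
      rw [card_filter, Nat.cast_sum]
      congr 1
      refine sum_congr rfl fun y _ => ?_
      have : (∀ i ∈ W, ¬ ∀ p ∈ P, IsSquare ((y + i : ℕ) : ZMod p)) ↔ (V y).card = 0 := by
        rw [card_eq_zero, filter_eq_empty_iff]
      rw [Nat.cast_ite, Nat.cast_one, Nat.cast_zero]
      by_cases hc : (V y).card = 0
      · rw [if_pos (this.2 hc), if_pos hc]
      · rw [if_neg (fun h => hc (this.1 h)), if_neg hc]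
    have h2 : ∑ r ∈ range (R + 1), (-1 : ℝ) ^ r * E r =
        (∑ y ∈ range m, ∑ r ∈ range (R + 1), (-1 : ℝ) ^ r * (V y).card.choose r) / m := by
      rw [sum_comm, sum_div]
      refine sum_congr rfl fun r _ => ?_
      rw [← mul_sum, mul_div_assoc]
    rw [h1, h2, ← sub_div, ← sum_sub_distrib, abs_div, abs_of_pos hm0]
    simp only [hE]
    gcongr
    exact (abs_sum_le_sum_abs _ _).trans
      (sum_le_sum fun y _ => abs_indicator_sub_alternating_choose_le _ _)
  have hmid : |∑ r ∈ range (R + 1), (-1 : ℝ) ^ r * E r -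
      ∑ r ∈ range (R + 1), (-1 : ℝ) ^ r * (n.choose r * ρ ^ r)| ≤ η * Real.exp (n * ρ) := by
    rw [← sum_sub_distrib]
    calc _ ≤ ∑ r ∈ range (R + 1), η * (n.choose r * ρ ^ r) := by
          refine (abs_sum_le_sum_abs _ _).trans (sum_le_sum fun r hr => ?_)
          rw [← mul_sub, abs_mul, abs_pow, abs_neg, abs_one, one_pow, one_mul]
          exact hEb r (by have := mem_range.1 hr; omega)
      _ ≤ ∑ r ∈ range (n + R + 1), η * (n.choose r * ρ ^ r) :=
          sum_le_sum_of_subset_of_nonneg (range_mono (by omega)) fun _ _ _ => by positivity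
      _ = η * (1 + ρ) ^ n := by rw [← mul_sum, sum_range_choose_mul_pow (by omega)]
      _ ≤ _ := by
          gcongr
          exact one_add_pow_le_exp hρ0.le n
  have hlast := abs_one_sub_pow_sub_le hρ0.le n R
  have hR1 : E (R + 1) ≤ (1 + η) * Real.exp (Real.exp 1 * (n * ρ) - R) := by
    have h1 := (abs_le.1 (hEb (R + 1) le_rfl)).2
    have h2 := choose_mul_pow_le hρ0.le n R
    calc E (R + 1) ≤ (1 + η) * (n.choose (R + 1) * ρ ^ (R + 1)) := by linarith
      _ ≤ _ := by gcongr
  rw [abs_le] at *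
  constructor <;> linarith [hQ.1, hQ.2, hmid.1, hmid.2, hlast.1, hlast.2]

/-- The number of squares modulo `A`. -/
noncomputable def squareCount (A : ℕ) : ℕ := by
  classical
  exact ((range A).filter fun u : ℕ => IsSquare (u : ZMod A)).card

/-- The positions `i ∈ [1, h]` for which `u + i` is a square modulo `A`. -/
noncomputable def squareWindow (A u h : ℕ) : Finset ℕ := by
  classical
  exact (Ioc 0 h).filter fun i => IsSquare ((u + i : ℕ) : ZMod A)

lemma mem_squareWindow {A u h i : ℕ} :
    i ∈ squareWindow A u h ↔ (0 < i ∧ i ≤ h) ∧ IsSquare ((u + i : ℕ) : ZMod A) := by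
  classical
  rw [squareWindow, mem_filter, mem_Ioc]

lemma squareCount_le (A : ℕ) : squareCount A ≤ A := by
  classical
  exact (card_filter_le _ _).trans (card_range A).le

lemma one_le_squareCount {A : ℕ} (hA : 0 < A) : 1 ≤ squareCount A := by
  classical
  exact card_pos.2 ⟨0, mem_filter.2 ⟨mem_range.2 hA, ⟨0, by simp⟩⟩⟩

lemma abs_card_squareWindow_sub_le {A : ℕ} (hA : 0 < A) (u h : ℕ) :
    |((squareWindow A u h).card : ℝ) - squareCount A / A * h| ≤ A := by
  classical
  set sq : ℕ → Prop := fun x => IsSquare (x : ZMod A) with hsq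
  have hper : Function.Periodic sq A := fun x => by
    simp only [hsq, eq_iff_iff]
    exact isSquare_natCast_congr (by simp [Nat.ModEq])
  set f : ℕ → ℕ := fun h => ((Ico (u + 1) (u + 1 + h)).filter sq).card with hf
  have hblock : ∀ a, ((Ico a (a + A)).filter sq).card = squareCount A := fun a => by
    rw [Nat.filter_Ico_card_eq_of_periodic a A sq hper, Nat.count_eq_card_filter_range]
    rfl
  have hwin : (squareWindow A u h).card = f h := by
    refine card_bij (fun i _ => u + i) ?_ (fun _ _ _ _ h => Nat.add_left_cancel h) ?_
    · intro i hi
      rw [mem_squareWindow] at hi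
      exact mem_filter.2 ⟨mem_Ico.2 ⟨by omega, by omega⟩, hi.2⟩
    · intro x hx
      rw [mem_filter, mem_Ico] at hx
      refine ⟨x - u, mem_squareWindow.2 ⟨⟨by omega, by omega⟩, ?_⟩, by omega⟩
      rw [Nat.add_sub_cancel' (by omega)]
      exact hx.2
  have hstep : ∀ h, f (h + A) = f h + squareCount A := fun h => by
    simp only [hf]
    rw [← hblock (u + 1 + h), ← card_union_of_disjoint, ← filter_union,
      Ico_union_Ico_eq_Ico (by omega) (by omega), ← add_assoc]
    exact disjoint_filter_filter (Ico_disjoint_Ico_consecutive _ _ _)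
  have hmul : ∀ q s, f (s + A * q) = f s + q * squareCount A := fun q s => by
    induction q with
    | zero => simp
    | succ q ih => rw [Nat.mul_succ, ← add_assoc, hstep, ih]; ring
  have hs : f (h % A) ≤ squareCount A := by
    rw [← hblock (u + 1)]
    refine card_le_card (filter_subset_filter _ (Ico_subset_Ico_right ?_))
    have := Nat.mod_lt h hA
    omega
  have hfh : f h = f (h % A) + h / A * squareCount A := by
    rw [← hmul, Nat.mod_add_div]
  have hA' : (0 : ℝ) < A := by exact_mod_cast hA
  have hh : (h : ℝ) = (h % A : ℕ) + A * (h / A : ℕ) := by exact_mod_cast (Nat.mod_add_div h A).symm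
  have hsA : ((h % A : ℕ) : ℝ) ≤ A := by exact_mod_cast (Nat.mod_lt h hA).le
  have hc : (squareCount A : ℝ) ≤ A := by exact_mod_cast squareCount_le A
  have hs' : (f (h % A) : ℝ) ≤ squareCount A := by exact_mod_cast hs
  have key : ((squareWindow A u h).card : ℝ) - squareCount A / A * h =
      f (h % A) - squareCount A * ((h % A : ℕ) / A) := by
    rw [hwin, hfh, hh]
    push_cast
    field_simp
    ring
  have h1 : (squareCount A : ℝ) * ((h % A : ℕ) / A) ≤ squareCount A :=
    mul_le_of_le_one_right (Nat.cast_nonneg _) ((div_le_one hA').2 hsA)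
  have h2 : (0 : ℝ) ≤ squareCount A * ((h % A : ℕ) / A) := by positivity
  rw [key, abs_le]
  constructor <;> linarith [(Nat.cast_nonneg (f (h % A)) : (0 : ℝ) ≤ _)]

lemma card_gapSet_eq {P : Finset ℕ} (hP : ∀ p ∈ P, p.Prime) {A : ℕ} (hA : 0 < A)
    (hAP : A.Coprime (∏ p ∈ P, p)) (h : ℕ) :
    ((gapSet (A * ∏ p ∈ P, p) h).card : ℝ) =
      (∏ p ∈ P, p : ℕ) * ∑ u ∈ range A, avoidDensity P (squareWindow A u h) := by
  classical
  set m := ∏ p ∈ P, p with hm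
  have hm0 : 0 < m := prod_primes_pos hP
  have hm0' : (m : ℝ) ≠ 0 := by exact_mod_cast hm0.ne'
  set H : ℕ → ℕ → ℝ := fun u v => if ∀ i ∈ squareWindow A u h,
    ¬ ∀ p ∈ P, IsSquare ((v + i : ℕ) : ZMod p) then 1 else 0 with hH
  have h1 := sum_range_mul_mod hAP hA hm0 H
  have h2 : ∑ x ∈ range (A * m), H (x % A) (x % m) = (gapSet (A * m) h).card := by
    rw [gapSet, card_filter, Nat.cast_sum]
    refine sum_congr rfl fun x _ => ?_
    rw [Nat.cast_ite, Nat.cast_one, Nat.cast_zero]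
    have : (∀ i ∈ squareWindow A (x % A) h, ¬ ∀ p ∈ P, IsSquare ((x % m + i : ℕ) : ZMod p)) ↔
        ∀ i < h, ¬ IsSquare ((x + (i + 1) : ℕ) : ZMod (A * m)) := by
      have hA1 : ∀ i, IsSquare ((x % A + i : ℕ) : ZMod A) ↔ IsSquare ((x + i : ℕ) : ZMod A) :=
        fun i => isSquare_natCast_congr ((Nat.mod_modEq x A).add_right i)
      have hP1 : ∀ i, ∀ p ∈ P, (IsSquare ((x % m + i : ℕ) : ZMod p) ↔
          IsSquare ((x + i : ℕ) : ZMod p)) := fun i p hp =>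
        isSquare_natCast_congr (((Nat.mod_modEq x m).of_dvd (dvd_prod_of_mem _ hp)).add_right i)
      constructor
      · intro hall i hi hsq
        rw [isSquare_natCast_mul_iff hAP, isSquare_natCast_prod_iff hP] at hsq
        exact hall (i + 1) (mem_squareWindow.2 ⟨⟨by omega, by omega⟩, (hA1 _).2 hsq.1⟩)
          fun p hp => (hP1 _ p hp).2 (hsq.2 p hp)
      · intro hall i hi hsq
        rw [mem_squareWindow] at hi
        refine hall (i - 1) (by omega) ?_
        rw [Nat.sub_add_cancel (by omega), isSquare_natCast_mul_iff hAP,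
          isSquare_natCast_prod_iff hP]
        exact ⟨(hA1 _).1 hi.2, fun p hp => (hP1 _ p hp).1 (hsq p hp)⟩
    simp only [hH]
    by_cases hc : ∀ i < h, ¬ IsSquare ((x + (i + 1) : ℕ) : ZMod (A * m))
    · rw [if_pos (this.2 hc), if_pos hc]
    · rw [if_neg (fun h' => hc (this.1 h')), if_neg hc]
  rw [← h2, h1, mul_sum]
  refine sum_congr rfl fun u _ => ?_
  rw [avoidDensity, mul_div_cancel₀ _ hm0', card_filter, Nat.cast_sum]
  refine sum_congr rfl fun v _ => ?_
  rw [Nat.cast_ite, Nat.cast_one, Nat.cast_zero]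

lemma card_QR_eq {P : Finset ℕ} (hP : ∀ p ∈ P, p.Prime) (hP2 : 2 ∉ P) {A : ℕ} (hA : 0 < A)
    (hAP : A.Coprime (∏ p ∈ P, p)) :
    ((QR (A * ∏ p ∈ P, p)).card : ℝ) = squareCount A * ∏ p ∈ P, ((p + 1 : ℝ) / 2) := by
  classical
  set m := ∏ p ∈ P, p with hm
  have hm0 : 0 < m := prod_primes_pos hP
  have : NeZero (A * m) := ⟨(Nat.mul_pos hA hm0).ne'⟩
  have h0 : (QR (A * m)).card = ((range (A * m)).filter
      fun x : ℕ => IsSquare (x : ZMod (A * m))).card := by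
    symm
    refine card_bij (fun x _ => (x : ZMod (A * m))) ?_ ?_ ?_
    · intro x hx
      exact (mem_QR_iff _).2 (mem_filter.1 hx).2
    · intro x hx y hy hxy
      have hx' := mem_range.1 (mem_filter.1 hx).1
      have hy' := mem_range.1 (mem_filter.1 hy).1
      have := (ZMod.natCast_eq_natCast_iff' _ _ _).1 hxy
      rwa [Nat.mod_eq_of_lt hx', Nat.mod_eq_of_lt hy'] at this
    · intro x hx
      rw [mem_QR_iff] at hx
      refine ⟨x.val, mem_filter.2 ⟨mem_range.2 (ZMod.val_lt x), ?_⟩, ZMod.natCast_zmod_val x⟩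
      rwa [ZMod.natCast_zmod_val]
  have hloc : ∀ p ∈ P, ∑ x ∈ range p, sqInd p x = (p + 1 : ℝ) / 2 := by
    intro p hp
    have := Fact.mk (hP p hp)
    have hp2 : ringChar (ZMod p) ≠ 2 := by
      rw [ZMod.ringChar_zmod_n]; exact fun h => hP2 (h ▸ hp)
    have hz : ∑ x ∈ range p, chi p x = 0 := by
      have h1 := sum_range_zmod p fun z => ((quadraticChar (ZMod p) z : ℤ) : ℝ)
      have h2 := quadraticChar_sum_zero hp2
      simp only [chi_prime]
      rw [h1]
      exact_mod_cast h2
    have hx : ∀ x ∈ range p, sqInd p x = (1 + chi p x) / 2 + if x = 0 then 1 / 2 else 0 := by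
      intro x hx
      rw [mem_range] at hx
      by_cases hx0 : x = 0
      · subst hx0
        have hsq : IsSquare ((0 : ℕ) : ZMod p) := ⟨0, by simp⟩
        rw [sqInd, if_pos hsq, chi_prime, if_pos rfl]
        simp; norm_num
      · have h1 := abs_sqInd_sub_le (hP p hp) x
        rw [if_neg (fun h => hx0 (Nat.eq_zero_of_dvd_of_lt h hx))] at h1
        rw [if_neg hx0, add_zero]
        exact sub_eq_zero.1 (abs_eq_zero.1 (le_antisymm h1 (abs_nonneg _)))
    rw [sum_congr rfl hx, sum_add_distrib, ← sum_div, sum_add_distrib, hz, sum_const, card_range,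
      sum_ite_eq' (range p) 0, if_pos (mem_range.2 (hP p hp).pos)]
    simp; ring
  set sA : ℕ → ℝ := sqInd A with hsA
  set H : ℕ → ℕ → ℝ := fun u v => sqInd A u * ∏ p ∈ P, sqInd p v with hH
  have h1 := sum_range_mul_mod hAP hA hm0 H
  have h2 : ∑ x ∈ range (A * m), H (x % A) (x % m) = (QR (A * m)).card := by
    rw [h0, card_filter, Nat.cast_sum]
    refine sum_congr rfl fun x _ => ?_
    rw [Nat.cast_ite, Nat.cast_one, Nat.cast_zero]
    simp only [hH]
    have e1 : sqInd A (x % A) = sqInd A x := sqInd_congr (Nat.mod_modEq x A)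
    have e2 : ∏ p ∈ P, sqInd p (x % m) = ∏ p ∈ P, sqInd p x := prod_congr rfl fun p hp =>
      sqInd_congr ((Nat.mod_modEq x m).of_dvd (dvd_prod_of_mem _ hp))
    have e3 : ∏ p ∈ P, sqInd p x = if ∀ p ∈ P, IsSquare (x : ZMod p) then 1 else 0 := by
      simp only [sqInd]
      convert prod_boole
    rw [e1, e2, e3, sqInd, ite_zero_mul_ite_zero, mul_one]
    have := (isSquare_natCast_mul_iff hAP x)
    rw [isSquare_natCast_prod_iff hP] at this
    by_cases hc : IsSquare (x : ZMod (A * m))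
    · rw [if_pos (this.1 hc), if_pos hc]
    · rw [if_neg (fun h' => hc (this.2 h')), if_neg hc]
  rw [← h2, h1]
  simp only [hH]
  rw [← sum_mul_sum, ← prod_congr rfl hloc, sum_range_prod_primes hP sqInd fun p _ x =>
    sqInd_congr (Nat.mod_modEq x p)]
  congr 1
  rw [squareCount, card_filter, Nat.cast_sum]
  refine sum_congr rfl fun x _ => ?_
  rw [Nat.cast_ite, Nat.cast_one, Nat.cast_zero, sqInd]

lemma exp_mul_log_natCast {ℓ : ℕ} (hℓ : 0 < ℓ) (n : ℕ) :
    Real.exp (n * Real.log ℓ) = (ℓ : ℝ) ^ n := by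
  rw [Real.exp_nat_mul, Real.exp_log (by exact_mod_cast hℓ)]

lemma exp_two_le : Real.exp 2 ≤ 9 := by
  have h := Real.exp_one_lt_d9
  have : Real.exp 2 = Real.exp 1 ^ 2 := by rw [← Real.exp_nat_mul]; norm_num
  rw [this]
  nlinarith [Real.exp_pos 1]

lemma exp_six_le : Real.exp 6 ≤ 729 := by
  have h := exp_two_le
  have : Real.exp 6 = Real.exp 2 ^ 3 := by rw [← Real.exp_nat_mul]; norm_num
  rw [this]
  calc Real.exp 2 ^ 3 ≤ 9 ^ 3 := by gcongr
    _ = 729 := by norm_num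

set_option exponentiation.threshold 600 in
lemma abs_avoidDensity_sub_le_inv {P : Finset ℕ} (hP : ∀ p ∈ P, p.Prime) (hP2 : 2 ∉ P)
    {ℓ : ℕ} (hℓ : 10000 ≤ ℓ) (hPℓ : ∀ p ∈ P, ℓ ^ 500 < p) (h2 : 2 ^ P.card ≤ ℓ)
    {W : Finset ℕ} (hW : ∀ p ∈ P, ∀ i ∈ W, i < p)
    (hμ : (W.card : ℝ) * ((2 : ℝ) ^ P.card)⁻¹ ≤ 10 * Real.log ℓ + 2) :
    |avoidDensity P W - (1 - ((2 : ℝ) ^ P.card)⁻¹) ^ W.card| ≤ 1 / (ℓ : ℝ) ^ 18 := by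
  have hℓ0 : 0 < ℓ := by omega
  have hy : (10000 : ℝ) ≤ ℓ := by exact_mod_cast hℓ
  have hy0 : (0 : ℝ) < ℓ := by linarith
  set y : ℝ := (ℓ : ℝ) with hyd
  set lam := Real.log y with hlam
  have hlam0 : 0 ≤ lam := Real.log_nonneg (by linarith)
  have hlamy : lam ≤ y := (Real.log_le_sub_one_of_pos hy0).trans (by linarith)
  set R := ⌈50 * lam⌉₊ with hR
  have hR1 : 50 * lam ≤ R := Nat.le_ceil _
  have hR2 : (R : ℝ) < 50 * lam + 1 := Nat.ceil_lt_add_one (by positivity)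
  have hw : (P.card : ℝ) ≤ y := by
    have : P.card < 2 ^ P.card := Nat.lt_two_pow_self
    rw [hyd]
    exact_mod_cast (this.le.trans h2)
  have h2R : (2 : ℝ) ^ (R + 1) ≤ 9 * y ^ 50 := by
    calc (2 : ℝ) ^ (R + 1) ≤ Real.exp 1 ^ (R + 1) := by
          gcongr
          linarith [Real.add_one_le_exp 1]
      _ = Real.exp ((R + 1 : ℕ) : ℝ) := by rw [← Real.exp_nat_mul, mul_one]
      _ ≤ Real.exp (2 + (50 : ℕ) * lam) := by
          gcongr
          push_cast
          linarith
      _ = Real.exp 2 * y ^ 50 := by rw [Real.exp_add, hlam, exp_mul_log_natCast hℓ0]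
      _ ≤ 9 * y ^ 50 := by gcongr; exact exp_two_le
  have hpow : ∀ n : ℕ, (0 : ℝ) < y ^ n := fun n => by positivity
  set ε : ℝ := y ^ 52 / y ^ 250 with hε
  have hεp : ∀ T ⊆ W, T.card ≤ R + 1 → ∀ p ∈ P, 2 ^ T.card * (21 * T.card) / √(p : ℝ) ≤ ε := by
    intro T _ hTR p hp
    have hs : y ^ 250 ≤ √(p : ℝ) := by
      refine Real.le_sqrt_of_sq_le ?_
      rw [← pow_mul, hyd]
      exact_mod_cast (hPℓ p hp).le
    have hT1 : (T.card : ℝ) ≤ R + 1 := by exact_mod_cast hTR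
    have hT2 : (T.card : ℝ) ≤ 52 * y := by linarith
    have hT3 : (2 : ℝ) ^ T.card ≤ 9 * y ^ 50 := le_trans (by gcongr; norm_num) h2R
    calc 2 ^ T.card * (21 * T.card) / √(p : ℝ) ≤ 9 * y ^ 50 * (21 * (52 * y)) / y ^ 250 := by
          gcongr
      _ = 9828 * y ^ 51 / y ^ 250 := by ring
      _ ≤ y * y ^ 51 / y ^ 250 := by gcongr; linarith
      _ = ε := by rw [hε]; ring
  set η : ℝ := 2 * (y ^ 53 / y ^ 250) with hη
  have hsmall : y ^ 53 / y ^ 250 = 1 / y ^ 197 := by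
    rw [div_eq_div_iff (hpow _).ne' (hpow _).ne', one_mul, ← pow_add]
  have hsmall1 : y ^ 53 / y ^ 250 ≤ 1 / 2 := by
    rw [hsmall]
    gcongr
    calc (2 : ℝ) ≤ y := by linarith
      _ = y ^ 1 := (pow_one _).symm
      _ ≤ y ^ 197 := pow_le_pow_right₀ (by linarith) (by norm_num)
  have hηb : Real.exp (P.card * ε) - 1 ≤ η := by
    have h1 : (P.card : ℝ) * ε ≤ y ^ 53 / y ^ 250 := by
      calc (P.card : ℝ) * ε ≤ y * ε := by gcongr
        _ = _ := by rw [hε]; ring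
    have h0 : 0 ≤ (P.card : ℝ) * ε := by positivity
    have h3 := Real.abs_exp_sub_one_le (x := P.card * ε) (by rw [abs_of_nonneg h0]; linarith)
    rw [abs_of_nonneg h0] at h3
    have := le_abs_self (Real.exp (P.card * ε) - 1)
    linarith
  have hTW : ∀ T ⊆ W, ∀ p ∈ P, ∀ i ∈ T, ∀ j ∈ T, i ≡ j [MOD p] → i = j :=
    fun T hT p hp i hi j hj h => h.eq_of_lt_of_lt (hW p hp i (hT hi)) (hW p hp j (hT hj))
  have main := abs_avoidDensity_sub_le hP W (R := R) (η := η) fun T hT hTR =>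
    (abs_density_sub_one_le hP hP2 T (hTW T hT) (hεp T hT hTR)).trans hηb
  refine main.trans ?_
  set μ : ℝ := (W.card : ℝ) * ((2 : ℝ) ^ P.card)⁻¹ with hμd
  have hμ0 : 0 ≤ μ := by positivity
  have he : Real.exp μ ≤ 9 * y ^ 10 := by
    calc Real.exp μ ≤ Real.exp (2 + (10 : ℕ) * lam) := by
          gcongr; push_cast; linarith
      _ = Real.exp 2 * y ^ 10 := by rw [Real.exp_add, hlam, exp_mul_log_natCast hℓ0]
      _ ≤ 9 * y ^ 10 := by gcongr; exact exp_two_le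
  have he2 : Real.exp (Real.exp 1 * μ - R) ≤ 729 / y ^ 20 := by
    have h3 : Real.exp 1 * μ ≤ 3 * (10 * lam + 2) := by
      have := Real.exp_one_lt_d9
      gcongr
      linarith
    calc Real.exp (Real.exp 1 * μ - R) ≤ Real.exp (6 - (20 : ℕ) * lam) := by
          refine Real.exp_le_exp.2 ?_
          push_cast
          linarith
      _ = Real.exp 6 / y ^ 20 := by rw [Real.exp_sub, hlam, exp_mul_log_natCast hℓ0]
      _ ≤ 729 / y ^ 20 := by gcongr; exact exp_six_le
  have hη1 : η ≤ 1 := by rw [hη]; linarith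
  calc η * Real.exp μ + (2 + η) * Real.exp (Real.exp 1 * μ - R)
      ≤ η * (9 * y ^ 10) + (2 + 1) * (729 / y ^ 20) := by gcongr
    _ = 18 / y ^ 187 + 2187 / y ^ 20 := by
        rw [hη, hsmall]
        have : y ^ 197 = y ^ 187 * y ^ 10 := by rw [← pow_add]
        rw [this]
        field_simp
        ring
    _ ≤ 18 / y ^ 20 + 2187 / y ^ 20 := by
        gcongr
        · linarith
        · norm_num
    _ = 2205 / y ^ 20 := by ring
    _ ≤ y ^ 2 / y ^ 20 := by gcongr; nlinarith
    _ = 1 / y ^ 18 := by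
        rw [div_eq_div_iff (hpow _).ne' (hpow _).ne', one_mul, ← pow_add]

lemma exp_neg_add_sq_le {x : ℝ} (hx0 : 0 ≤ x) (hx : x ≤ 1 / 2) :
    Real.exp (-(x + x ^ 2)) ≤ 1 - x := by
  have h := Real.quadratic_le_exp_of_nonneg (x := x + x ^ 2) (by positivity)
  rw [Real.exp_neg, inv_le_comm₀ (Real.exp_pos _) (by linarith)]
  refine le_trans ?_ h
  rw [inv_le_iff_one_le_mul₀ (by linarith)]
  nlinarith [mul_nonneg (pow_nonneg hx0 2) (by linarith : 0 ≤ 1 / 2 - x), pow_nonneg hx0 3,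
    mul_nonneg (pow_nonneg hx0 3) (by linarith : 0 ≤ 1 / 2 - x), pow_nonneg hx0 4,
    mul_nonneg (pow_nonneg hx0 4) (by linarith : 0 ≤ 1 / 2 - x)]

set_option exponentiation.threshold 600 in
lemma gapSet_density_bounds {P : Finset ℕ} (hP : ∀ p ∈ P, p.Prime) (hP2 : 2 ∉ P)
    (hP0 : P.Nonempty) {A : ℕ} (hA : 0 < A) (hAP : A.Coprime (∏ p ∈ P, p))
    {ℓ : ℕ} (hℓ : 10000 ≤ ℓ) (hPℓ : ∀ p ∈ P, ℓ ^ 500 < p) (h2 : 2 ^ P.card ≤ ℓ)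
    {ρ τ : ℝ} (hρ : ρ = ((2 : ℝ) ^ P.card)⁻¹) (hτ : τ = ρ * (squareCount A / A))
    {h : ℕ} (hh : h ≤ ℓ ^ 500) (hμ : τ * h + ρ * A ≤ 10 * Real.log ℓ + 2) :
    Real.exp (-(ρ * (A + 10 * Real.log ℓ + 2))) * Real.exp (-(τ * h)) - 1 / (ℓ : ℝ) ^ 18
        ≤ ((gapSet (A * ∏ p ∈ P, p) h).card : ℝ) / (A * ∏ p ∈ P, p : ℕ) ∧
      ((gapSet (A * ∏ p ∈ P, p) h).card : ℝ) / (A * ∏ p ∈ P, p : ℕ)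
        ≤ Real.exp (ρ * A) * Real.exp (-(τ * h)) + 1 / (ℓ : ℝ) ^ 18 := by
  have hρ0 : 0 < ρ := by rw [hρ]; positivity
  have hρ2 : ρ ≤ 1 / 2 := by
    rw [hρ, one_div]
    refine inv_anti₀ (by norm_num) ?_
    calc (2 : ℝ) = 2 ^ 1 := (pow_one _).symm
      _ ≤ 2 ^ P.card := pow_le_pow_right₀ (by norm_num) hP0.card_pos
  have hA0 : (0 : ℝ) < A := by exact_mod_cast hA
  have hprod : (0 : ℝ) < (∏ p ∈ P, p : ℕ) := by exact_mod_cast prod_primes_pos hP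
  have hd : ((gapSet (A * ∏ p ∈ P, p) h).card : ℝ) / (A * ∏ p ∈ P, p : ℕ)
      = (∑ u ∈ range A, avoidDensity P (squareWindow A u h)) / A := by
    rw [card_gapSet_eq hP hA hAP h, Nat.cast_mul]
    field_simp
  have key : ∀ u,
      Real.exp (-(ρ * (A + 10 * Real.log ℓ + 2))) * Real.exp (-(τ * h)) - 1 / (ℓ : ℝ) ^ 18
        ≤ avoidDensity P (squareWindow A u h) ∧
      avoidDensity P (squareWindow A u h)
        ≤ Real.exp (ρ * A) * Real.exp (-(τ * h)) + 1 / (ℓ : ℝ) ^ 18 := fun u => by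
    set n := (squareWindow A u h).card with hn
    have hw := abs_le.1 (abs_card_squareWindow_sub_le hA u h)
    have h1 : τ * h - ρ * A ≤ n * ρ := by rw [hτ]; nlinarith
    have h3 : n * ρ ≤ τ * h + ρ * A := by rw [hτ]; nlinarith
    have hm := abs_le.1 (abs_avoidDensity_sub_le_inv hP hP2 hℓ hPℓ h2 (W := squareWindow A u h)
      (fun p hp i hi => ((mem_squareWindow.1 hi).1.2.trans hh).trans_lt (hPℓ p hp))
      (by rw [← hρ]; exact h3.trans hμ))
    rw [← hρ, ← hn] at hm
    have hup : (1 - ρ) ^ n ≤ Real.exp (ρ * A) * Real.exp (-(τ * h)) := by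
      calc (1 - ρ) ^ n ≤ Real.exp (-ρ) ^ n := by
            gcongr
            · linarith
            · linarith [Real.add_one_le_exp (-ρ)]
        _ = Real.exp (n * -ρ) := (Real.exp_nat_mul _ _).symm
        _ ≤ Real.exp (ρ * A + -(τ * h)) := Real.exp_le_exp.2 (by linarith)
        _ = _ := Real.exp_add _ _
    have hlo : Real.exp (-(ρ * (A + 10 * Real.log ℓ + 2))) * Real.exp (-(τ * h))
        ≤ (1 - ρ) ^ n := by
      rw [← Real.exp_add]
      calc _ ≤ Real.exp (n * (-(ρ + ρ ^ 2))) := by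
            refine Real.exp_le_exp.2 ?_
            have : n * ρ * ρ ≤ (10 * Real.log ℓ + 2) * ρ := by gcongr; exact h3.trans hμ
            nlinarith
        _ = Real.exp (-(ρ + ρ ^ 2)) ^ n := Real.exp_nat_mul _ _
        _ ≤ _ := by
            gcongr
            exact exp_neg_add_sq_le hρ0.le hρ2
    constructor <;> linarith
  rw [hd, le_div_iff₀ hA0, div_le_iff₀ hA0]
  constructor
  · calc _ = ∑ u ∈ range A, (Real.exp (-(ρ * (A + 10 * Real.log ℓ + 2))) *
          Real.exp (-(τ * h)) - 1 / (ℓ : ℝ) ^ 18) := by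
          rw [sum_const, card_range, nsmul_eq_mul]; ring
      _ ≤ _ := sum_le_sum fun u _ => (key u).1
  · calc _ ≤ ∑ u ∈ range A, (Real.exp (ρ * A) * Real.exp (-(τ * h)) + 1 / (ℓ : ℝ) ^ 18) :=
          sum_le_sum fun u _ => (key u).2
      _ = _ := by rw [sum_const, card_range, nsmul_eq_mul]; ring

lemma sum_exp_neg_mul_le {τ : ℝ} (hτ : 0 < τ) (n : ℕ) :
    ∑ h ∈ range n, Real.exp (-(τ * h)) ≤ 1 / τ + 1 := by
  have hlt : Real.exp (-τ) < 1 :=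
    (Real.exp_lt_exp.2 (by linarith)).trans_eq Real.exp_zero
  have hE : Real.exp (-τ) ≤ 1 / (1 + τ) := by
    rw [Real.exp_neg, one_div]
    exact inv_anti₀ (by linarith) (by linarith [Real.add_one_le_exp τ])
  calc ∑ h ∈ range n, Real.exp (-(τ * h)) = ∑ h ∈ range n, Real.exp (-τ) ^ h :=
        sum_congr rfl fun h _ => by rw [← Real.exp_nat_mul]; congr 1; ring
    _ = (1 - Real.exp (-τ) ^ n) / (1 - Real.exp (-τ)) := by
        rw [geom_sum_eq hlt.ne, ← neg_div_neg_eq]; simp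
    _ ≤ 1 / (1 - 1 / (1 + τ)) := by
        gcongr
        · rw [sub_pos, div_lt_one (by linarith)]; linarith
        · linarith [pow_nonneg (Real.exp_pos (-τ)).le n]
    _ = 1 / τ + 1 := by field_simp; ring_nf; field_simp

lemma le_sum_exp_neg_mul {τ : ℝ} (hτ : 0 < τ) (n : ℕ) :
    (1 - Real.exp (-(τ * n))) * (1 / τ) ≤ ∑ h ∈ range n, Real.exp (-(τ * h)) := by
  have hlt : Real.exp (-τ) < 1 :=
    (Real.exp_lt_exp.2 (by linarith)).trans_eq Real.exp_zero
  have hle : Real.exp (-(τ * n)) ≤ 1 := Real.exp_le_one_iff.2 (by simp; positivity)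
  calc (1 - Real.exp (-(τ * n))) * (1 / τ)
      ≤ (1 - Real.exp (-(τ * n))) * (1 / (1 - Real.exp (-τ))) := by
        have h1 : 0 < 1 - Real.exp (-τ) := by linarith
        have h2 : 1 - Real.exp (-τ) ≤ τ := by linarith [Real.add_one_le_exp (-τ)]
        gcongr
    _ = (1 - Real.exp (-τ) ^ n) / (1 - Real.exp (-τ)) := by
        rw [← Real.exp_nat_mul, mul_one_div]; congr 3; ring
    _ = ∑ h ∈ range n, Real.exp (-τ) ^ h := by
        rw [geom_sum_eq hlt.ne, ← neg_div_neg_eq]; simp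
    _ = _ := sum_congr rfl fun h _ => by rw [← Real.exp_nat_mul]; congr 1; ring

set_option exponentiation.threshold 600 in
lemma sum_card_gapSet_bounds {P : Finset ℕ} (hP : ∀ p ∈ P, p.Prime) (hP2 : 2 ∉ P)
    (hP0 : P.Nonempty) {A : ℕ} (hA : 0 < A) (hAP : A.Coprime (∏ p ∈ P, p))
    {ℓ : ℕ} (hℓ : 10000 ≤ ℓ) (hPℓ : ∀ p ∈ P, ℓ ^ 500 < p) (h640 : 640 ^ P.card ≤ ℓ ^ 8)
    (h2 : 2 ^ P.card ≤ ℓ) (hAℓ : A ≤ ℓ) (hA2 : A ≤ 2 ^ P.card)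
    {ρ τ : ℝ} (hρ : ρ = ((2 : ℝ) ^ P.card)⁻¹) (hτ : τ = ρ * (squareCount A / A)) :
    Real.exp (-(ρ * (A + 10 * Real.log ℓ + 2))) * ((1 - 1 / (ℓ : ℝ) ^ 10) * (1 / τ)) - 1
        ≤ (∑ h ∈ range (A * ∏ p ∈ P, p), ((gapSet (A * ∏ p ∈ P, p) h).card : ℝ))
          / (A * ∏ p ∈ P, p : ℕ) ∧
      (∑ h ∈ range (A * ∏ p ∈ P, p), ((gapSet (A * ∏ p ∈ P, p) h).card : ℝ))
          / (A * ∏ p ∈ P, p : ℕ)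
        ≤ Real.exp (ρ * A) * (1 / τ + 1) + 1 := by
  have hℓ0 : 0 < ℓ := by omega
  have hy : (10000 : ℝ) ≤ ℓ := by exact_mod_cast hℓ
  have hy0 : (0 : ℝ) < ℓ := by linarith
  have hy1 : (1 : ℝ) ≤ ℓ := by linarith
  have hA0 : (0 : ℝ) < A := by exact_mod_cast hA
  have hAy : (A : ℝ) ≤ ℓ := by exact_mod_cast hAℓ
  have hρ0 : 0 < ρ := by rw [hρ]; positivity
  have hρ1 : ρ ≤ 1 := by rw [hρ]; exact inv_le_one_of_one_le₀ (one_le_pow₀ (by norm_num))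
  have hρA : ρ * A ≤ 1 := by
    rw [hρ, inv_mul_le_one₀ (by positivity)]
    exact_mod_cast hA2
  have hs0 : (1 : ℝ) ≤ squareCount A := by exact_mod_cast one_le_squareCount hA
  have hsA : (squareCount A : ℝ) ≤ A := by exact_mod_cast squareCount_le A
  have hτ0 : 0 < τ := by rw [hτ]; positivity
  have hτ1 : τ ≤ 1 := by
    rw [hτ]
    have : (squareCount A : ℝ) / A ≤ 1 := (div_le_one hA0).2 hsA
    have h0 : (0 : ℝ) ≤ squareCount A / A := by positivity
    nlinarith
  have hB : 1 / τ ≤ (ℓ : ℝ) ^ 2 := by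
    rw [div_le_iff₀ hτ0, hτ, hρ]
    have h2' : (2 : ℝ) ^ P.card ≤ ℓ := by exact_mod_cast h2
    rw [← div_eq_inv_mul, div_div, mul_div_assoc', le_div_iff₀ (by positivity), one_mul, sq]
    calc (A : ℝ) * 2 ^ P.card ≤ ℓ * ℓ := by gcongr
      _ = ℓ * ℓ * 1 := (mul_one _).symm
      _ ≤ ℓ * ℓ * squareCount A := by gcongr
  set lam := Real.log ℓ with hlam
  have hlam0 : 0 ≤ lam := Real.log_nonneg (by linarith)
  have hlamy : lam ≤ ℓ := (Real.log_le_sub_one_of_pos hy0).trans (by linarith)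
  set H := ⌈10 * lam / τ⌉₊ with hH
  have hH1 : 10 * lam / τ ≤ H := Nat.le_ceil _
  have hH2 : (H : ℝ) < 10 * lam / τ + 1 := Nat.ceil_lt_add_one (by positivity)
  have hτH1 : 10 * lam ≤ τ * H := by
    rw [div_le_iff₀ hτ0] at hH1; linarith
  have hτH2 : τ * H ≤ 10 * lam + 1 := by
    have := mul_lt_mul_of_pos_left hH2 hτ0
    rw [mul_add, mul_div_cancel₀ _ hτ0.ne'] at this
    linarith
  have hH3 : H ≤ ℓ ^ 4 := by
    have : (H : ℝ) ≤ (ℓ : ℝ) ^ 4 := by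
      calc (H : ℝ) ≤ 10 * lam / τ + 1 := hH2.le
        _ = 10 * lam * (1 / τ) + 1 := by ring
        _ ≤ 10 * (ℓ : ℝ) * (ℓ : ℝ) ^ 2 + (ℓ : ℝ) ^ 3 := by
            gcongr
            exact one_le_pow₀ hy1
        _ = 11 * (ℓ : ℝ) ^ 3 := by ring
        _ ≤ (ℓ : ℝ) * (ℓ : ℝ) ^ 3 := by gcongr; linarith
        _ = _ := by ring
    exact_mod_cast this
  set M := A * ∏ p ∈ P, p with hM
  have hprod := prod_primes_pos hP
  have hM0 : (0 : ℝ) < (M : ℕ) := by exact_mod_cast Nat.mul_pos hA hprod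
  set g : ℕ → ℝ := fun h => ((gapSet M h).card : ℝ) / (M : ℕ) with hg
  have hsum : (∑ h ∈ range M, ((gapSet M h).card : ℝ)) / (M : ℕ) = ∑ h ∈ range M, g h := by
    rw [sum_div]
  have hg0 : ∀ h, 0 ≤ g h := fun h => by positivity
  have hanti : ∀ h h', h ≤ h' → g h' ≤ g h := fun h h' hh => by
    simp only [hg]
    gcongr
    exact gapSet_anti M hh
  have hbounds : ∀ h ≤ H, _ := fun h hh => gapSet_density_bounds hP hP2 hP0 hA hAP hℓ hPℓ h2 hρ hτ
    (h := h) (hh.trans (hH3.trans (Nat.pow_le_pow_right hℓ0 (by norm_num)))) (by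
      have : τ * h ≤ τ * H := by gcongr
      linarith)
  set T := A * ℓ ^ 8 with hT
  have hHT : H ≤ T := hH3.trans ((Nat.pow_le_pow_right hℓ0 (by norm_num)).trans
    (Nat.le_mul_of_pos_left _ hA))
  have hTM : T ≤ M := by
    obtain ⟨p, hp⟩ := hP0
    refine Nat.mul_le_mul_left _ ((Nat.pow_le_pow_right hℓ0 (by norm_num : 8 ≤ 500)).trans ?_)
    exact (hPℓ p hp).le.trans (Nat.le_of_dvd hprod (dvd_prod_of_mem _ hp))
  have hsplit : ∑ h ∈ range M, g h
      = ∑ h ∈ range H, g h + ∑ h ∈ Ico H T, g h + ∑ h ∈ Ico T M, g h := by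
    rw [sum_range_add_sum_Ico _ hHT, sum_range_add_sum_Ico _ hTM]
  have hexpH : Real.exp (-(τ * H)) ≤ 1 / (ℓ : ℝ) ^ 10 := by
    rw [← exp_mul_log_natCast hℓ0, one_div, ← Real.exp_neg, Real.exp_le_exp, ← hlam]
    push_cast
    linarith
  have hHε : (H : ℝ) * (1 / (ℓ : ℝ) ^ 18) ≤ 1 / ℓ := by
    rw [mul_one_div, div_le_div_iff₀ (by positivity) hy0, one_mul]
    calc (H : ℝ) * ℓ ≤ (ℓ : ℝ) ^ 4 * ℓ := by gcongr; exact_mod_cast hH3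
      _ = (ℓ : ℝ) ^ 5 := by ring
      _ ≤ (ℓ : ℝ) ^ 18 := pow_le_pow_right₀ hy1 (by norm_num)
  have hinv : 1 / (ℓ : ℝ) ≤ 1 / 10000 := by gcongr
  have hC : Real.exp (ρ * A) ≤ 3 :=
    (Real.exp_le_exp.2 hρA).trans (Real.exp_one_lt_d9.le.trans (by norm_num))
  rw [hsum]
  constructor
  · have h1 : ∑ h ∈ range H, g h ≤ ∑ h ∈ range M, g h := by
      rw [hsplit]
      have h3 : 0 ≤ ∑ h ∈ Ico H T, g h := sum_nonneg fun h _ => hg0 h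
      have h4 : 0 ≤ ∑ h ∈ Ico T M, g h := sum_nonneg fun h _ => hg0 h
      linarith
    have h5 : Real.exp (-(ρ * (A + 10 * lam + 2))) * ∑ h ∈ range H, Real.exp (-(τ * h))
        - H * (1 / (ℓ : ℝ) ^ 18) ≤ ∑ h ∈ range H, g h := by
      calc _ = ∑ h ∈ range H, (Real.exp (-(ρ * (A + 10 * lam + 2))) * Real.exp (-(τ * h))
            - 1 / (ℓ : ℝ) ^ 18) := by
            rw [sum_sub_distrib, sum_const, card_range, nsmul_eq_mul, mul_sum]
        _ ≤ _ := sum_le_sum fun h hh => (hbounds h (mem_range.1 hh).le).1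
    have h6 : (1 - 1 / (ℓ : ℝ) ^ 10) * (1 / τ) ≤ ∑ h ∈ range H, Real.exp (-(τ * h)) := by
      refine le_trans ?_ (le_sum_exp_neg_mul hτ0 H)
      gcongr
    have h7 := mul_le_mul_of_nonneg_left h6 (Real.exp_pos (-(ρ * (A + 10 * lam + 2)))).le
    linarith
  · have h1 : ∑ h ∈ range H, g h ≤ Real.exp (ρ * A) * (1 / τ + 1) + 1 / ℓ := by
      calc _ ≤ ∑ h ∈ range H, (Real.exp (ρ * A) * Real.exp (-(τ * h)) + 1 / (ℓ : ℝ) ^ 18) :=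
            sum_le_sum fun h hh => (hbounds h (mem_range.1 hh).le).2
        _ = Real.exp (ρ * A) * ∑ h ∈ range H, Real.exp (-(τ * h)) + H * (1 / (ℓ : ℝ) ^ 18) := by
            rw [sum_add_distrib, sum_const, card_range, nsmul_eq_mul, mul_sum]
        _ ≤ _ := by
            gcongr
            exact sum_exp_neg_mul_le hτ0 H
    have h3 : ∑ h ∈ Ico H T, g h ≤ 4 / ℓ := by
      have hgH : g H ≤ 4 / (ℓ : ℝ) ^ 10 := by
        calc g H ≤ Real.exp (ρ * A) * Real.exp (-(τ * H)) + 1 / (ℓ : ℝ) ^ 18 := (hbounds H le_rfl).2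
          _ ≤ 3 * (1 / (ℓ : ℝ) ^ 10) + 1 / (ℓ : ℝ) ^ 10 := by
              gcongr
              norm_num
          _ = _ := by ring
      calc ∑ h ∈ Ico H T, g h ≤ ∑ h ∈ Ico H T, 4 / (ℓ : ℝ) ^ 10 :=
            sum_le_sum fun h hh => (hanti H h (mem_Ico.1 hh).1).trans hgH
        _ = (T - H : ℕ) * (4 / (ℓ : ℝ) ^ 10) := by rw [sum_const, Nat.card_Ico, nsmul_eq_mul]
        _ ≤ ((ℓ : ℝ) * (ℓ : ℝ) ^ 8) * (4 / (ℓ : ℝ) ^ 10) := by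
            gcongr
            calc ((T - H : ℕ) : ℝ) ≤ (T : ℕ) := by exact_mod_cast Nat.sub_le _ _
              _ = (A : ℝ) * (ℓ : ℝ) ^ 8 := by rw [hT]; push_cast; ring
              _ ≤ _ := by gcongr
        _ = 4 / ℓ := by field_simp
    have h4 : ∑ h ∈ Ico T M, g h ≤ 10 / ℓ := by
      have htail := sum_card_gapSet_tail_le hP hP2 hA hAP (ℓ := ℓ) (by omega) hPℓ h640 h2
      calc ∑ h ∈ Ico T M, g h = (∑ h ∈ Ico T M, ((gapSet M h).card : ℝ)) / (M : ℕ) := by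
            rw [sum_div]
        _ ≤ 10 * A / (ℓ : ℝ) ^ 3 := by
            rw [div_le_iff₀ hM0, mul_comm]
            exact htail
        _ ≤ 10 * (ℓ : ℝ) / (ℓ : ℝ) ^ 3 := by gcongr
        _ = 10 / (ℓ : ℝ) ^ 2 := by field_simp
        _ ≤ 10 / (ℓ : ℝ) := by
            gcongr
            nlinarith
    rw [hsplit]
    have : 1 / (ℓ : ℝ) + 4 / ℓ + 10 / ℓ = 15 * (1 / ℓ) := by ring
    linarith

lemma ratio_bounds {x B F G c e : ℝ} (hx4 : x ≤ 1 / 4) (hB : 0 < B) (hxB : 1 ≤ x * B)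
    (hF1 : 1 ≤ 2 * F) (hlo : c * ((1 - x) * B) - 1 ≤ F) (hup : F ≤ e * (B + 1) + 1) (he : 0 ≤ e)
    (hG1 : (1 - x) ^ 2 * B ≤ G) (hG2 : G ≤ B) :
    c * (1 - x) - 3 / 2 * x ≤ (2 * F - 1) / (2 * G - 1) ∧
      (2 * F - 1) / (2 * G - 1) ≤ 2 * (e * (1 + x) + x) / (2 * (1 - x) ^ 2 - x) := by
  have hx0 : 0 < x := by
    by_contra! h
    have := mul_nonpos_of_nonpos_of_nonneg h hB.le
    linarith
  have hd : 0 < 2 * (1 - x) ^ 2 - x := by nlinarith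
  have hGd : (2 * (1 - x) ^ 2 - x) * B ≤ 2 * G - 1 := by nlinarith
  have hG0 : 0 < 2 * G - 1 := (mul_pos hd hB).trans_le hGd
  constructor
  · rw [le_div_iff₀ hG0]
    rcases le_or_gt (c * (1 - x) - 3 / 2 * x) 0 with h | h
    · have := mul_nonpos_of_nonpos_of_nonneg h hG0.le
      linarith
    · have : (c * (1 - x) - 3 / 2 * x) * (2 * G - 1) ≤ (c * (1 - x) - 3 / 2 * x) * (2 * B) := by
        gcongr
        linarith
      nlinarith
  · rw [div_le_div_iff₀ hG0 hd]
    have h1 : 2 * F - 1 ≤ 2 * (e * (1 + x) + x) * B := by nlinarith [mul_le_mul_of_nonneg_left hxB he]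
    calc (2 * F - 1) * (2 * (1 - x) ^ 2 - x)
        ≤ 2 * (e * (1 + x) + x) * B * (2 * (1 - x) ^ 2 - x) := by gcongr
      _ = 2 * (e * (1 + x) + x) * ((2 * (1 - x) ^ 2 - x) * B) := by ring
      _ ≤ _ := by gcongr

set_option exponentiation.threshold 600 in
set_option maxHeartbeats 1000000 in
lemma stoch_div_savg_bounds {P : Finset ℕ} (hP : ∀ p ∈ P, p.Prime) (hP2 : 2 ∉ P)
    (hP0 : P.Nonempty) {A : ℕ} (hA : 0 < A) (hAP : A.Coprime (∏ p ∈ P, p))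
    {ℓ : ℕ} (hℓ : 10000 ≤ ℓ) (hPℓ : ∀ p ∈ P, ℓ ^ 500 < p) (h640 : 640 ^ P.card ≤ ℓ ^ 8)
    (h2 : 2 ^ P.card ≤ ℓ) (hAℓ : A ≤ ℓ) {x lam : ℝ} (hx4 : x ≤ 1 / 4)
    (hA2 : A * ((2 : ℝ) ^ P.card)⁻¹ ≤ x) (hℓx : 1 / (ℓ : ℝ) ≤ x) (hlam : Real.log ℓ ≤ lam)
    {M : ℕ} (hM : M = A * ∏ p ∈ P, p) :
    Real.exp (-(x * (10 * lam + 3))) * (1 - x) - 3 / 2 * x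
        ≤ (stoch M (QR M) : ℝ) / ((savg M (QR M).card : ℚ) : ℝ) ∧
      (stoch M (QR M) : ℝ) / ((savg M (QR M).card : ℚ) : ℝ)
        ≤ 2 * (Real.exp x * (1 + x) + x) / (2 * (1 - x) ^ 2 - x) := by
  have hℓ0 : 0 < ℓ := by omega
  have hy : (10000 : ℝ) ≤ ℓ := by exact_mod_cast hℓ
  have hy0 : (0 : ℝ) < ℓ := by linarith
  have hy1 : (1 : ℝ) ≤ ℓ := by linarith
  have hx0 : 0 < x := lt_of_lt_of_le (by positivity) hℓx
  have hℓpow : ∀ n : ℕ, n ≠ 0 → 1 / (ℓ : ℝ) ^ n ≤ x := fun n hn =>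
    le_trans (one_div_le_one_div_of_le hy0 (le_self_pow₀ hy1 hn)) hℓx
  have hA0 : (0 : ℝ) < A := by exact_mod_cast hA
  have hA1 : (1 : ℝ) ≤ A := by exact_mod_cast hA
  have hs0 : (1 : ℝ) ≤ squareCount A := by exact_mod_cast one_le_squareCount hA
  have hsA : (squareCount A : ℝ) ≤ A := by exact_mod_cast squareCount_le A
  set ρ : ℝ := ((2 : ℝ) ^ P.card)⁻¹ with hρ
  have hρ0 : 0 < ρ := by positivity
  have hρx : ρ ≤ x := by nlinarith
  have hA2' : A ≤ 2 ^ P.card := by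
    have : (A : ℝ) * ρ ≤ 1 := by linarith
    rw [hρ, ← div_eq_mul_inv, div_le_one (by positivity)] at this
    exact_mod_cast this
  set τ : ℝ := ρ * (squareCount A / A) with hτ
  have hτ0 : 0 < τ := by positivity
  have hτρ : τ ≤ ρ := by
    have : (squareCount A : ℝ) / A ≤ 1 := (div_le_one hA0).2 hsA
    nlinarith
  have hB0 : 0 < 1 / τ := by positivity
  have hxB : 1 ≤ x * (1 / τ) := by
    rw [mul_one_div, le_div_iff₀ hτ0]; linarith
  have hprod := prod_primes_pos hP
  have hMpos : 0 < M := hM ▸ Nat.mul_pos hA hprod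
  have hM0 : (0 : ℝ) < M := by exact_mod_cast hMpos
  have hne : NeZero M := ⟨hMpos.ne'⟩
  obtain ⟨hlo, hup⟩ := sum_card_gapSet_bounds hP hP2 hP0 hA hAP hℓ hPℓ h640 h2 hAℓ hA2' hρ hτ
  rw [← hM] at hlo hup
  set F : ℝ := (∑ h ∈ range M, ((gapSet M h).card : ℝ)) / (M : ℕ) with hF
  set k := (QR M).card with hk
  have hst : (stoch M (QR M) : ℝ) = M * (2 * F - 1) := by
    rw [stoch_QR_eq, hF]; field_simp
  have hkM : k ≤ M := card_image_le.trans (card_range M).le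
  have hkeq : (k : ℝ) = squareCount A * ∏ p ∈ P, ((p + 1 : ℝ) / 2) := by
    rw [hk, hM, card_QR_eq hP hP2 hA hAP]
  have hkℓ : (ℓ : ℝ) ≤ k := by
    rw [hkeq]
    calc (ℓ : ℝ) ≤ (ℓ : ℝ) ^ P.card := le_self_pow₀ hy1 hP0.card_pos.ne'
      _ = ∏ p ∈ P, (ℓ : ℝ) := by rw [prod_const]
      _ ≤ ∏ p ∈ P, ((p + 1 : ℝ) / 2) := by
          refine prod_le_prod (fun _ _ => hy0.le) fun p hp => ?_
          have h1 : (ℓ : ℝ) ^ 500 < p := by exact_mod_cast hPℓ p hp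
          have h3 : (ℓ : ℝ) ^ 2 ≤ (ℓ : ℝ) ^ 500 := pow_le_pow_right₀ hy1 (by norm_num)
          nlinarith
      _ = 1 * ∏ p ∈ P, ((p + 1 : ℝ) / 2) := (one_mul _).symm
      _ ≤ _ := by gcongr
  have hkpos : 0 < k := by
    have : (0 : ℝ) < k := by linarith
    exact_mod_cast this
  set G : ℝ := (M + 1) / (k + 1) with hG
  have hk1 : (0 : ℝ) < k + 1 := by positivity
  have hsv : ((savg M k : ℚ) : ℝ) = M * (2 * G - 1) := by
    rw [savg_eq hkpos hkM, hG]
    push_cast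
    field_simp
  have hkB : k * (1 / τ) = A * ∏ p ∈ P, ((p : ℝ) + 1) := by
    rw [hkeq, hτ, hρ, prod_div_distrib, prod_const]
    field_simp
  have hMr : (M : ℝ) = A * ∏ p ∈ P, (p : ℝ) := by rw [hM]; push_cast; ring
  have hle : (M : ℝ) ≤ k * (1 / τ) := by
    rw [hkB, hMr]
    gcongr
    linarith
  have hge : (1 - x) * (k * (1 / τ)) ≤ M := by
    have h1 : ∏ p ∈ P, ((p : ℝ) + 1) ≤ (∏ p ∈ P, (p : ℝ)) * Real.exp x := by
      calc ∏ p ∈ P, ((p : ℝ) + 1) ≤ ∏ p ∈ P, ((p : ℝ) * Real.exp (1 / (ℓ : ℝ) ^ 500)) := by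
            refine prod_le_prod (fun _ _ => by positivity) fun p hp => ?_
            have hp1 : (ℓ : ℝ) ^ 500 ≤ p := by exact_mod_cast (hPℓ p hp).le
            have hp2 : 1 ≤ (p : ℝ) * (1 / (ℓ : ℝ) ^ 500) := by
              rw [mul_one_div, le_div_iff₀ (by positivity)]
              linarith
            have := mul_le_mul_of_nonneg_left (Real.add_one_le_exp (1 / (ℓ : ℝ) ^ 500))
              (Nat.cast_nonneg (α := ℝ) p)
            linarith
        _ = (∏ p ∈ P, (p : ℝ)) * Real.exp (P.card * (1 / (ℓ : ℝ) ^ 500)) := by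
            rw [prod_mul_distrib, prod_const, Real.exp_nat_mul]
        _ ≤ _ := by
            gcongr
            have hw : (P.card : ℝ) ≤ ℓ := by
              have : P.card < 2 ^ P.card := Nat.lt_two_pow_self
              exact_mod_cast (this.le.trans h2)
            calc (P.card : ℝ) * (1 / (ℓ : ℝ) ^ 500) ≤ ℓ * (1 / (ℓ : ℝ) ^ 500) := by gcongr
              _ = 1 / (ℓ : ℝ) ^ 499 := by
                  rw [pow_succ (ℓ : ℝ) 499]
                  field_simp
              _ ≤ x := hℓpow 499 (by norm_num)
    have h3 : (1 - x) * Real.exp x ≤ 1 := by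
      calc (1 - x) * Real.exp x ≤ Real.exp (-x) * Real.exp x := by
            gcongr
            exact Real.one_sub_le_exp_neg x
        _ = 1 := by rw [← Real.exp_add, neg_add_cancel, Real.exp_zero]
    have h4 : (0 : ℝ) ≤ ∏ p ∈ P, (p : ℝ) := by positivity
    rw [hkB, hMr]
    calc (1 - x) * (A * ∏ p ∈ P, ((p : ℝ) + 1))
        ≤ (1 - x) * (A * ((∏ p ∈ P, (p : ℝ)) * Real.exp x)) := by
          have : 0 ≤ 1 - x := by linarith
          gcongr
      _ = A * (∏ p ∈ P, (p : ℝ)) * ((1 - x) * Real.exp x) := by ring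
      _ ≤ A * (∏ p ∈ P, (p : ℝ)) * 1 := by gcongr
      _ = _ := mul_one _
  have hB1 : 1 ≤ 1 / τ := by
    rw [le_div_iff₀ hτ0]; linarith
  have hG2 : G ≤ 1 / τ := by
    rw [hG, div_le_iff₀ hk1]
    linarith
  have hG1 : (1 - x) ^ 2 * (1 / τ) ≤ G := by
    rw [hG, le_div_iff₀ hk1]
    have h1 : (1 - x) * (k + 1) ≤ k := by
      have : 1 ≤ x * ℓ := by rwa [div_le_iff₀ hy0] at hℓx
      have h3 : x * ℓ ≤ x * k := by gcongr
      linarith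
    have h3 : 0 ≤ (1 - x) * (1 / τ) := mul_nonneg (by linarith) hB0.le
    nlinarith [mul_le_mul_of_nonneg_left h1 h3]
  have hF1 : 1 ≤ 2 * F := by
    have : 0 ≤ (M : ℝ) * (2 * F - 1) := hst ▸ Nat.cast_nonneg _
    have := nonneg_of_mul_nonneg_right this hM0
    linarith
  rw [hst, hsv, mul_div_mul_left _ _ hM0.ne']
  refine ratio_bounds hx4 hB0 hxB hF1 ?_ ?_ (Real.exp_pos _).le hG1 hG2
  · refine le_trans ?_ hlo
    have hlog : 0 ≤ Real.log ℓ := Real.log_nonneg hy1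
    have h1 : ρ * (A + 10 * Real.log ℓ + 2) ≤ x * (10 * lam + 3) := by
      have : ρ * (10 * Real.log ℓ + 2) ≤ x * (10 * lam + 2) := by gcongr
      linarith
    have h3 : 0 ≤ (1 - x) * (1 / τ) := mul_nonneg (by linarith) hB0.le
    have h4 := hℓpow 10 (by norm_num)
    refine sub_le_sub_right (mul_le_mul (Real.exp_le_exp.2 (neg_le_neg h1))
      (mul_le_mul_of_nonneg_right (by linarith) hB0.le) h3 (Real.exp_pos _).le) 1
  · refine hup.trans ?_
    have : ρ * A ≤ x := by linarith
    exact add_le_add_left (mul_le_mul_of_nonneg_right (Real.exp_le_exp.2 this) (by linarith)) 1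

set_option exponentiation.threshold 600 in
lemma stoch_div_savg_bounds_of_inOmega {M : ℕ} (hL : 10001 ≤ Real.log M)
    (hLL : 30 ≤ Real.log (Real.log M)) (hM : inOmega 500 M)
    {x lam : ℝ} (hlam : lam = Real.log (Real.log M)) (hx : x = Real.exp (-(2 / 5 * lam))) :
    Real.exp (-(x * (10 * lam + 3))) * (1 - x) - 3 / 2 * x
        ≤ (stoch M (QR M) : ℝ) / ((savg M (QR M).card : ℚ) : ℝ) ∧
      (stoch M (QR M) : ℝ) / ((savg M (QR M).card : ℚ) : ℝ)
        ≤ 2 * (Real.exp x * (1 + x) + x) / (2 * (1 - x) ^ 2 - x) := by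
  obtain ⟨hsq, hω1, hω2, A, m, hMA, hA3, hAL, hp⟩ := hM
  rw [← hlam] at hLL hω1 hω2
  set L := Real.log M with hLd
  have hL0 : 0 < L := by linarith
  have hLexp : L = Real.exp lam := by rw [hlam, Real.exp_log hL0]
  rw [hMA, Nat.squarefree_mul_iff] at hsq
  obtain ⟨hcop, -, hsqm⟩ := hsq
  set P := m.primeFactors with hPd
  have hPm : ∏ p ∈ P, p = m := Nat.prod_primeFactors_of_squarefree hsqm
  set ℓ := ⌊L⌋₊ with hℓd
  have hℓL : (ℓ : ℝ) ≤ L := Nat.floor_le hL0.le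
  have hLℓ : L - 1 < ℓ := Nat.sub_one_lt_floor L
  have hℓ : 10000 ≤ ℓ := Nat.le_floor (by push_cast; linarith)
  have hy : (10000 : ℝ) ≤ ℓ := by exact_mod_cast hℓ
  have hℓexp : Real.exp (lam - 1) ≤ ℓ := by
    rw [Real.exp_sub, ← hLexp, div_le_iff₀ (Real.exp_pos 1)]
    nlinarith [Real.add_one_le_exp (1 : ℝ)]
  have hAexp : (A : ℝ) ≤ Real.exp (0.1 * lam) := by
    rwa [Real.rpow_def_of_pos hL0, ← hlam, mul_comm] at hAL
  have hcard : M.primeFactors.card = A.primeFactors.card + P.card := by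
    rw [hMA, hcop.primeFactors_mul, card_union_of_disjoint hcop.disjoint_primeFactors]
  have hωA : (2 : ℝ) ^ A.primeFactors.card ≤ A := by
    have h1 : 2 ^ A.primeFactors.card ≤ ∏ p ∈ A.primeFactors, p :=
      pow_card_le_prod _ _ _ fun p hp => (Nat.prime_of_mem_primeFactors hp).two_le
    have h3 := h1.trans (Nat.le_of_dvd (by omega) (Nat.prod_primeFactors_dvd A))
    exact_mod_cast h3
  have hpow : ∀ n : ℕ, (2 : ℝ) ^ n = Real.exp (n * Real.log 2) := fun n => by
    rw [Real.exp_nat_mul, Real.exp_log (by norm_num)]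
  have hl1 := Real.log_two_gt_d9
  have hl2 := Real.log_two_lt_d9
  have hbig : Real.exp (0.6 * lam) ≤ A * (2 : ℝ) ^ P.card := by
    calc Real.exp (0.6 * lam) ≤ (2 : ℝ) ^ M.primeFactors.card := by
          rw [hpow, Real.exp_le_exp]
          nlinarith
      _ = (2 : ℝ) ^ A.primeFactors.card * (2 : ℝ) ^ P.card := by rw [hcard, pow_add]
      _ ≤ _ := by gcongr
  have hsmall : (2 : ℝ) ^ P.card ≤ Real.exp (0.77 * lam) := by
    calc (2 : ℝ) ^ P.card ≤ (2 : ℝ) ^ M.primeFactors.card := by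
          refine pow_le_pow_right₀ (by norm_num) ?_
          rw [hcard]
          omega
      _ ≤ _ := by
          rw [hpow, Real.exp_le_exp]
          nlinarith
  have hx4 : x ≤ 1 / 4 := by
    rw [hx, Real.exp_neg, one_div]
    refine inv_anti₀ (by norm_num) ?_
    linarith [Real.add_one_le_exp (2 / 5 * lam)]
  have hA2 : A * ((2 : ℝ) ^ P.card)⁻¹ ≤ x := by
    rw [← div_eq_mul_inv, div_le_iff₀ (by positivity)]
    have h1 : (A : ℝ) * A ≤ Real.exp (-(2 / 5 * lam)) * Real.exp (0.6 * lam) := by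
      calc (A : ℝ) * A ≤ Real.exp (0.1 * lam) * Real.exp (0.1 * lam) := by gcongr
        _ = Real.exp (0.1 * lam + 0.1 * lam) := (Real.exp_add _ _).symm
        _ ≤ Real.exp (-(2 / 5 * lam) + 0.6 * lam) := Real.exp_le_exp.2 (by linarith)
        _ = _ := Real.exp_add _ _
    have hA0 : (0 : ℝ) < A := by
      have : 0 < A := by omega
      exact_mod_cast this
    have h3 : (A : ℝ) * A ≤ x * (A * (2 : ℝ) ^ P.card) := by
      rw [hx]
      exact h1.trans (by gcongr)
    refine le_of_mul_le_mul_left ?_ hA0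
    linarith
  have hP0 : P.Nonempty := by
    by_contra h
    rw [not_nonempty_iff_eq_empty] at h
    rw [h, card_empty, pow_zero, inv_one, mul_one] at hA2
    have : (3 : ℝ) ≤ A := by exact_mod_cast hA3
    linarith
  have hPℓ : ∀ p ∈ P, ℓ ^ 500 < p := fun p hpP => by
    have h1 := hp p (Nat.prime_of_mem_primeFactors hpP) (Nat.dvd_of_mem_primeFactors hpP)
    have h3 : (ℓ : ℝ) ^ 500 < p := by
      refine lt_of_le_of_lt ?_ h1
      rw [Real.rpow_ofNat]
      gcongr
    exact_mod_cast h3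
  have h2 : (2 : ℝ) ^ P.card ≤ ℓ :=
    hsmall.trans ((Real.exp_le_exp.2 (by linarith)).trans hℓexp)
  have h640 : (640 : ℝ) ^ P.card ≤ (ℓ : ℝ) ^ 8 := by
    calc (640 : ℝ) ^ P.card ≤ ((2 : ℝ) ^ 10) ^ P.card := by gcongr; norm_num
      _ = ((2 : ℝ) ^ P.card) ^ 10 := by rw [← pow_mul, ← pow_mul, mul_comm]
      _ ≤ Real.exp (0.77 * lam) ^ 10 := by gcongr
      _ ≤ Real.exp (lam - 1) ^ 8 := by
          rw [← Real.exp_nat_mul, ← Real.exp_nat_mul, Real.exp_le_exp]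
          push_cast
          linarith
      _ ≤ _ := by gcongr
  refine stoch_div_savg_bounds (fun p hp => Nat.prime_of_mem_primeFactors hp) (fun h => ?_) hP0
    (by omega) (by rwa [hPm]) hℓ hPℓ (by exact_mod_cast h640) (by exact_mod_cast h2) ?_ hx4 hA2 ?_
    ?_ (by rw [hPm, hMA])
  · have h1 := hPℓ 2 h
    have h3 : ℓ ≤ ℓ ^ 500 := Nat.le_self_pow (by norm_num) ℓ
    omega
  · have : (A : ℝ) ≤ ℓ := hAexp.trans ((Real.exp_le_exp.2 (by linarith)).trans hℓexp)
    exact_mod_cast this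
  · rw [hx, Real.exp_neg, one_div]
    exact inv_anti₀ (Real.exp_pos _) ((Real.exp_le_exp.2 (by linarith)).trans hℓexp)
  · rw [hlam]
    exact Real.log_le_log (by linarith) hℓL

/-- Corollary of Theorems 1.4 and 1.5: there is an absolute constant `C₀ > 2` such that
`S(R_M)/s(|R_M|) → 1` as `M → ∞` along `M ∈ Ω(C₀)`. -/
theorem stmt_5 :
    ∃ C₀ : ℝ, 2 < C₀ ∧
      Filter.Tendsto
        (fun M : ℕ => (stoch M (QR M) : ℝ) / ((savg M (QR M).card : ℚ) : ℝ))
        (Filter.atTop ⊓ Filter.principal {M : ℕ | inOmega C₀ M})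
        (nhds 1) := by
  refine ⟨500, by norm_num, ?_⟩
  have hlog : Filter.Tendsto (fun M : ℕ => Real.log M) Filter.atTop Filter.atTop :=
    Real.tendsto_log_atTop.comp tendsto_natCast_atTop_atTop
  have hll : Filter.Tendsto (fun M : ℕ => Real.log (Real.log M)) Filter.atTop Filter.atTop :=
    Real.tendsto_log_atTop.comp hlog
  have hx : Filter.Tendsto (fun t : ℝ => Real.exp (-(2 / 5 * t))) Filter.atTop (nhds 0) :=
    Real.tendsto_exp_neg_atTop_nhds_zero.comp
      (Filter.tendsto_id.const_mul_atTop (by norm_num : (0 : ℝ) < 2 / 5))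
  have hxt : Filter.Tendsto (fun t : ℝ => Real.exp (-(2 / 5 * t)) * (10 * t + 3)) Filter.atTop
      (nhds 0) := by
    have h1 := (Real.tendsto_pow_mul_exp_neg_atTop_nhds_zero 1).comp
      (Filter.tendsto_id.const_mul_atTop (by norm_num : (0 : ℝ) < 2 / 5))
    have h2 := (h1.const_mul 25).add (hx.const_mul 3)
    rw [mul_zero, mul_zero, add_zero] at h2
    refine h2.congr fun t => ?_
    simp only [Function.comp_apply, id_eq, pow_one]
    ring
  have hlo : Filter.Tendsto (fun t : ℝ => Real.exp (-(Real.exp (-(2 / 5 * t)) * (10 * t + 3)))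
      * (1 - Real.exp (-(2 / 5 * t))) - 3 / 2 * Real.exp (-(2 / 5 * t))) Filter.atTop (nhds 1) := by
    have h := ((Real.continuous_exp.tendsto _).comp hxt.neg).mul (hx.const_sub 1)
    have h' := h.sub (hx.const_mul (3 / 2))
    norm_num at h'
    exact h'
  have hup : Filter.Tendsto (fun t : ℝ => 2 * (Real.exp (Real.exp (-(2 / 5 * t)))
      * (1 + Real.exp (-(2 / 5 * t))) + Real.exp (-(2 / 5 * t)))
      / (2 * (1 - Real.exp (-(2 / 5 * t))) ^ 2 - Real.exp (-(2 / 5 * t)))) Filter.atTop (nhds 1) := by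
    have hc : ContinuousAt (fun x : ℝ => 2 * (Real.exp x * (1 + x) + x) / (2 * (1 - x) ^ 2 - x))
        0 := by
      refine ContinuousAt.div (by fun_prop) (by fun_prop) (by norm_num)
    have := hc.tendsto.comp hx
    norm_num at this
    exact this
  have hev : ∀ᶠ M : ℕ in Filter.atTop ⊓ Filter.principal {M : ℕ | inOmega 500 M},
      10001 ≤ Real.log M ∧ 30 ≤ Real.log (Real.log M) ∧ inOmega 500 M := by
    filter_upwards [(hlog.eventually_ge_atTop 10001).filter_mono inf_le_left,
      (hll.eventually_ge_atTop 30).filter_mono inf_le_left,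
      Filter.mem_inf_of_right (Filter.mem_principal_self _)] with M h1 h2 h3
    exact ⟨h1, h2, h3⟩
  refine tendsto_of_tendsto_of_tendsto_of_le_of_le' ((hlo.comp hll).mono_left inf_le_left)
    ((hup.comp hll).mono_left inf_le_left) ?_ ?_
  · filter_upwards [hev] with M hM
    exact (stoch_div_savg_bounds_of_inOmega hM.1 hM.2.1 hM.2.2 rfl rfl).1
  · filter_upwards [hev] with M hM
    exact (stoch_div_savg_bounds_of_inOmega hM.1 hM.2.1 hM.2.2 rfl rfl).2
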